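/- If every factor of a recurrent infinite binary word w has at most three abelian returns and at least two semi-abelian returns, then w is 2-balanced. -/

import Mathlib

/-- The factor of length `n` of the infinite word `w` starting at position `i`. -/
def wordAt {α : Type*} (w : ℕ → α) (i n : ℕ) : List α :=
  (List.range n).map (fun k => w (i + k))

/-- `u` is a factor of the infinite word `w`. -/
def IsFactorW {α : Type*} (w : ℕ → α) (u : List α) : Prop :=
  ∃ i, u = wordAt w i u.length

/-- `w` is recurrent: every factor occurs infinitely often. -/
def RecurrentW {α : Type*} (w : ℕ → α) : Prop :=
  ∀ u, IsFactorW w u → ∀ N, ∃ i, N ≤ i ∧ u = wordAt w i u.length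

/-- `w` is (purely) periodic. -/
def PeriodicW {α : Type*} (w : ℕ → α) : Prop :=
  ∃ T, 0 < T ∧ ∀ n, w (n + T) = w n

/-- `w` is ultimately periodic. -/
def UltPeriodicW {α : Type*} (w : ℕ → α) : Prop :=
  ∃ T, 0 < T ∧ ∃ n₀, ∀ n, n₀ ≤ n → w (n + T) = w n

/-- Two finite words are abelian equivalent: same number of occurrences of each letter. -/
def AbEquiv {α : Type*} [DecidableEq α] (u v : List α) : Prop :=
  ∀ a : α, u.count a = v.count a

/-- Positions of occurrences of words abelian equivalent to `u` in `w`. -/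
def abOcc {α : Type*} [DecidableEq α] (w : ℕ → α) (u : List α) : Set ℕ :=
  {i | AbEquiv (wordAt w i u.length) u}

/-- The semi-abelian returns to (the abelian class of) `u` in `w`: words extending from one
occurrence of the abelian class of `u` to the next one. -/
def semiAbReturns {α : Type*} [DecidableEq α] (w : ℕ → α) (u : List α) : Set (List α) :=
  {r | ∃ i j, i ∈ abOcc w u ∧ j ∈ abOcc w u ∧ i < j ∧
      (∀ k, i < k → k < j → k ∉ abOcc w u) ∧ r = wordAt w i (j - i)}

/-- Positions of (exact) occurrences of `u` in `w`. -/
def occW {α : Type*} [DecidableEq α] (w : ℕ → α) (u : List α) : Set ℕ :=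
  {i | u = wordAt w i u.length}

/-- The ordinary return words of `u` in `w`. -/
def returnWords {α : Type*} [DecidableEq α] (w : ℕ → α) (u : List α) : Set (List α) :=
  {r | ∃ i j, i ∈ occW w u ∧ j ∈ occW w u ∧ i < j ∧
      (∀ k, i < k → k < j → k ∉ occW w u) ∧ r = wordAt w i (j - i)}

/-- `u` has exactly `k` semi-abelian returns in `w`. -/
def ExactlyKSemiAbReturns {α : Type*} [DecidableEq α] (w : ℕ → α) (u : List α) (k : ℕ) : Prop :=
  ∃ f : Fin k → List α, Function.Injective f ∧ semiAbReturns w u = Set.range f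

/-- `u` has exactly `k` abelian returns in `w`: there are `k` pairwise non-abelian-equivalent
representatives so that every semi-abelian return is abelian equivalent to exactly one of them,
and each representative is realized. -/
def ExactlyKAbReturns {α : Type*} [DecidableEq α] (w : ℕ → α) (u : List α) (k : ℕ) : Prop :=
  ∃ f : Fin k → List α,
    (∀ i j, AbEquiv (f i) (f j) → i = j) ∧
    (∀ r ∈ semiAbReturns w u, ∃ i, AbEquiv r (f i)) ∧
    (∀ i, ∃ r ∈ semiAbReturns w u, AbEquiv r (f i))

/-- `u` has at most `k` abelian returns in `w`. -/
def AtMostKAbReturns {α : Type*} [DecidableEq α] (w : ℕ → α) (u : List α) (k : ℕ) : Prop :=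
  ∃ f : Fin k → List α, ∀ r ∈ semiAbReturns w u, ∃ i, AbEquiv r (f i)

/-- `u` has at least `k` abelian returns in `w`. -/
def AtLeastKAbReturns {α : Type*} [DecidableEq α] (w : ℕ → α) (u : List α) (k : ℕ) : Prop :=
  ∃ f : Fin k → List α,
    (∀ i j, AbEquiv (f i) (f j) → i = j) ∧
    (∀ i, ∃ r ∈ semiAbReturns w u, AbEquiv r (f i))

/-- `u` has at least two semi-abelian returns in `w`. -/
def AtLeastTwoSemiAbReturns {α : Type*} [DecidableEq α] (w : ℕ → α) (u : List α) : Prop :=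
  ∃ r₁ r₂, r₁ ∈ semiAbReturns w u ∧ r₂ ∈ semiAbReturns w u ∧ r₁ ≠ r₂

/-- The factor complexity of `w`. -/
noncomputable def complexityW {α : Type*} (w : ℕ → α) (n : ℕ) : ℕ :=
  {u : List α | u.length = n ∧ IsFactorW w u}.ncard

/-- A Sturmian word: aperiodic binary word with factor complexity `n + 1`. -/
def SturmianW (w : ℕ → Bool) : Prop :=
  ¬ UltPeriodicW w ∧ ∀ n, complexityW w n = n + 1

/-- Right special factor of a binary word. -/
def RightSpecial (w : ℕ → Bool) (B : List Bool) : Prop :=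
  IsFactorW w (B ++ [false]) ∧ IsFactorW w (B ++ [true])

/-- Left special factor of a binary word. -/
def LeftSpecial (w : ℕ → Bool) (B : List Bool) : Prop :=
  IsFactorW w (false :: B) ∧ IsFactorW w (true :: B)

/-- Bispecial factor of a binary word. -/
def Bispecial (w : ℕ → Bool) (B : List Bool) : Prop :=
  RightSpecial w B ∧ LeftSpecial w B

/-- `w` is `c`-balanced. -/
def CBalanced {α : Type*} [DecidableEq α] (w : ℕ → α) (c : ℕ) : Prop :=
  ∀ u v : List α, IsFactorW w u → IsFactorW w v → u.length = v.length →
    ∀ a : α, |((u.count a : ℤ) - (v.count a : ℤ))| ≤ (c : ℤ)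

/-- The number of ones among the first `n` letters of `w`. -/
def ones (w : ℕ → Bool) : ℕ → ℕ
  | 0 => 0
  | n + 1 => ones w n + (w n).toNat

/-- `i < j` are consecutive starting positions of factors of length `n` with `k` ones. -/
def Ret (w : ℕ → Bool) (n k i j : ℕ) : Prop :=
  i < j ∧ ones w (i + n) = ones w i + k ∧ ones w (j + n) = ones w j + k ∧
    ∀ x, i < x → x < j → ones w (x + n) ≠ ones w x + k

/-- The abelian class `(n, k)` has a return of length `l` with `m` ones. -/
def HasRet (w : ℕ → Bool) (n k l m : ℕ) : Prop :=
  ∃ i, Ret w n k i (i + l) ∧ ones w (i + l) = ones w i + m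

/-- The hypotheses on the word, expressed with prefix counts. -/
structure Good (w : ℕ → Bool) : Prop where
  four : ∀ {n k l₁ m₁ l₂ m₂ l₃ m₃ l₄ m₄ : ℕ}, 0 < n → HasRet w n k l₁ m₁ → HasRet w n k l₂ m₂ →
    HasRet w n k l₃ m₃ → HasRet w n k l₄ m₄ → ¬(l₁ = l₂ ∧ m₁ = m₂) → ¬(l₁ = l₃ ∧ m₁ = m₃) →
    ¬(l₁ = l₄ ∧ m₁ = m₄) → ¬(l₂ = l₃ ∧ m₂ = m₃) → ¬(l₂ = l₄ ∧ m₂ = m₄) →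
    ¬(l₃ = l₄ ∧ m₃ = m₄) → False
  two : ∀ {n k i : ℕ}, 0 < n → ones w (i + n) = ones w i + k → ∀ N, ∃ i₁ l₁ i₂ l₂,
    N ≤ i₁ ∧ N ≤ i₂ ∧ Ret w n k i₁ (i₁ + l₁) ∧ Ret w n k i₂ (i₂ + l₂) ∧
      ¬(l₁ = l₂ ∧ ∀ r, r < l₁ → w (i₁ + r) = w (i₂ + r))
  recur : ∀ i n N, ∃ j, N ≤ j ∧ ∀ r, r < n → w (j + r) = w (i + r)

theorem ones_succ (w : ℕ → Bool) (n : ℕ) : ones w (n + 1) = ones w n + (w n).toNat := rfl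

theorem ones_true {w : ℕ → Bool} {n : ℕ} (h : w n = true) : ones w (n + 1) = ones w n + 1 := by
  simp [ones_succ, h]

theorem ones_false {w : ℕ → Bool} {n : ℕ} (h : w n = false) : ones w (n + 1) = ones w n := by
  simp [ones_succ, h]

theorem ones_add_congr {w v : ℕ → Bool} {i j n : ℕ} (h : ∀ r, r < n → w (i + r) = v (j + r))
    {r : ℕ} (hr : r ≤ n) : ones w (i + r) + ones v j = ones v (j + r) + ones w i := by
  induction r with
  | zero => simp [add_comm]
  | succ r ih =>
    have h1 := ih (by omega)
    have h2 := h r (by omega)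
    rw [← add_assoc, ← add_assoc, ones_succ, ones_succ, h2]
    omega

theorem ones_le (w : ℕ → Bool) (i n : ℕ) :
    ones w i ≤ ones w (i + n) ∧ ones w (i + n) ≤ ones w i + n := by
  induction n with
  | zero => simp
  | succ n ih =>
    have := Bool.toNat_le (w (i + n))
    rw [← add_assoc, ones_succ]
    omega

theorem ones_mono (w : ℕ → Bool) {i j : ℕ} (h : i ≤ j) :
    ones w i ≤ ones w j ∧ ones w j ≤ ones w i + (j - i) := by
  have := ones_le w i (j - i)
  rwa [Nat.add_sub_cancel' h] at this

theorem ones_eq_zeros {w : ℕ → Bool} {i n : ℕ} (h : ∀ r, r < n → w (i + r) = false) {r : ℕ}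
    (hr : r ≤ n) : ones w (i + r) = ones w i := by
  induction r with
  | zero => rfl
  | succ r ih => rw [← add_assoc, ones_false (h r (by omega)), ih (by omega)]

theorem ones_eq_ones {w : ℕ → Bool} {i n : ℕ} (h : ∀ r, r < n → w (i + r) = true) {r : ℕ}
    (hr : r ≤ n) : ones w (i + r) = ones w i + r := by
  induction r with
  | zero => rfl
  | succ r ih => rw [← add_assoc, ones_true (h r (by omega)), ih (by omega)]; rfl

theorem length_wordAt (w : ℕ → Bool) (i n : ℕ) : (wordAt w i n).length = n := by
  simp [wordAt]

theorem wordAt_succ (w : ℕ → Bool) (i n : ℕ) : wordAt w i (n + 1) = wordAt w i n ++ [w (i + n)] :=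
    by
  simp [wordAt, List.range_succ]

theorem ones_add (w : ℕ → Bool) (i n : ℕ) :
    ones w (i + n) = ones w i + (wordAt w i n).count true := by
  induction n with
  | zero => simp [wordAt]
  | succ n ih =>
    rw [← add_assoc, ones_succ, ih, wordAt_succ, List.count_append]
    cases w (i + n) <;> simp [add_assoc]

theorem count_false_add (u : List Bool) : u.count false + u.count true = u.length := by
  induction u with
  | nil => rfl
  | cons a u ih => cases a <;> simp <;> omega

theorem wordAt_eq_iff (w : ℕ → Bool) (i j n : ℕ) :
    wordAt w i n = wordAt w j n ↔ ∀ r, r < n → w (i + r) = w (j + r) := by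
  simp [wordAt]

theorem abEquiv_iff {u v : List Bool} :
    AbEquiv u v ↔ u.length = v.length ∧ u.count true = v.count true := by
  have h1 := count_false_add u
  have h2 := count_false_add v
  constructor
  · intro h
    have h3 := h true
    have h4 := h false
    omega
  · rintro ⟨h3, h4⟩ (_ | _) <;> omega

theorem mem_abOcc_iff (w : ℕ → Bool) (i x n : ℕ) :
    x ∈ abOcc w (wordAt w i n) ↔ ones w (x + n) = ones w x + (wordAt w i n).count true := by
  rw [abOcc, Set.mem_ofPred_eq, abEquiv_iff, length_wordAt, length_wordAt, ones_add]
  simp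

theorem mem_semiAbReturns_iff (w : ℕ → Bool) (i n : ℕ) (u : List Bool) :
    u ∈ semiAbReturns w (wordAt w i n) ↔
      ∃ x l, Ret w n ((wordAt w i n).count true) x (x + l) ∧ u = wordAt w x l := by
  simp only [semiAbReturns, Set.mem_ofPred_eq, mem_abOcc_iff, Ret]
  constructor
  · rintro ⟨x, y, h1, h2, h3, h4, h5⟩
    refine ⟨x, y - x, ?_, h5⟩
    rw [Nat.add_sub_cancel' h3.le]
    exact ⟨h3, h1, h2, h4⟩
  · rintro ⟨x, l, ⟨h1, h2, h3, h4⟩, h5⟩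
    exact ⟨x, x + l, h2, h3, h1, h4, by rw [h5, Nat.add_sub_cancel_left]⟩

theorem Ret.congr {w v : ℕ → Bool} {n k i j l : ℕ} (h : Ret w n k i (i + l))
    (hw : ∀ r, r < l + n → v (j + r) = w (i + r)) : Ret v n k j (j + l) := by
  obtain ⟨h1, h2, h3, h4⟩ := h
  have key := fun r (hr : r ≤ l + n) => ones_add_congr hw hr
  refine ⟨by omega, ?_, ?_, ?_⟩
  · have := key n (by omega)
    omega
  · have h5 := key (l + n) le_rfl
    have h6 := key l (by omega)
    simp only [← add_assoc] at h5
    omega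
  · intro x hx hx'
    obtain ⟨r, rfl⟩ := Nat.exists_eq_add_of_lt hx
    have h5 := key (r + 1 + n) (by omega)
    have h6 := key (r + 1) (by omega)
    have h7 := h4 (i + r + 1) (by omega) (by omega)
    simp only [← add_assoc] at h5 h6
    omega

theorem good_of_returns (w : ℕ → Bool) (hrec : RecurrentW w)
    (h : ∀ u, IsFactorW w u → u ≠ [] → AtMostKAbReturns w u 3 ∧ AtLeastTwoSemiAbReturns w u) :
    Good w := by
  have hrecur : ∀ i n N, ∃ j, N ≤ j ∧ ∀ r, r < n → w (j + r) = w (i + r) := by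
    intro i n N
    obtain ⟨j, hj, he⟩ := hrec (wordAt w i n) ⟨i, by rw [length_wordAt]⟩ N
    rw [length_wordAt, wordAt_eq_iff] at he
    exact ⟨j, hj, fun r hr => (he r hr).symm⟩
  have hfac : ∀ i n, 0 < n → AtMostKAbReturns w (wordAt w i n) 3 ∧
      AtLeastTwoSemiAbReturns w (wordAt w i n) := by
    intro i n hn
    refine h _ ⟨i, by rw [length_wordAt]⟩ fun h0 => ?_
    have := length_wordAt w i n
    rw [h0] at this
    simp at this
    omega
  refine ⟨?_, ?_, hrecur⟩
  · intro n k l₁ m₁ l₂ m₂ l₃ m₃ l₄ m₄ hn h1 h2 h3 h4 d12 d13 d14 d23 d24 d34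
    have hk : ∀ i, ones w (i + n) = ones w i + k → (wordAt w i n).count true = k := by
      intro i hi
      have := ones_add w i n
      omega
    obtain ⟨i₀, hr₀, -⟩ := id h1
    have hk₀ := hk i₀ hr₀.2.1
    obtain ⟨f, hf⟩ := (hfac i₀ n hn).1
    have key : ∀ l m, HasRet w n k l m →
        ∃ a : Fin 3, (f a).length = l ∧ (f a).count true = m := by
      rintro l m ⟨i, hr, hm⟩
      obtain ⟨a, ha⟩ := hf (wordAt w i l)
        ((mem_semiAbReturns_iff w i₀ n _).2 ⟨i, l, by rwa [hk₀], rfl⟩)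
      rw [abEquiv_iff, length_wordAt] at ha
      have := ones_add w i l
      exact ⟨a, by omega, by omega⟩
    obtain ⟨a, ha, ha'⟩ := key _ _ h1
    obtain ⟨b, hb, hb'⟩ := key _ _ h2
    obtain ⟨c, hc, hc'⟩ := key _ _ h3
    obtain ⟨d, hd, hd'⟩ := key _ _ h4
    have e1 : a ≠ b := by rintro rfl; omega
    have e2 : a ≠ c := by rintro rfl; omega
    have e3 : a ≠ d := by rintro rfl; omega
    have e4 : b ≠ c := by rintro rfl; omega
    have e5 : b ≠ d := by rintro rfl; omega
    have e6 : c ≠ d := by rintro rfl; omega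
    omega
  · intro n k i hn hk N
    have hk' : (wordAt w i n).count true = k := by
      have := ones_add w i n
      omega
    obtain ⟨u₁, u₂, h1, h2, hne⟩ := (hfac i n hn).2
    rw [mem_semiAbReturns_iff, hk'] at h1 h2
    obtain ⟨x₁, l₁, hr₁, rfl⟩ := h1
    obtain ⟨x₂, l₂, hr₂, rfl⟩ := h2
    obtain ⟨y₁, hy₁, hy₁'⟩ := hrecur x₁ (l₁ + n) N
    obtain ⟨y₂, hy₂, hy₂'⟩ := hrecur x₂ (l₂ + n) N
    refine ⟨y₁, l₁, y₂, l₂, hy₁, hy₂, hr₁.congr hy₁', hr₂.congr hy₂', ?_⟩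
    rintro ⟨rfl, he⟩
    refine hne ((wordAt_eq_iff _ _ _ _).2 fun r hr => ?_)
    rw [← hy₁' r (by omega), ← hy₂' r (by omega), he r hr]

theorem ones_compl (w : ℕ → Bool) (n : ℕ) : ones (fun x => !w x) n + ones w n = n := by
  induction n with
  | zero => rfl
  | succ n ih =>
    rw [ones_succ, ones_succ]
    cases w n <;> simp <;> omega

theorem Ret.compl {w : ℕ → Bool} {n k i j : ℕ} (h : Ret (fun x => !w x) n k i j) :
    Ret w n (n - k) i j := by
  obtain ⟨h1, h2, h3, h4⟩ := h
  have key := ones_compl w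
  have a1 := key i
  have a2 := key (i + n)
  have a3 := key j
  have a4 := key (j + n)
  have a5 := ones_le w i n
  refine ⟨h1, by omega, by omega, fun x hx hx' => ?_⟩
  have := h4 x hx hx'
  have a1 := key x
  have a2 := key (x + n)
  omega

theorem HasRet.compl {w : ℕ → Bool} {n k l m : ℕ} (h : HasRet (fun x => !w x) n k l m) :
    HasRet w n (n - k) l (l - m) ∧ m ≤ l := by
  obtain ⟨i, h1, h2⟩ := h
  have a1 := ones_compl w i
  have a2 := ones_compl w (i + l)
  have a3 := ones_le w i l
  exact ⟨⟨i, h1.compl, by omega⟩, by omega⟩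

theorem Good.compl {w : ℕ → Bool} (h : Good w) : Good (fun x => !w x) := by
  refine ⟨?_, ?_, ?_⟩
  · intro n k l₁ m₁ l₂ m₂ l₃ m₃ l₄ m₄ hn h1 h2 h3 h4 d12 d13 d14 d23 d24 d34
    obtain ⟨h1, e1⟩ := h1.compl
    obtain ⟨h2, e2⟩ := h2.compl
    obtain ⟨h3, e3⟩ := h3.compl
    obtain ⟨h4, e4⟩ := h4.compl
    exact h.four hn h1 h2 h3 h4 (by omega) (by omega) (by omega) (by omega) (by omega) (by omega)
  · intro n k i hn hk N
    have a1 := ones_compl w i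
    have a2 := ones_compl w (i + n)
    have a3 := ones_le w i n
    obtain ⟨i₁, l₁, i₂, l₂, b1, b2, b3, b4, b5⟩ :=
      h.two (n := n) (k := n - k) (i := i) hn (by omega) N
    have hkn : n - (n - k) = k := by omega
    have key : ∀ i j, Ret w n (n - k) i j → Ret (fun x => !w x) n k i j := by
      intro i j hr
      rw [← hkn]
      exact Ret.compl (w := fun x => !w x) (by simpa using hr)
    refine ⟨i₁, l₁, i₂, l₂, b1, b2, key _ _ b3, key _ _ b4, fun h6 => b5 ⟨h6.1, fun r hr => ?_⟩⟩
    exact Bool.not_inj (h6.2 r hr)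
  · intro i n N
    obtain ⟨j, hj, hj'⟩ := h.recur i n N
    exact ⟨j, hj, fun r hr => by rw [hj' r hr]⟩

/-- `w` has two factors of equal length whose numbers of ones differ by at least three. -/
def Unbal (w : ℕ → Bool) : Prop :=
  ∃ n x y, ones w (x + n) + 3 + ones w y ≤ ones w (y + n) + ones w x

theorem Unbal.compl {w : ℕ → Bool} (h : Unbal w) : Unbal (fun x => !w x) := by
  obtain ⟨n, x, y, h⟩ := h
  have a1 := ones_compl w x
  have a2 := ones_compl w (x + n)
  have a3 := ones_compl w y
  have a4 := ones_compl w (y + n)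
  exact ⟨n, y, x, by omega⟩

theorem cBalanced_of_not_unbal {w : ℕ → Bool} (h : ¬ Unbal w) : CBalanced w 2 := by
  rintro u v ⟨i, hu⟩ ⟨j, hv⟩ huv a
  rw [← huv] at hv
  set n := u.length with hn
  have h1 := count_false_add u
  have h2 := count_false_add v
  have h3 : ¬ _ := fun h' => h ⟨n, i, j, h'⟩
  have h4 : ¬ _ := fun h' => h ⟨n, j, i, h'⟩
  rw [ones_add, ones_add, ← hu, ← hv] at h3 h4
  rw [abs_le]
  cases a <;> constructor <;> push_cast <;> omega

/-- A maximal run of exactly `k ≥ 1` letters `a` in `c`, preceded by the other letter at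
position `p`. -/
def IsRun (c : ℕ → Bool) (a : Bool) (p k : ℕ) : Prop :=
  1 ≤ k ∧ c p = !a ∧ (∀ i, i < k → c (p + 1 + i) = a) ∧ c (p + 1 + k) = !a

theorem exists_isRun {c : ℕ → Bool} {a : Bool} (h : ∀ N, ∃ q, N ≤ q ∧ c q = !a) {p : ℕ}
    (hp : c p = !a) (hp' : c (p + 1) = a) : ∃ k, IsRun c a p k := by
  classical
  have hex : ∃ k, c (p + 1 + k) = !a := by
    obtain ⟨q, hq, hq'⟩ := h (p + 1)
    exact ⟨q - (p + 1), by rwa [Nat.add_sub_cancel' hq]⟩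
  refine ⟨Nat.find hex, ?_, hp, fun i hi => ?_, Nat.find_spec hex⟩
  · rw [Nat.one_le_iff_ne_zero]
    intro h0
    have := Nat.find_spec hex
    rw [h0, add_zero, hp'] at this
    cases a <;> simp at this
  · have := Nat.find_min hex hi
    cases a <;> simpa using this

theorem exists_change {c : ℕ → Bool} {a : Bool} {p q : ℕ} (hpq : p ≤ q) (hp : c p = !a)
    (hq : c q = a) : ∃ r, p ≤ r ∧ r < q ∧ c r = !a ∧ c (r + 1) = a := by
  obtain ⟨d, rfl⟩ := Nat.exists_eq_add_of_le hpq
  clear hpq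
  induction d with
  | zero => rw [add_zero, hp] at hq; cases a <;> simp at hq
  | succ d ih =>
    by_cases h : c (p + d) = a
    · obtain ⟨r, h1, h2, h3⟩ := ih h
      exact ⟨r, h1, by omega, h3⟩
    · refine ⟨p + d, by omega, by omega, ?_, hq⟩
      cases a <;> simpa using h

theorem periodic_of_isRun {c : ℕ → Bool} (h : ∀ a N, ∃ q, N ≤ q ∧ c q = a)
    (hk : ∀ a p p' k k', IsRun c a p k → IsRun c a p' k' → k = k') :
    ∃ N k m, 1 ≤ k ∧ 1 ≤ m ∧ ∀ q, c (N + q) = decide (q % (k + m) < k) := by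
  obtain ⟨p, -, hp⟩ := h false 0
  obtain ⟨q, hq, hq'⟩ := h true p
  obtain ⟨r, -, -, hr, hr'⟩ := exists_change (a := true) hq hp hq'
  obtain ⟨k, hk0⟩ := exists_isRun (h (!true)) hr hr'
  obtain ⟨m, hm0⟩ := exists_isRun (a := false) (p := r + k) (h (!false))
    (by have := hk0.2.2.1 (k - 1) (by have := hk0.1; omega)
        have := hk0.1
        rwa [show r + 1 + (k - 1) = r + k by omega] at *)
    (by have := hk0.2.2.2
        rwa [show r + 1 + k = r + k + 1 by omega] at this)
  have step : ∀ s, c s = false → c (s + 1) = true →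
      IsRun c true s k ∧ IsRun c false (s + k) m ∧ c (s + k + m) = false ∧
        c (s + k + m + 1) = true := by
    intro s h1 h2
    obtain ⟨k', hk'⟩ := exists_isRun (a := true) (h (!true)) h1 h2
    obtain rfl := hk _ _ _ _ _ hk0 hk'
    obtain ⟨m', hm'⟩ := exists_isRun (a := false) (p := s + k) (h (!false))
      (by have := hk'.2.2.1 (k - 1) (by have := hk'.1; omega)
          have := hk'.1
          rwa [show s + 1 + (k - 1) = s + k by omega] at *)
      (by have := hk'.2.2.2
          rwa [show s + 1 + k = s + k + 1 by omega] at this)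
    obtain rfl := hk _ _ _ _ _ hm0 hm'
    refine ⟨hk', hm', ?_, ?_⟩
    · have := hm'.2.2.1 (m - 1) (by have := hm'.1; omega)
      have := hm'.1
      rwa [show s + k + 1 + (m - 1) = s + k + m by omega] at *
    · have := hm'.2.2.2
      rwa [show s + k + 1 + m = s + k + m + 1 by omega] at this
  have all : ∀ a, c (r + a * (k + m)) = false ∧ c (r + a * (k + m) + 1) = true := by
    intro a
    induction a with
    | zero => simpa using ⟨hr, hr'⟩
    | succ a ih =>
      have := (step _ ih.1 ih.2).2.2
      rwa [show r + (a + 1) * (k + m) = r + a * (k + m) + k + m by ring]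
  refine ⟨r + 1, k, m, hk0.1, hm0.1, fun q => ?_⟩
  have hT : 0 < k + m := by have := hk0.1; omega
  have hd := Nat.div_add_mod q (k + m)
  have hlt := Nat.mod_lt q hT
  set s := q % (k + m) with hs
  obtain ⟨h1, h2, -, -⟩ := step _ (all (q / (k + m))).1 (all (q / (k + m))).2
  rw [Nat.mul_comm] at hd
  by_cases hsk : s < k
  · have := h1.2.2.1 s hsk
    rw [show r + 1 + q = r + q / (k + m) * (k + m) + 1 + s by omega, this]
    simp [hsk]
  · have := h2.2.2.1 (s - k) (by omega)
    rw [show r + 1 + q = r + q / (k + m) * (k + m) + k + 1 + (s - k) by omega, this]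
    simp [hsk]

theorem le_of_ones_add_le {w : ℕ → Bool} {y z r : ℕ} (hr : 1 ≤ r)
    (h : ones w z + r ≤ ones w y) : z + r ≤ y := by
  rcases le_total z y with h1 | h1
  · have := ones_mono w h1
    omega
  · have := ones_mono w h1
    omega

/-- `w` reads `1^t 0^(G q)` at position `B q`, for every `q`, and nothing else from `B 0` on. -/
structure IsBlocks (w : ℕ → Bool) (t : ℕ) (B G : ℕ → ℕ) : Prop where
  next : ∀ q, B (q + 1) = B q + t + G q
  one : ∀ q r, r < t → w (B q + r) = true
  zero : ∀ q r, r < G q → w (B q + t + r) = false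
  pos : ∀ q, 1 ≤ G q

namespace IsBlocks

variable {w : ℕ → Bool} {t : ℕ} {B G : ℕ → ℕ}

theorem shift (h : IsBlocks w t B G) (N : ℕ) :
    IsBlocks w t (fun q => B (N + q)) (fun q => G (N + q)) :=
  ⟨fun q => h.next (N + q), fun q => h.one (N + q), fun q => h.zero (N + q),
    fun q => h.pos (N + q)⟩

theorem le_add (h : IsBlocks w t B G) (q m : ℕ) : B q + m ≤ B (q + m) := by
  induction m with
  | zero => simp
  | succ m ih =>
    have := h.next (q + m)
    have := h.pos (q + m)
    rw [← Nat.add_assoc q]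
    omega

theorem mono (h : IsBlocks w t B G) {q q' : ℕ} (hq : q ≤ q') : B q + (q' - q) ≤ B q' := by
  have := h.le_add q (q' - q)
  rwa [Nat.add_sub_cancel' hq] at this

theorem locate (h : IsBlocks w t B G) {x : ℕ} (hx : B 0 ≤ x) : ∃ q, B q ≤ x ∧ x < B (q + 1) := by
  classical
  have hex : ∃ q, x < B (q + 1) := ⟨x, by have := h.le_add 0 (x + 1); simp at this; omega⟩
  refine ⟨Nat.find hex, ?_, Nat.find_spec hex⟩
  rcases h0 : Nat.find hex with _ | m
  · exact hx
  · have := Nat.find_min hex (m := m) (by omega)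
    omega

theorem ones_add (h : IsBlocks w t B G) (q : ℕ) {r : ℕ} (hr : r ≤ t + G q) :
    ones w (B q + r) = ones w (B q) + min r t := by
  have h1 := fun r (hr : r ≤ t) => ones_eq_ones (h.one q) hr
  have h2 := fun r (hr : r ≤ G q) => ones_eq_zeros (h.zero q) hr
  rcases le_total r t with h3 | h3
  · rw [h1 r h3]; omega
  · have h4 := h2 (r - t) (by omega)
    rw [h1 t le_rfl, show B q + t + (r - t) = B q + r by omega] at h4
    omega

theorem ones_of_mem (h : IsBlocks w t B G) {q x : ℕ} (h1 : B q ≤ x) (h2 : x ≤ B (q + 1)) :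
    ones w x = ones w (B q) + min (x - B q) t := by
  have := h.next q
  have h3 := h.ones_add q (r := x - B q) (by omega)
  rwa [Nat.add_sub_cancel' h1] at h3

theorem ones_next (h : IsBlocks w t B G) (q : ℕ) : ones w (B (q + 1)) = ones w (B q) + t := by
  have := h.next q
  rw [h.ones_of_mem (by omega) le_rfl]
  omega

theorem ones_start (h : IsBlocks w t B G) (q m : ℕ) :
    ones w (B (q + m)) = ones w (B q) + m * t := by
  induction m with
  | zero => simp
  | succ m ih => rw [← add_assoc, h.ones_next, ih]; ring

theorem length_const (h : IsBlocks w t B G) {b q m : ℕ} (hb : ∀ i, i < m → G (q + i) = b) :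
    B (q + m) = B q + m * (b + t) := by
  induction m with
  | zero => simp
  | succ m ih =>
    rw [← add_assoc, h.next, ih fun i hi => hb i (by omega), hb m (by omega)]
    ring

theorem length_ge (h : IsBlocks w t B G) {b : ℕ} (hb : ∀ q, b ≤ G q) (q m : ℕ) :
    B q + m * (b + t) ≤ B (q + m) ∧
      (B (q + m) ≤ B q + m * (b + t) → ∀ i, i < m → G (q + i) = b) := by
  induction m with
  | zero => simp
  | succ m ih =>
    have h1 := h.next (q + m)
    have h2 := hb (q + m)
    rw [← add_assoc, Nat.succ_mul]
    refine ⟨by omega, fun h3 i hi => ?_⟩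
    rcases Nat.lt_succ_iff_lt_or_eq.1 hi with h4 | rfl
    · exact ih.2 (by omega) i h4
    · omega

theorem ones_congr (h : IsBlocks w t B G) {q q' m : ℕ} (hG : ∀ i, i < m → G (q + i) = G (q' + i)) :
    B (q + m) + B q' = B (q' + m) + B q ∧
      ∀ r, r < B (q + m) - B q → w (B q + r) = w (B q' + r) := by
  induction m with
  | zero => simp [add_comm]
  | succ m ih =>
    obtain ⟨h1, h2⟩ := ih fun i hi => hG i (by omega)
    have h3 := h.next (q + m)
    have h4 := h.next (q' + m)
    have h5 := hG m (by omega)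
    have h6 := h.mono (q := q) (q' := q + m) (by omega)
    have h7 := h.mono (q := q') (q' := q' + m) (by omega)
    rw [← add_assoc, ← add_assoc]
    refine ⟨by omega, fun r hr => ?_⟩
    by_cases h8 : r < B (q + m) - B q
    · exact h2 r h8
    · obtain ⟨s, hs⟩ := Nat.exists_eq_add_of_le (not_lt.1 h8)
      have e1 : B q + r = B (q + m) + s := by omega
      have e2 : B q' + r = B (q' + m) + s := by omega
      rw [e1, e2]
      by_cases h9 : s < t
      · rw [h.one _ _ h9, h.one _ _ h9]
      · have z1 := h.zero (q + m) (s - t) (by omega)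
        have z2 := h.zero (q' + m) (s - t) (by omega)
        rw [show B (q + m) + s = B (q + m) + t + (s - t) by omega,
          show B (q' + m) + s = B (q' + m) + t + (s - t) by omega, z1, z2]

/-- The windows of densest type start exactly at the maximal blocks of short gaps. -/
theorem dense_visit (h : IsBlocks w t B G) (ht : 1 ≤ t) {b : ℕ} (hb1 : 1 ≤ b) (hb : ∀ q, b ≤ G q)
    {k x : ℕ} (hx : B 0 ≤ x) :
    ones w (x + (k * (b + t) + t)) = ones w x + (k + 1) * t ↔
      ∃ q, x = B q ∧ ∀ i, i < k → G (q + i) = b := by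
  constructor
  · intro hv
    obtain ⟨q, h1, h2⟩ := h.locate hx
    have h3 := h.ones_of_mem h1 h2.le
    have h4 := h.next q
    have a1 := h.length_ge hb q (k + 1)
    have a2 := h.length_ge hb (q + 1) k
    have a3 := h.length_ge hb q k
    have b1 := h.ones_start q (k + 1)
    have b2 := h.ones_start (q + 1) k
    have b3 := h.ones_start q k
    have c1 := h.ones_next q
    have c2 := h.ones_next (q + k)
    have c3 := h.ones_next (q + 1 + k)
    rw [show q + (k + 1) = q + k + 1 by ring] at a1 b1
    rw [show q + 1 + k = q + k + 1 by ring] at a2 b2 c3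
    have e1 : (k + 1) * (b + t) = k * (b + t) + b + t := by ring
    have e2 : (k + 1) * t = k * t + t := by ring
    rw [e1] at a1
    rw [e2] at b1 hv
    generalize k * (b + t) = X at *
    generalize k * t = Y at *
    by_cases hr : x = B q
    · subst hr
      have h5 := le_of_ones_add_le (w := w) (z := B (q + k)) (y := B q + (X + t)) ht (by omega)
      exact ⟨q, rfl, a3.2 (by omega)⟩
    · exfalso
      by_cases hr2 : x ≤ B q + t
      · have h5 := le_of_ones_add_le (w := w) (z := B (q + k + 1)) (y := x + (X + t)) (r := x - B q)
          (by omega) (by omega)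
        omega
      · have h5 := le_of_ones_add_le (w := w) (z := B (q + k + 1)) (y := x + (X + t)) ht (by omega)
        omega
  · rintro ⟨q, rfl, hq⟩
    have h1 := h.length_const hq
    have h2 := h.ones_start q k
    have h3 := h.ones_add (q + k) (r := t) (by omega)
    rw [← add_assoc, ← h1, h3, h2]
    ring_nf
    simp

theorem false_of_periodic (h : IsBlocks w t B G) (hw : Good w) (ht : 1 ≤ t) {b g k m : ℕ}
    (hb : 1 ≤ b) (hbg : b < g) (hk : 1 ≤ k) (hkm : 1 ≤ m ∨ k = 1)
    (hG : ∀ q, G q = if q % (k + m) < k then b else g) : False := by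
  have hle : ∀ q, b ≤ G q := by
    intro q
    rw [hG]
    split_ifs <;> omega
  have key : ∀ q, (∀ i, i < k → G (q + i) = b) ↔ q % (k + m) = 0 := by
    intro q
    have hlt := Nat.mod_lt q (show 0 < k + m by omega)
    constructor
    · intro hq
      by_contra h0
      have h1 := hq 0 (by omega)
      rw [hG, add_zero] at h1
      have h2 : q % (k + m) < k := by
        by_contra h2
        rw [if_neg h2] at h1
        omega
      have h3 := hq (k - q % (k + m)) (by omega)
      rw [hG, Nat.add_mod, Nat.mod_eq_of_lt (a := k - q % (k + m)) (by omega),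
        show q % (k + m) + (k - q % (k + m)) = k by omega, Nat.mod_eq_of_lt (by omega),
        if_neg (by omega)] at h3
      omega
    · intro h0 i hi
      rw [hG, Nat.add_mod, h0, zero_add, Nat.mod_mod, Nat.mod_eq_of_lt (by omega), if_pos hi]
  have hvis := fun x (hx : B 0 ≤ x) => h.dense_visit ht hb hle (k := k) hx
  simp only [key] at hvis
  have h0 := (hvis (B 0) le_rfl).2 ⟨0, rfl, by simp⟩
  obtain ⟨i₁, l₁, i₂, l₂, n1, n2, r1, r2, hne⟩ := hw.two (by omega) h0 (B 0)
  have hret : ∀ i l, B 0 ≤ i → Ret w (k * (b + t) + t) ((k + 1) * t) i (i + l) →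
      ∃ q, q % (k + m) = 0 ∧ i = B q ∧ i + l = B (q + (k + m)) := by
    rintro i l hi ⟨h1, h2, h3, h4⟩
    obtain ⟨q, rfl, hq⟩ := (hvis i hi).1 h2
    obtain ⟨q', hq', hq'0⟩ := (hvis _ (hi.trans h1.le)).1 h3
    refine ⟨q, hq, rfl, ?_⟩
    rw [hq'] at h1 h4 ⊢
    have hqq : q < q' := by
      by_contra hh
      have := h.mono (not_lt.1 hh)
      omega
    have hmod : (q + (k + m)) % (k + m) = 0 := by simpa using hq
    rcases lt_trichotomy q' (q + (k + m)) with h5 | h5 | h5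
    · exfalso
      obtain ⟨a, ha⟩ := Nat.dvd_of_mod_eq_zero hq
      obtain ⟨c, hc⟩ := Nat.dvd_of_mod_eq_zero hq'0
      rw [ha, hc] at hqq h5
      have h6 : a < c := lt_of_mul_lt_mul_left hqq (Nat.zero_le _)
      have h7 : c < a + 1 := lt_of_mul_lt_mul_left (by linarith) (Nat.zero_le (k + m))
      omega
    · rw [h5]
    · exfalso
      have m1 := h.mono (q := q) (q' := q + (k + m)) (by omega)
      have m2 := h.mono h5.le
      have m3 := h.mono (Nat.zero_le (q + (k + m)))
      exact h4 (B (q + (k + m))) (by omega) (by omega)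
        ((hvis _ (by omega)).2 ⟨_, rfl, hmod⟩)
  obtain ⟨q₁, e1, rfl, f1⟩ := hret _ _ n1 r1
  obtain ⟨q₂, e2, rfl, f2⟩ := hret _ _ n2 r2
  have hc := h.ones_congr (q := q₁) (q' := q₂) (m := k + m) fun i hi => by
    rw [hG, hG, Nat.add_mod, e1, Nat.add_mod q₂, e2]
  refine hne ⟨by omega, fun r hr => hc.2 r (by omega)⟩

end IsBlocks

namespace IsBlocks

variable {w : ℕ → Bool} {t b g : ℕ} {B G : ℕ → ℕ}

theorem locate_between (h : IsBlocks w t B G) {p p' x : ℕ} (hp : B p ≤ x) (hp' : x < B (p' + 1)) :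
    ∃ q, p ≤ q ∧ q ≤ p' ∧ B q ≤ x ∧ x < B (q + 1) := by
  obtain ⟨q, h1, h2⟩ := h.locate (x := x) (by have := h.mono (Nat.zero_le p); omega)
  refine ⟨q, ?_, ?_, h1, h2⟩
  · by_contra hq
    have := h.mono (q := q + 1) (q' := p) (by omega)
    omega
  · by_contra hq
    have := h.mono (q := p' + 1) (q' := q) (by omega)
    omega

theorem ones_cases (h : IsBlocks w t B G) (q : ℕ) {x : ℕ} (h1 : B q ≤ x)
    (h2 : x ≤ B q + t + G q) :
    (x ≤ B q + t ∧ ones w x + B q = ones w (B q) + x) ∨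
      (B q + t < x ∧ ones w x = ones w (B q) + t) := by
  rw [← h.next] at h2
  rw [h.ones_of_mem h1 h2]
  rcases le_or_gt x (B q + t) with h3 | h3
  · rw [min_eq_left (by omega)]; omega
  · rw [min_eq_right (by omega)]; omega

/-- The number of ones before the position `y` of one of the blocks `q`, `q + 1`, `q + 2`. -/
theorem ones_cases₃ (h : IsBlocks w t B G) (q : ℕ) {y : ℕ} (h1 : B q ≤ y) :
    (y ≤ B q + t ∧ ones w y + B q = ones w (B q) + y) ∨
    (B q + t < y ∧ y ≤ B q + t + G q ∧ ones w y = ones w (B q) + t) ∨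
    (B q + t + G q < y ∧ y ≤ B q + 2 * t + G q ∧
      ones w y + B q + G q = ones w (B q) + y) ∨
    (B q + 2 * t + G q < y ∧ y ≤ B q + 2 * t + G q + G (q + 1) ∧
      ones w y = ones w (B q) + 2 * t) ∨
    (B q + 2 * t + G q + G (q + 1) < y ∧ y ≤ B q + 3 * t + G q + G (q + 1) ∧
      ones w y + B q + G q + G (q + 1) = ones w (B q) + y) ∨
    (B q + 3 * t + G q + G (q + 1) < y ∧ y ≤ B q + 3 * t + G q + G (q + 1) + G (q + 2) ∧
      ones w y = ones w (B q) + 3 * t) ∨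
    (B q + 3 * t + G q + G (q + 1) + G (q + 2) < y ∧ ones w (B q) + 3 * t ≤ ones w y) := by
  have e0 := h.next q
  have e1 := h.next (q + 1)
  have e2 := h.next (q + 2)
  have o1 := h.ones_next q
  have o2 := h.ones_next (q + 1)
  have o3 := h.ones_next (q + 2)
  have p1 := h.pos q
  have p2 := h.pos (q + 1)
  have p3 := h.pos (q + 2)
  rw [show q + 1 + 1 = q + 2 by rfl] at e1 o2
  rw [show q + 2 + 1 = q + 3 by rfl] at e2 o3
  rcases le_or_gt y (B (q + 1)) with h2 | h2
  · rcases h.ones_cases q h1 (by omega) with h3 | h3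
    · exact Or.inl (by omega)
    · exact Or.inr (Or.inl (by omega))
  rcases le_or_gt y (B (q + 2)) with h4 | h4
  · rcases h.ones_cases (q + 1) h2.le (by omega) with h3 | h3
    · exact Or.inr (Or.inr (Or.inl (by omega)))
    · exact Or.inr (Or.inr (Or.inr (Or.inl (by omega))))
  rcases le_or_gt y (B (q + 3)) with h5 | h5
  · rcases h.ones_cases (q + 2) h4.le (by omega) with h3 | h3
    · exact Or.inr (Or.inr (Or.inr (Or.inr (Or.inl (by omega)))))
    · exact Or.inr (Or.inr (Or.inr (Or.inr (Or.inr (Or.inl (by omega))))))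
  · have h6 := (ones_mono w h5.le).1
    exact Or.inr (Or.inr (Or.inr (Or.inr (Or.inr (Or.inr (by omega))))))

end IsBlocks

theorem hasRet_succ {w : ℕ → Bool} {n k x m : ℕ} (h1 : ones w (x + n) = ones w x + k)
    (h2 : ones w (x + 1 + n) = ones w (x + 1) + k) (h3 : ones w (x + 1) = ones w x + m) :
    HasRet w n k 1 m :=
  ⟨x, ⟨by omega, h1, h2, by omega⟩, h3⟩

namespace IsBlocks

variable {w : ℕ → Bool} {t b g : ℕ} {B G : ℕ → ℕ}

theorem long_short_next_ne (h : IsBlocks w t B G) (hb : 1 ≤ b) (ht : 1 ≤ t) (hbg : 2 * b < g)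
    {p k : ℕ} (hk : 1 ≤ k) (hp : G p = g) (hk1 : ∀ i, i < k → G (p + 1 + i) = b)
    (hk2 : G (p + 1 + k) = g) {x : ℕ} (hx : B p + t + b < x) (hx' : x < B (p + k) + t) :
    ones w (x + (g + t)) ≠ ones w x + t := by
  have hpk := hk1 (k - 1) (by omega)
  rw [show p + 1 + (k - 1) = p + k by omega] at hpk
  have hp1 := hk1 0 (by omega)
  rw [add_zero] at hp1
  rw [show p + 1 + k = p + k + 1 by omega] at hk2
  have n1 := h.next (p + k)
  obtain ⟨q, q1, q2, q3, q4⟩ := h.locate_between (p := p) (p' := p + k) (x := x) (by omega)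
    (by omega)
  rw [h.next] at q4
  have f1 := h.ones_cases q q3 q4.le
  have f2 := h.ones_cases₃ q (y := x + (g + t)) (by omega)
  rcases eq_or_ne q p with rfl | hqp
  · rcases f2 with f | f | f | f | f | f | f <;> rcases f1 with f' | f' <;> omega
  · have hq0 := hk1 (q - (p + 1)) (by omega)
    rw [show p + 1 + (q - (p + 1)) = q by omega] at hq0
    rcases eq_or_ne q (p + k) with rfl | hqk
    · rcases f2 with f | f | f | f | f | f | f <;> rcases f1 with f' | f' <;> omega
    · have hq1 := hk1 (q - p) (by omega)
      rw [show p + 1 + (q - p) = q + 1 by omega] at hq1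
      rcases f2 with f | f | f | f | f | f | f <;> rcases f1 with f' | f' <;> omega

theorem hasRet_long_short (h : IsBlocks w t B G) (hb : 1 ≤ b) (ht : 1 ≤ t) (hbg : 2 * b < g)
    {p k : ℕ} (hk : 1 ≤ k) (hp : G p = g) (hk1 : ∀ i, i < k → G (p + 1 + i) = b)
    (hk2 : G (p + 1 + k) = g) :
    HasRet w (g + t) t (t + g - b + (k - 1) * (b + t)) (k * t) := by
  have len := h.length_const (q := p + 1) (m := k - 1) fun i hi => hk1 i (by omega)
  rw [show p + 1 + (k - 1) = p + k by omega] at len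
  have n0 := h.next p
  have hpk := hk1 (k - 1) (by omega)
  rw [show p + 1 + (k - 1) = p + k by omega] at hpk
  have hkt := h.ones_start p k
  have hp1 := hk1 0 (by omega)
  rw [add_zero] at hp1
  rw [show p + 1 + k = p + k + 1 by omega] at hk2
  have hj : B p + t + b + (t + g - b + (k - 1) * (b + t)) = B (p + k) + t := by omega
  have hle : B p + t + b < B (p + k) + t := by omega
  refine ⟨B p + t + b, ⟨by omega, ?_, ?_, ?_⟩, ?_⟩
  · have f1 := h.ones_cases p (x := B p + t + b) (by omega) (by omega)
    have f2 := h.ones_cases₃ p (y := B p + t + b + (g + t)) (by omega)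
    clear hj hkt
    rcases f2 with f | f | f | f | f | f | f <;> rcases f1 with f' | f' <;> omega
  · rw [hj]
    have f1 := h.ones_cases (p + k) (x := B (p + k) + t) (by omega) (by omega)
    have f2 := h.ones_cases₃ (p + k) (y := B (p + k) + t + (g + t)) (by omega)
    clear hj hkt
    rcases f2 with f | f | f | f | f | f | f <;> rcases f1 with f' | f' <;> omega
  · intro x hx hx'
    rw [hj] at hx'
    rw [show p + k + 1 = p + 1 + k by omega] at hk2
    exact h.long_short_next_ne hb ht hbg hk hp hk1 hk2 hx hx'
  · rw [hj]
    have f1 := h.ones_cases p (x := B p + t + b) (by omega) (by omega)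
    have f2 := h.ones_cases (p + k) (x := B (p + k) + t) (by omega) (by omega)
    omega
theorem hasRet_long_short_zero (h : IsBlocks w t B G) (hb : 1 ≤ b) (ht : 1 ≤ t) (hbg : b < g)
    {s : ℕ} (hs : G s = b) (hs1 : G (s + 1) = g) : HasRet w (g + t) t 1 0 := by
  have f1 := h.ones_cases s (x := B s + t) (by omega) (by omega)
  have f2 := h.ones_cases s (x := B s + t + 1) (by omega) (by omega)
  have f3 := h.ones_cases₃ s (y := B s + t + (g + t)) (by omega)
  have f4 := h.ones_cases₃ s (y := B s + t + 1 + (g + t)) (by omega)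
  refine hasRet_succ (x := B s + t) ?_ ?_ ?_
  · clear f2 f4
    rcases f3 with f | f | f | f | f | f | f <;> omega
  · clear f1 f3
    rcases f4 with f | f | f | f | f | f | f <;> omega
  · omega

theorem hasRet_long_short_one (h : IsBlocks w t B G) (ht : 1 ≤ t)
    {s : ℕ} (hs : G s = g) : HasRet w (g + t) t 1 1 := by
  have g1 := h.pos s
  have f1 := h.ones_cases s (x := B s) (by omega) (by omega)
  have f2 := h.ones_cases s (x := B s + 1) (by omega) (by omega)
  have f3 := h.ones_cases₃ s (y := B s + (g + t)) (by omega)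
  have f4 := h.ones_cases₃ s (y := B s + 1 + (g + t)) (by omega)
  refine hasRet_succ (x := B s) ?_ ?_ ?_
  · clear f2 f4
    rcases f3 with f | f | f | f | f | f | f <;> omega
  · clear f1 f3
    rcases f4 with f | f | f | f | f | f | f <;> omega
  · omega

/-- All runs of the short gap have the same length, if the long gap is long enough. -/
theorem short_run_unique (h : IsBlocks w t B G) (hw : Good w) (hb : 1 ≤ b) (ht : 1 ≤ t)
    (hbg : 2 * b < g) {p k p' k' : ℕ} (hk : 1 ≤ k) (hp : G p = g)
    (hk1 : ∀ i, i < k → G (p + 1 + i) = b) (hk2 : G (p + 1 + k) = g) (hk' : 1 ≤ k')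
    (hp' : G p' = g) (hk1' : ∀ i, i < k' → G (p' + 1 + i) = b) (hk2' : G (p' + 1 + k') = g) :
    k = k' := by
  by_contra hne
  have hpk := hk1 (k - 1) (by omega)
  have h3 : k * t ≠ k' * t := fun h0 => hne (Nat.eq_of_mul_eq_mul_right (by omega) h0)
  exact hw.four (by omega)
    (h.hasRet_long_short_zero hb ht (by omega) hpk
      (by rwa [show p + 1 + (k - 1) + 1 = p + 1 + k by omega]))
    (h.hasRet_long_short_one ht hp) (h.hasRet_long_short hb ht hbg hk hp hk1 hk2)
    (h.hasRet_long_short hb ht hbg hk' hp' hk1' hk2')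
    (by omega) (by omega) (by omega) (by omega) (by omega) (by omega)

theorem short_long_next_ne (h : IsBlocks w t B G) (hb : 1 ≤ b) (ht : 1 ≤ t) (hbg : 2 * b < g)
    {p m : ℕ} (hm : 1 ≤ m) (hp : G p = b) (hm1 : ∀ i, i < m → G (p + 1 + i) = g)
    (hm2 : G (p + 1 + m) = b) {x : ℕ} (hx : B p < x) (hx' : x < B (p + m) + t + g - b) :
    ones w (x + (2 * b + 2 * t)) ≠ ones w x + 2 * t := by
  have hpk := hm1 (m - 1) (by omega)
  rw [show p + 1 + (m - 1) = p + m by omega] at hpk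
  have hp1 := hm1 0 (by omega)
  rw [add_zero] at hp1
  rw [show p + 1 + m = p + m + 1 by omega] at hm2
  have n1 := h.next (p + m)
  obtain ⟨q, q1, q2, q3, q4⟩ := h.locate_between (p := p) (p' := p + m) (x := x) (by omega)
    (by omega)
  rw [h.next] at q4
  have f1 := h.ones_cases q q3 q4.le
  have f2 := h.ones_cases₃ q (y := x + (2 * b + 2 * t)) (by omega)
  rcases eq_or_ne q p with rfl | hqp
  · rcases f2 with f | f | f | f | f | f | f <;> rcases f1 with f' | f' <;> omega
  · have hq0 := hm1 (q - (p + 1)) (by omega)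
    rw [show p + 1 + (q - (p + 1)) = q by omega] at hq0
    rcases eq_or_ne q (p + m) with rfl | hqk
    · rcases f2 with f | f | f | f | f | f | f <;> rcases f1 with f' | f' <;> omega
    · have hq1 := hm1 (q - p) (by omega)
      rw [show p + 1 + (q - p) = q + 1 by omega] at hq1
      rcases f2 with f | f | f | f | f | f | f <;> rcases f1 with f' | f' <;> omega

theorem hasRet_short_long (h : IsBlocks w t B G) (hb : 1 ≤ b) (ht : 1 ≤ t) (hbg : 2 * b < g)
    {p m : ℕ} (hm : 1 ≤ m) (hp : G p = b) (hm1 : ∀ i, i < m → G (p + 1 + i) = g)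
    (hm2 : G (p + 1 + m) = b) :
    HasRet w (2 * b + 2 * t) (2 * t) (t + m * (g + t)) ((m + 1) * t) := by
  have len := h.length_const (q := p + 1) (m := m) hm1
  have n0 := h.next p
  have hpk := hm1 (m - 1) (by omega)
  rw [show p + 1 + (m - 1) = p + m by omega] at hpk
  have hkt := h.ones_start p m
  have hp1 := hm1 0 (by omega)
  rw [add_zero] at hp1
  rw [show p + 1 + m = p + m + 1 by omega] at hm2 len
  have n1 := h.next (p + m)
  have hj : B p + (t + m * (g + t)) = B (p + m) + t + g - b := by omega
  have hmt := add_mul m 1 t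
  have hle := h.mono (q := p) (q' := p + m) (by omega)
  refine ⟨B p, ⟨by omega, ?_, ?_, ?_⟩, ?_⟩
  · have f1 := h.ones_cases p (x := B p) (by omega) (by omega)
    have f2 := h.ones_cases₃ p (y := B p + (2 * b + 2 * t)) (by omega)
    clear hj hkt len hmt
    rcases f2 with f | f | f | f | f | f | f <;> rcases f1 with f' | f' <;> omega
  · rw [hj]
    have f1 := h.ones_cases (p + m) (x := B (p + m) + t + g - b) (by omega) (by omega)
    have f2 := h.ones_cases₃ (p + m) (y := B (p + m) + t + g - b + (2 * b + 2 * t)) (by omega)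
    have := h.pos (p + m + 2)
    clear hj hkt len hmt
    rcases f2 with f | f | f | f | f | f | f <;> rcases f1 with f' | f' <;> omega
  · intro x hx hx'
    rw [hj] at hx'
    rw [show p + m + 1 = p + 1 + m by omega] at hm2
    exact h.short_long_next_ne hb ht hbg hm hp hm1 hm2 hx hx'
  · rw [hj]
    have f2 := h.ones_cases (p + m) (x := B (p + m) + t + g - b) (by omega) (by omega)
    omega

theorem hasRet_short_short_zero (h : IsBlocks w t B G) (hb : 1 ≤ b) (ht : 1 ≤ t)
    {s : ℕ} (hs : G s = b) (hs1 : G (s + 1) = b) : HasRet w (2 * b + 2 * t) (2 * t) 1 0 := by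
  have f1 := h.ones_cases s (x := B s + t) (by omega) (by omega)
  have f2 := h.ones_cases s (x := B s + t + 1) (by omega) (by omega)
  have f3 := h.ones_cases₃ s (y := B s + t + (2 * b + 2 * t)) (by omega)
  have f4 := h.ones_cases₃ s (y := B s + t + 1 + (2 * b + 2 * t)) (by omega)
  have := h.pos (s + 2)
  refine hasRet_succ (x := B s + t) ?_ ?_ ?_
  · clear f2 f4
    rcases f3 with f | f | f | f | f | f | f <;> omega
  · clear f1 f3
    rcases f4 with f | f | f | f | f | f | f <;> omega
  · omega

theorem hasRet_short_short_one (h : IsBlocks w t B G) (ht : 1 ≤ t)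
    {s : ℕ} (hs : G s = b) (hs1 : G (s + 1) = b) : HasRet w (2 * b + 2 * t) (2 * t) 1 1 := by
  have g1 := h.pos s
  have f1 := h.ones_cases s (x := B s) (by omega) (by omega)
  have f2 := h.ones_cases s (x := B s + 1) (by omega) (by omega)
  have f3 := h.ones_cases₃ s (y := B s + (2 * b + 2 * t)) (by omega)
  have f4 := h.ones_cases₃ s (y := B s + 1 + (2 * b + 2 * t)) (by omega)
  refine hasRet_succ (x := B s) ?_ ?_ ?_
  · clear f2 f4
    rcases f3 with f | f | f | f | f | f | f <;> omega
  · clear f1 f3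
    rcases f4 with f | f | f | f | f | f | f <;> omega
  · omega

/-- All runs of the long gap have the same length, if the long gap is long enough. -/
theorem long_run_unique (h : IsBlocks w t B G) (hw : Good w) (hb : 1 ≤ b) (ht : 1 ≤ t)
    (hbg : 2 * b < g) {s : ℕ} (hs : G s = b) (hs1 : G (s + 1) = b)
    {p m p' m' : ℕ} (hm : 1 ≤ m) (hp : G p = b)
    (hm1 : ∀ i, i < m → G (p + 1 + i) = g) (hm2 : G (p + 1 + m) = b) (hm' : 1 ≤ m')
    (hp' : G p' = b) (hm1' : ∀ i, i < m' → G (p' + 1 + i) = g) (hm2' : G (p' + 1 + m') = b) :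
    m = m' := by
  by_contra hne
  have h3 : (m + 1) * t ≠ (m' + 1) * t :=
    fun h0 => hne (Nat.succ.inj (Nat.eq_of_mul_eq_mul_right (by omega) h0))
  have h4 := Nat.mul_pos (show 0 < m by omega) (show 0 < g + t by omega)
  have h5 := Nat.mul_pos (show 0 < m' by omega) (show 0 < g + t by omega)
  exact hw.four (by omega)
    (h.hasRet_short_short_zero hb ht hs hs1)
    (h.hasRet_short_short_one ht hs hs1) (h.hasRet_short_long hb ht hbg hm hp hm1 hm2)
    (h.hasRet_short_long hb ht hbg hm' hp' hm1' hm2')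
    (by omega) (by omega) (by omega) (by omega) (by omega) (by omega)

theorem hasRet_long_long (h : IsBlocks w t B G) (ht : 1 ≤ t) (hbg : b < g) (hgb : g ≤ 2 * b)
    {q : ℕ} (hq : G q = g) (hq1 : G (q + 1) = g) :
    HasRet w (2 * b + 2 * t) (2 * t) (t + (2 * g - 2 * b)) t := by
  have := h.pos (q + 2)
  refine ⟨B q, ⟨by omega, ?_, ?_, ?_⟩, ?_⟩
  · have f2 := h.ones_cases₃ q (y := B q + (2 * b + 2 * t)) (by omega)
    rcases f2 with f | f | f | f | f | f | f <;> omega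
  · have f1 := h.ones_cases q (x := B q + (t + (2 * g - 2 * b))) (by omega) (by omega)
    have f2 := h.ones_cases₃ q (y := B q + (t + (2 * g - 2 * b)) + (2 * b + 2 * t)) (by omega)
    rcases f2 with f | f | f | f | f | f | f <;> omega
  · intro x hx hx'
    have f1 := h.ones_cases q (x := x) (by omega) (by omega)
    have f2 := h.ones_cases₃ q (y := x + (2 * b + 2 * t)) (by omega)
    rcases f2 with f | f | f | f | f | f | f <;> rcases f1 with f' | f' <;> omega
  · have f1 := h.ones_cases q (x := B q + (t + (2 * g - 2 * b))) (by omega) (by omega)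
    omega

theorem hasRet_long_then_short (h : IsBlocks w t B G) (hb : 1 ≤ b) (ht : 1 ≤ t) (hbg : b < g)
    (hgb : g ≤ 2 * b) {q : ℕ} (hq : G q = g) (hq1 : G (q + 1) = b) :
    HasRet w (2 * b + 2 * t) (2 * t) (t + g - b) t := by
  have := h.pos (q + 2)
  refine ⟨B q, ⟨by omega, ?_, ?_, ?_⟩, ?_⟩
  · have f2 := h.ones_cases₃ q (y := B q + (2 * b + 2 * t)) (by omega)
    rcases f2 with f | f | f | f | f | f | f <;> omega
  · have f1 := h.ones_cases q (x := B q + (t + g - b)) (by omega) (by omega)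
    have f2 := h.ones_cases₃ q (y := B q + (t + g - b) + (2 * b + 2 * t)) (by omega)
    rcases f2 with f | f | f | f | f | f | f <;> omega
  · intro x hx hx'
    have f1 := h.ones_cases q (x := x) (by omega) (by omega)
    have f2 := h.ones_cases₃ q (y := x + (2 * b + 2 * t)) (by omega)
    rcases f2 with f | f | f | f | f | f | f <;> rcases f1 with f' | f' <;> omega
  · have f1 := h.ones_cases q (x := B q + (t + g - b)) (by omega) (by omega)
    omega

/-- Long gaps are isolated if short gaps are not and the two lengths are close. -/
theorem not_long_long (h : IsBlocks w t B G) (hw : Good w) (hb : 1 ≤ b) (ht : 1 ≤ t)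
    (hbg : b < g) (hgb : g ≤ 2 * b) {s : ℕ} (hs : G s = b) (hs1 : G (s + 1) = b) {q : ℕ}
    (hq : G q = g) (hq1 : G (q + 1) = b) {q' : ℕ} (hq' : G q' = g) (hq1' : G (q' + 1) = g) :
    False :=
  hw.four (by omega) (h.hasRet_short_short_zero hb ht hs hs1)
    (h.hasRet_short_short_one ht hs hs1) (h.hasRet_long_long ht hbg hgb hq' hq1')
    (h.hasRet_long_then_short hb ht hbg hgb hq hq1)
    (by omega) (by omega) (by omega) (by omega) (by omega) (by omega)

end IsBlocks

namespace IsBlocks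

variable {w : ℕ → Bool} {t b g : ℕ} {B G : ℕ → ℕ}

theorem hasRet_mixed_one (h : IsBlocks w t B G) (ht : 2 ≤ t)
    {s : ℕ} (hs : G s + G (s + 1) = b + g) :
    HasRet w (b + g + 2 * t - 1) (2 * t - 1) 1 1 := by
  have g1 := h.pos s
  have f1 := h.ones_cases s (x := B s + 1) (by omega) (by omega)
  have f2 := h.ones_cases s (x := B s + 1 + 1) (by omega) (by omega)
  have f3 := h.ones_cases₃ s (y := B s + 1 + (b + g + 2 * t - 1)) (by omega)
  have f4 := h.ones_cases₃ s (y := B s + 1 + 1 + (b + g + 2 * t - 1)) (by omega)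
  refine hasRet_succ (x := B s + 1) ?_ ?_ ?_
  · clear f2 f4
    rcases f3 with f | f | f | f | f | f | f <;> omega
  · clear f1 f3
    rcases f4 with f | f | f | f | f | f | f <;> omega
  · omega

theorem hasRet_mixed_short (h : IsBlocks w t B G) (ht : 2 ≤ t) (hb : 1 ≤ b) (hbg : b < g)
    {q : ℕ} (hq : G q = b) (hq1 : G (q + 1) = g) (hq2 : b ≤ G (q + 2)) :
    HasRet w (b + g + 2 * t - 1) (2 * t - 1) (b + 1) 1 := by
  have n1 := h.next q
  have o1 := h.ones_next q
  refine ⟨B q + t, ⟨by omega, ?_, ?_, ?_⟩, ?_⟩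
  · have f1 := h.ones_cases q (x := B q + t) (by omega) (by omega)
    have f2 := h.ones_cases₃ q (y := B q + t + (b + g + 2 * t - 1)) (by omega)
    rcases f2 with f | f | f | f | f | f | f <;> omega
  · have f1 := h.ones_cases₃ q (y := B q + t + (b + 1)) (by omega)
    have f2 := h.ones_cases₃ q (y := B q + t + (b + 1) + (b + g + 2 * t - 1)) (by omega)
    rcases f2 with f | f | f | f | f | f | f <;> omega
  · intro x hx hx'
    have f1 := h.ones_cases q (x := x) (by omega) (by omega)
    have f2 := h.ones_cases₃ q (y := x + (b + g + 2 * t - 1)) (by omega)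
    rcases f2 with f | f | f | f | f | f | f <;> rcases f1 with f' | f' <;> omega
  · have f1 := h.ones_cases q (x := B q + t) (by omega) (by omega)
    have f2 := h.ones_cases₃ q (y := B q + t + (b + 1)) (by omega)
    omega

theorem mixed_next_ne (h : IsBlocks w t B G) (hb : 1 ≤ b) (ht : 2 ≤ t) (hbg : b < g)
    {p k : ℕ} (hk : 1 ≤ k) (hp : G p = g) (hk1 : ∀ i, i < k → G (p + 1 + i) = b)
    {x : ℕ} (hx : B p + t < x) (hx' : x < B (p + k) + 1) :
    ones w (x + (b + g + 2 * t - 1)) ≠ ones w x + (2 * t - 1) := by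
  have hpk := hk1 (k - 1) (by omega)
  rw [show p + 1 + (k - 1) = p + k by omega] at hpk
  have hp1 := hk1 0 (by omega)
  rw [add_zero] at hp1
  have n1 := h.next (p + k)
  rcases eq_or_ne x (B (p + k)) with rfl | hxne
  · have f2 := h.ones_cases₃ (p + k) (y := B (p + k) + (b + g + 2 * t - 1)) (by omega)
    rcases f2 with f | f | f | f | f | f | f <;> omega
  obtain ⟨q, q1, q2, q3, q4⟩ := h.locate_between (p := p) (p' := p + k - 1) (x := x) (by omega)
    (by rw [show p + k - 1 + 1 = p + k by omega]; omega)
  rw [h.next] at q4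
  have f1 := h.ones_cases q q3 q4.le
  have f2 := h.ones_cases₃ q (y := x + (b + g + 2 * t - 1)) (by omega)
  rcases eq_or_ne q p with rfl | hqp
  · rcases f2 with f | f | f | f | f | f | f <;> rcases f1 with f' | f' <;> omega
  · have hq0 := hk1 (q - (p + 1)) (by omega)
    rw [show p + 1 + (q - (p + 1)) = q by omega] at hq0
    have hq1 := hk1 (q - p) (by omega)
    rw [show p + 1 + (q - p) = q + 1 by omega] at hq1
    rcases f2 with f | f | f | f | f | f | f <;> rcases f1 with f' | f' <;> omega

theorem hasRet_mixed (h : IsBlocks w t B G) (hb : 1 ≤ b) (ht : 2 ≤ t) (hbg : b < g)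
    {p k : ℕ} (hk : 1 ≤ k) (hp : G p = g) (hk1 : ∀ i, i < k → G (p + 1 + i) = b)
    (hk2 : G (p + 1 + k) = g) :
    HasRet w (b + g + 2 * t - 1) (2 * t - 1) (g + 1 + (k - 1) * (b + t)) ((k - 1) * t + 1) := by
  have len := h.length_const (q := p + 1) (m := k - 1) fun i hi => hk1 i (by omega)
  rw [show p + 1 + (k - 1) = p + k by omega] at len
  have n0 := h.next p
  have o0 := h.ones_next p
  have hpk := hk1 (k - 1) (by omega)
  rw [show p + 1 + (k - 1) = p + k by omega] at hpk
  have hkt := h.ones_start (p + 1) (k - 1)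
  rw [show p + 1 + (k - 1) = p + k by omega] at hkt
  have hp1 := hk1 0 (by omega)
  rw [add_zero] at hp1
  rw [show p + 1 + k = p + k + 1 by omega] at hk2
  have hj : B p + t + (g + 1 + (k - 1) * (b + t)) = B (p + k) + 1 := by omega
  refine ⟨B p + t, ⟨by omega, ?_, ?_, ?_⟩, ?_⟩
  · have f1 := h.ones_cases p (x := B p + t) (by omega) (by omega)
    have f2 := h.ones_cases₃ p (y := B p + t + (b + g + 2 * t - 1)) (by omega)
    clear hj hkt len
    rcases f2 with f | f | f | f | f | f | f <;> rcases f1 with f' | f' <;> omega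
  · rw [hj]
    have f1 := h.ones_cases (p + k) (x := B (p + k) + 1) (by omega) (by omega)
    have f2 := h.ones_cases₃ (p + k) (y := B (p + k) + 1 + (b + g + 2 * t - 1)) (by omega)
    clear hj hkt len
    rcases f2 with f | f | f | f | f | f | f <;> rcases f1 with f' | f' <;> omega
  · intro x hx hx'
    rw [hj] at hx'
    exact h.mixed_next_ne hb ht hbg hk hp hk1 hx hx'
  · rw [hj]
    have f1 := h.ones_cases p (x := B p + t) (by omega) (by omega)
    have f2 := h.ones_cases (p + k) (x := B (p + k) + 1) (by omega) (by omega)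
    omega

/-- All runs of the short gap have the same length if `t ≥ 2`. -/
theorem short_run_unique_of_two_le (h : IsBlocks w t B G) (hw : Good w) (hb : 1 ≤ b) (ht : 2 ≤ t)
    (hbg : b < g) (hG : ∀ q, b ≤ G q) {p k p' k' : ℕ} (hk : 1 ≤ k) (hp : G p = g)
    (hk1 : ∀ i, i < k → G (p + 1 + i) = b) (hk2 : G (p + 1 + k) = g) (hk' : 1 ≤ k')
    (hp' : G p' = g) (hk1' : ∀ i, i < k' → G (p' + 1 + i) = b) (hk2' : G (p' + 1 + k') = g) :
    k = k' := by
  by_contra hne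
  have hpk := hk1 (k - 1) (by omega)
  have hpk' : G (p + 1 + (k - 1) + 1) = g := by rwa [show p + 1 + (k - 1) + 1 = p + 1 + k by omega]
  have h3 : (k - 1) * t ≠ (k' - 1) * t := fun h0 =>
    hne (by have := Nat.eq_of_mul_eq_mul_right (by omega) h0; omega)
  have h4 := Nat.zero_le ((k - 1) * (b + t))
  have h5 := Nat.zero_le ((k' - 1) * (b + t))
  exact hw.four (by omega) (h.hasRet_mixed_one ht (by rw [hpk, hpk']))
    (h.hasRet_mixed_short ht hb hbg hpk hpk' (hG _)) (h.hasRet_mixed hb ht hbg hk hp hk1 hk2)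
    (h.hasRet_mixed hb ht hbg hk' hp' hk1' hk2')
    (by omega) (by omega) (by omega) (by omega) (by omega) (by omega)

theorem hasRet_mixed'_one (h : IsBlocks w t B G) (ht : 2 ≤ t)
    {s : ℕ} (hs : G s + G (s + 1) = b + g) :
    HasRet w (b + g + 2 * t + 1) (2 * t + 1) 1 1 := by
  have g1 := h.pos s
  have f1 := h.ones_cases s (x := B s) (by omega) (by omega)
  have f2 := h.ones_cases s (x := B s + 1) (by omega) (by omega)
  have f3 := h.ones_cases₃ s (y := B s + (b + g + 2 * t + 1)) (by omega)
  have f4 := h.ones_cases₃ s (y := B s + 1 + (b + g + 2 * t + 1)) (by omega)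
  refine hasRet_succ (x := B s) ?_ ?_ ?_
  · clear f2 f4
    rcases f3 with f | f | f | f | f | f | f <;> omega
  · clear f1 f3
    rcases f4 with f | f | f | f | f | f | f <;> omega
  · omega

theorem hasRet_mixed'_long (h : IsBlocks w t B G) (ht : 2 ≤ t) (hb : 1 ≤ b) (hbg : b < g)
    {q : ℕ} (hq : G q = g) (hq1 : G (q + 1) = b) (hq2 : G (q + 2) = g) :
    HasRet w (b + g + 2 * t + 1) (2 * t + 1) (g + 1) 1 := by
  have n1 := h.next q
  have o1 := h.ones_next q
  have e : B q + (t - 1) + (g + 1) = B (q + 1) := by omega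
  refine ⟨B q + (t - 1), ⟨by omega, ?_, ?_, ?_⟩, ?_⟩
  · have f1 := h.ones_cases q (x := B q + (t - 1)) (by omega) (by omega)
    have f2 := h.ones_cases₃ q (y := B q + (t - 1) + (b + g + 2 * t + 1)) (by omega)
    rcases f2 with f | f | f | f | f | f | f <;> omega
  · rw [e]
    have f2 := h.ones_cases₃ (q + 1) (y := B (q + 1) + (b + g + 2 * t + 1)) (by omega)
    rw [show q + 1 + 1 = q + 2 by rfl] at f2
    rcases f2 with f | f | f | f | f | f | f <;> omega
  · intro x hx hx'
    have f1 := h.ones_cases q (x := x) (by omega) (by omega)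
    have f2 := h.ones_cases₃ q (y := x + (b + g + 2 * t + 1)) (by omega)
    rcases f2 with f | f | f | f | f | f | f <;> rcases f1 with f' | f' <;> omega
  · rw [e]
    have f1 := h.ones_cases q (x := B q + (t - 1)) (by omega) (by omega)
    omega

theorem mixed'_next_ne (h : IsBlocks w t B G) (hb : 1 ≤ b) (ht : 2 ≤ t) (hbg : b < g)
    (hG : ∀ q, b ≤ G q)
    {q m : ℕ} (hm : 1 ≤ m) (hq : G q = b) (hm1 : ∀ i, i < m → G (q + 1 + i) = g)
    {x : ℕ} (hx : B q + (t - 1) < x) (hx' : x < B (q + m)) :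
    ones w (x + (b + g + 2 * t + 1)) ≠ ones w x + (2 * t + 1) := by
  have hp1 := hm1 0 (by omega)
  rw [add_zero] at hp1
  obtain ⟨s, q1, q2, q3, q4⟩ := h.locate_between (p := q) (p' := q + m - 1) (x := x) (by omega)
    (by rw [show q + m - 1 + 1 = q + m by omega]; omega)
  rw [h.next] at q4
  have f1 := h.ones_cases s q3 q4.le
  have f2 := h.ones_cases₃ s (y := x + (b + g + 2 * t + 1)) (by omega)
  have := hG (s + 2)
  rcases eq_or_ne s q with rfl | hqp
  · rcases f2 with f | f | f | f | f | f | f <;> rcases f1 with f' | f' <;> omega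
  · have hq0 := hm1 (s - (q + 1)) (by omega)
    rw [show q + 1 + (s - (q + 1)) = s by omega] at hq0
    have hq1 := hm1 (s - q) (by omega)
    rw [show q + 1 + (s - q) = s + 1 by omega] at hq1
    rcases f2 with f | f | f | f | f | f | f <;> rcases f1 with f' | f' <;> omega

theorem hasRet_mixed' (h : IsBlocks w t B G) (hb : 1 ≤ b) (ht : 2 ≤ t) (hbg : b < g)
    (hG : ∀ q, b ≤ G q)
    {q m : ℕ} (hm : 1 ≤ m) (hq : G q = b) (hm1 : ∀ i, i < m → G (q + 1 + i) = g)
    (hm2 : G (q + 1 + m) = b) :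
    HasRet w (b + g + 2 * t + 1) (2 * t + 1) (1 + b + (m - 1) * (g + t)) ((m - 1) * t + 1) := by
  have len := h.length_const (q := q + 1) (m := m - 1) fun i hi => hm1 i (by omega)
  rw [show q + 1 + (m - 1) = q + m by omega] at len
  have n0 := h.next q
  have o0 := h.ones_next q
  have hpk := hm1 (m - 1) (by omega)
  rw [show q + 1 + (m - 1) = q + m by omega] at hpk
  have hkt := h.ones_start (q + 1) (m - 1)
  rw [show q + 1 + (m - 1) = q + m by omega] at hkt
  have hp1 := hm1 0 (by omega)
  rw [add_zero] at hp1
  have g2 := hG (q + 2)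
  rw [show q + 1 + m = q + m + 1 by omega] at hm2
  have hj : B q + (t - 1) + (1 + b + (m - 1) * (g + t)) = B (q + m) := by omega
  refine ⟨B q + (t - 1), ⟨by omega, ?_, ?_, ?_⟩, ?_⟩
  · have f1 := h.ones_cases q (x := B q + (t - 1)) (by omega) (by omega)
    have f2 := h.ones_cases₃ q (y := B q + (t - 1) + (b + g + 2 * t + 1)) (by omega)
    clear hj hkt len
    rcases f2 with f | f | f | f | f | f | f <;> rcases f1 with f' | f' <;> omega
  · rw [hj]
    have f2 := h.ones_cases₃ (q + m) (y := B (q + m) + (b + g + 2 * t + 1)) (by omega)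
    clear hj hkt len
    rcases f2 with f | f | f | f | f | f | f <;> omega
  · intro x hx hx'
    rw [hj] at hx'
    exact h.mixed'_next_ne hb ht hbg hG hm hq hm1 hx hx'
  · rw [hj]
    have f1 := h.ones_cases q (x := B q + (t - 1)) (by omega) (by omega)
    omega

/-- All runs of the long gap have the same length if `t ≥ 2` and short gaps are isolated. -/
theorem long_run_unique_of_isolated (h : IsBlocks w t B G) (hw : Good w) (hb : 1 ≤ b) (ht : 2 ≤ t)
    (hbg : b < g) (hG : ∀ q, b ≤ G q) (hiso : ∀ q, G q = b → G (q + 1) = g)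
    {q m q' m' : ℕ} (hm : 1 ≤ m) (hq : G q = b)
    (hm1 : ∀ i, i < m → G (q + 1 + i) = g) (hm2 : G (q + 1 + m) = b) (hm' : 1 ≤ m')
    (hq' : G q' = b) (hm1' : ∀ i, i < m' → G (q' + 1 + i) = g) (hm2' : G (q' + 1 + m') = b) :
    m = m' := by
  by_contra hne
  have hpk := hm1 (m - 1) (by omega)
  rw [show q + 1 + (m - 1) = q + m by omega] at hpk
  rw [show q + 1 + m = q + m + 1 by omega] at hm2
  have h3 : (m - 1) * t ≠ (m' - 1) * t := fun h0 =>
    hne (by have := Nat.eq_of_mul_eq_mul_right (by omega) h0; omega)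
  have h4 : m - 1 = 0 ∨ t ≤ (m - 1) * t :=
    (Nat.eq_zero_or_pos (m - 1)).imp_right fun h0 => Nat.le_mul_of_pos_left t h0
  have h5 : m' - 1 = 0 ∨ t ≤ (m' - 1) * t :=
    (Nat.eq_zero_or_pos (m' - 1)).imp_right fun h0 => Nat.le_mul_of_pos_left t h0
  refine hw.four (by omega) (h.hasRet_mixed'_one ht (s := q) (by rw [hq, hiso q hq]))
    (h.hasRet_mixed'_long ht hb hbg hpk hm2 (hiso _ hm2))
    (h.hasRet_mixed' hb ht hbg hG hm hq hm1 (by rwa [show q + 1 + m = q + m + 1 by omega]))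
    (h.hasRet_mixed' hb ht hbg hG hm' hq' hm1' hm2')
    (by omega) ?_ ?_ ?_ ?_ (by omega)
  · rcases h4 with h4 | h4
    · rw [h4]; omega
    · omega
  · rcases h5 with h5 | h5
    · rw [h5]; omega
    · omega
  · rcases h4 with h4 | h4
    · rw [h4]; omega
    · omega
  · rcases h5 with h5 | h5
    · rw [h5]; omega
    · omega

end IsBlocks

namespace IsBlocks

variable {w : ℕ → Bool} {t b g : ℕ} {B G : ℕ → ℕ}

theorem hasRet_gap (h : IsBlocks w t B G) (ht : 1 ≤ t) (q : ℕ) :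
    HasRet w (t + 1) t (if G q = 1 then 1 else t + G q - 1) (if G q = 1 then 1 else t) := by
  have n1 := h.next q
  have o1 := h.ones_next q
  have g0 := h.pos q
  have g1 := h.pos (q + 1)
  split_ifs with hg
  · have f1 := h.ones_cases q (x := B q) (by omega) (by omega)
    have f2 := h.ones_cases q (x := B q + 1) (by omega) (by omega)
    have f3 := h.ones_cases₃ q (y := B q + (t + 1)) (by omega)
    have f4 := h.ones_cases₃ q (y := B q + 1 + (t + 1)) (by omega)
    refine hasRet_succ (x := B q) ?_ ?_ ?_
    · rcases f3 with f | f | f | f | f | f | f <;> omega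
    · rcases f4 with f | f | f | f | f | f | f <;> omega
    · omega
  · refine ⟨B q, ⟨by omega, ?_, ?_, ?_⟩, ?_⟩
    · have f2 := h.ones_cases₃ q (y := B q + (t + 1)) (by omega)
      rcases f2 with f | f | f | f | f | f | f <;> omega
    · have f1 := h.ones_cases q (x := B q + (t + G q - 1)) (by omega) (by omega)
      have f2 := h.ones_cases₃ q (y := B q + (t + G q - 1) + (t + 1)) (by omega)
      rcases f2 with f | f | f | f | f | f | f <;> omega
    · intro x hx hx'
      have f1 := h.ones_cases q (x := x) (by omega) (by omega)
      have f2 := h.ones_cases₃ q (y := x + (t + 1)) (by omega)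
      rcases f2 with f | f | f | f | f | f | f <;> rcases f1 with f' | f' <;> omega
    · have f1 := h.ones_cases q (x := B q + (t + G q - 1)) (by omega) (by omega)
      omega

theorem hasRet_gap_zero (h : IsBlocks w t B G) (ht : 1 ≤ t) : HasRet w (t + 1) t 1 0 := by
  have n1 := h.next 0
  have o1 := h.ones_next 0
  have g0 := h.pos 0
  have g1 := h.pos 1
  have f1 := h.ones_cases 0 (x := B 0 + t + G 0 - 1) (by omega) (by omega)
  have f3 := h.ones_cases₃ 0 (y := B 0 + t + G 0 - 1 + (t + 1)) (by omega)
  have f4 := h.ones_cases₃ 1 (y := B 1 + (t + 1)) (by omega)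
  simp only [zero_add] at n1 o1 f3
  have e : B 0 + t + G 0 - 1 + 1 = B 1 := by omega
  refine hasRet_succ (x := B 0 + t + G 0 - 1) ?_ ?_ ?_
  · rcases f3 with f | f | f | f | f | f | f <;> omega
  · rw [e]
    rcases f4 with f | f | f | f | f | f | f <;> omega
  · rw [e]; omega

theorem gap_eq_or_eq (h : IsBlocks w t B G) (hw : Good w) (ht : 1 ≤ t) {q q' : ℕ}
    (hne : G q ≠ G q') (s : ℕ) : G s = G q ∨ G s = G q' := by
  by_contra! hs
  have g0 := h.pos q
  have g1 := h.pos q'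
  have g2 := h.pos s
  refine hw.four (by omega) (h.hasRet_gap_zero ht) (h.hasRet_gap ht q) (h.hasRet_gap ht q')
    (h.hasRet_gap ht s) ?_ ?_ ?_ ?_ ?_ ?_ <;> split_ifs <;> rintro ⟨e1, e2⟩ <;> omega

theorem false_of_runs (h : IsBlocks w t B G) (hw : Good w) (ht : 1 ≤ t) (hb : 1 ≤ b)
    (hbg : b < g) (hG : ∀ q, G q = b ∨ G q = g) (hbio : ∀ N, ∃ q, N ≤ q ∧ G q = b)
    (hgio : ∀ N, ∃ q, N ≤ q ∧ G q = g)
    (hk : ∀ p p' k k', 1 ≤ k → G p = g → (∀ i, i < k → G (p + 1 + i) = b) → G (p + 1 + k) = g →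
      1 ≤ k' → G p' = g → (∀ i, i < k' → G (p' + 1 + i) = b) → G (p' + 1 + k') = g → k = k')
    (hm : ∀ p p' k k', 1 ≤ k → G p = b → (∀ i, i < k → G (p + 1 + i) = g) → G (p + 1 + k) = b →
      1 ≤ k' → G p' = b → (∀ i, i < k' → G (p' + 1 + i) = g) → G (p' + 1 + k') = b → k = k') :
    False := by
  have hT : ∀ q, decide (G q = b) = true ↔ G q = b := by simp
  have hF : ∀ q, decide (G q = b) = false ↔ G q = g := by
    intro q
    rw [decide_eq_false_iff_not]
    rcases hG q with h1 | h1 <;> omega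
  obtain ⟨N, k, m, hk1, hm1, hc⟩ := periodic_of_isRun (c := fun q => decide (G q = b)) (by
      rintro (_ | _) N
      · obtain ⟨q, hq, hq'⟩ := hgio N
        exact ⟨q, hq, (hF q).2 hq'⟩
      · obtain ⟨q, hq, hq'⟩ := hbio N
        exact ⟨q, hq, (hT q).2 hq'⟩) (by
      rintro (_ | _) p p' k k' ⟨h1, h2, h3, h4⟩ ⟨h1', h2', h3', h4'⟩
      · simp only [hF, hT, Bool.not_false] at *
        exact hm p p' k k' h1 h2 h3 h4 h1' h2' h3' h4'
      · simp only [hF, hT, Bool.not_true] at *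
        exact hk p p' k k' h1 h2 h3 h4 h1' h2' h3' h4')
  refine (h.shift N).false_of_periodic hw ht hb hbg hk1 (Or.inl hm1) fun q => ?_
  have := hc q
  rcases hG (N + q) with h1 | h1
  · rw [(hT _).2 h1, eq_comm, decide_eq_true_iff] at this
    rw [if_pos this, h1]
  · rw [(hF _).2 h1, eq_comm, decide_eq_false_iff_not] at this
    rw [if_neg this, h1]

theorem exists_adjacent (hne : b ≠ g) (hG : ∀ q, G q = b ∨ G q = g)
    (hbio : ∀ N, ∃ q, N ≤ q ∧ G q = b) (hgio : ∀ N, ∃ q, N ≤ q ∧ G q = g) :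
    ∃ q, G q = g ∧ G (q + 1) = b := by
  obtain ⟨p, -, hp⟩ := hgio 0
  obtain ⟨p', hpp, hp'⟩ := hbio p
  obtain ⟨r, rfl⟩ := Nat.exists_eq_add_of_le hpp
  by_contra! hcon
  have : ∀ i, G (p + i) = g := by
    intro i
    induction i with
    | zero => exact hp
    | succ i ih => exact (hG _).resolve_left (hcon _ ih)
  have := this r
  omega

theorem false_of_good (h : IsBlocks w t B G) (hw : Good w) (ht : 1 ≤ t)
    (h1 : t = 1 → ∀ b g, b < g → (∀ q, G q = b ∨ G q = g) → (∀ N, ∃ q, N ≤ q ∧ G q = b) →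
      (∀ N, ∃ q, N ≤ q ∧ G q = g) → 2 * b < g ∧ ∃ s, G s = b ∧ G (s + 1) = b) : False := by
  have hconst : ∀ N, ∃ q, N ≤ q ∧ G q ≠ G N := by
    by_contra! hcon
    obtain ⟨N, hN⟩ := hcon
    refine (h.shift N).false_of_periodic hw ht (h.pos N) (Nat.lt_succ_self _) le_rfl
      (m := 0) (Or.inr rfl) fun q => ?_
    rw [if_pos (by omega)]
    exact hN _ (by omega)
  obtain ⟨b, g, hbg, hG, hbio, hgio⟩ : ∃ b g, b < g ∧ (∀ q, G q = b ∨ G q = g) ∧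
      (∀ N, ∃ q, N ≤ q ∧ G q = b) ∧ (∀ N, ∃ q, N ≤ q ∧ G q = g) := by
    obtain ⟨q, -, hq⟩ := hconst 0
    have hG := h.gap_eq_or_eq hw ht hq
    have hio : ∀ N, (∃ s, N ≤ s ∧ G s = G q) ∧ ∃ s, N ≤ s ∧ G s = G 0 := by
      intro N
      obtain ⟨s, hs, hs'⟩ := hconst N
      rcases hG N with h2 | h2 <;> rcases hG s with h3 | h3
      · omega
      · exact ⟨⟨N, le_rfl, h2⟩, s, hs, h3⟩
      · exact ⟨⟨s, hs, h3⟩, N, le_rfl, h2⟩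
      · omega
    rcases lt_or_gt_of_ne hq with h2 | h2
    · exact ⟨_, _, h2, hG, fun N => (hio N).1, fun N => (hio N).2⟩
    · exact ⟨_, _, h2, fun s => (hG s).symm, fun N => (hio N).2, fun N => (hio N).1⟩
  obtain ⟨q₀, -, hq₀⟩ := hbio 0
  have hb : 1 ≤ b := hq₀ ▸ h.pos q₀
  have hGb : ∀ q, b ≤ G q := fun q => by rcases hG q with h2 | h2 <;> omega
  obtain ⟨s, hs, hs1⟩ := exists_adjacent (by omega) hG hbio hgio
  by_cases hbb : ∃ s, G s = b ∧ G (s + 1) = b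
  · obtain ⟨s', hs', hs1'⟩ := hbb
    rcases lt_or_ge (2 * b) g with h2 | h2
    · refine h.false_of_runs hw ht hb hbg hG hbio hgio ?_ ?_
      · intro p p' k k' a1 a2 a3 a4 a5 a6 a7 a8
        exact h.short_run_unique hw hb ht h2 a1 a2 a3 a4 a5 a6 a7 a8
      · intro p p' k k' a1 a2 a3 a4 a5 a6 a7 a8
        exact h.long_run_unique hw hb ht h2 hs' hs1' a1 a2 a3 a4 a5 a6 a7 a8
    · have ht2 : 2 ≤ t := by
        by_contra h3
        have := (h1 (by omega) b g hbg hG hbio hgio).1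
        omega
      have key : ∀ p k, 1 ≤ k → (∀ i, i < k → G (p + 1 + i) = g) → k = 1 := by
        intro p k hk hp
        by_contra h3
        exact h.not_long_long hw hb ht hbg h2 hs' hs1' hs hs1 (hp 0 (by omega))
          (hp 1 (by omega))
      refine h.false_of_runs hw ht hb hbg hG hbio hgio ?_ ?_
      · intro p p' k k' a1 a2 a3 a4 a5 a6 a7 a8
        exact h.short_run_unique_of_two_le hw hb ht2 hbg hGb a1 a2 a3 a4 a5 a6 a7 a8
      · intro p p' k k' a1 a2 a3 a4 a5 a6 a7 a8
        rw [key p k a1 a3, key p' k' a5 a7]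
  · have ht2 : 2 ≤ t := by
      by_contra h3
      exact hbb (h1 (by omega) b g hbg hG hbio hgio).2
    push Not at hbb
    refine h.false_of_runs hw ht hb hbg hG hbio hgio ?_ ?_
    · intro p p' k k' a1 a2 a3 a4 a5 a6 a7 a8
      exact h.short_run_unique_of_two_le hw hb ht2 hbg hGb a1 a2 a3 a4 a5 a6 a7 a8
    · intro p p' k k' a1 a2 a3 a4 a5 a6 a7 a8
      exact h.long_run_unique_of_isolated hw hb ht2 hbg hGb
        (fun q hq => (hG _).resolve_left (hbb q hq)) a1 a2 a3 a4 a5 a6 a7 a8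

end IsBlocks

section Paths

variable {s : ℕ → ℕ} {v i j : ℕ}

theorem exists_last_up (hs : ∀ x, s (x + 1) ≤ s x + 1 ∧ s x ≤ s (x + 1) + 1) (hij : i ≤ j)
    (hi : s i ≤ v) (hj : v < s j) : ∃ r, i ≤ r ∧ r < j ∧ s r = v ∧ s (r + 1) = v + 1 ∧
      ∀ x, r < x → x ≤ j → v < s x := by
  induction j, hij using Nat.le_induction with
  | base => omega
  | succ j hij ih =>
    have := hs j
    rcases le_or_gt (s j) v with h | h
    · refine ⟨j, hij, by omega, by omega, by omega, fun x hx hx' => ?_⟩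
      obtain rfl : x = j + 1 := by omega
      exact hj
    · obtain ⟨r, h1, h2, h3, h4, h5⟩ := ih h
      refine ⟨r, h1, by omega, h3, h4, fun x hx hx' => ?_⟩
      rcases eq_or_ne x (j + 1) with rfl | h6
      · exact hj
      · exact h5 x hx (by omega)

theorem exists_last_down (hs : ∀ x, s (x + 1) ≤ s x + 1 ∧ s x ≤ s (x + 1) + 1) (hij : i ≤ j)
    (hi : v < s i) (hj : s j ≤ v) : ∃ r, i ≤ r ∧ r < j ∧ s r = v + 1 ∧ s (r + 1) = v ∧
      ∀ x, r < x → x ≤ j → s x ≤ v := by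
  induction j, hij using Nat.le_induction with
  | base => omega
  | succ j hij ih =>
    have := hs j
    rcases lt_or_ge v (s j) with h | h
    · refine ⟨j, hij, by omega, by omega, by omega, fun x hx hx' => ?_⟩
      obtain rfl : x = j + 1 := by omega
      exact hj
    · obtain ⟨r, h1, h2, h3, h4, h5⟩ := ih h
      refine ⟨r, h1, by omega, h3, h4, fun x hx hx' => ?_⟩
      rcases eq_or_ne x (j + 1) with rfl | h6
      · exact hj
      · exact h5 x hx (by omega)

theorem exists_first {P : ℕ → Prop} (hij : i ≤ j) (hi : ¬P i) (hj : P j) :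
    ∃ r, i ≤ r ∧ r < j ∧ P (r + 1) ∧ ∀ x, i ≤ x → x ≤ r → ¬P x := by
  induction j, hij using Nat.le_induction with
  | base => exact absurd hj hi
  | succ j hij ih =>
    by_cases h : ∃ x, i ≤ x ∧ x ≤ j ∧ P x
    · classical
      have h' : ∃ x, i ≤ x ∧ P x := ⟨j + 1, by omega, hj⟩
      obtain ⟨x, h1, h2, h3⟩ := h
      have hle : Nat.find h' ≤ x := Nat.find_min' h' ⟨h1, h3⟩
      have hsp := Nat.find_spec h'
      have hne : Nat.find h' ≠ i := fun h0 => hi (h0 ▸ hsp.2)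
      refine ⟨Nat.find h' - 1, by omega, by omega, ?_, fun y hy hy' hP => ?_⟩
      · rw [Nat.sub_add_cancel (by omega)]
        exact hsp.2
      · exact Nat.find_min h' (m := y) (by omega) ⟨hy, hP⟩
    · push Not at h
      exact ⟨j, hij, by omega, hj, h⟩

theorem exists_first_up (hs : ∀ x, s (x + 1) ≤ s x + 1 ∧ s x ≤ s (x + 1) + 1) (hij : i ≤ j)
    (hi : s i ≤ v) (hj : v < s j) : ∃ r, i ≤ r ∧ r < j ∧ s r = v ∧ s (r + 1) = v + 1 ∧
      ∀ x, i ≤ x → x ≤ r → s x ≤ v := by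
  obtain ⟨r, h1, h2, h3, h4⟩ := exists_first (P := fun x => v < s x) hij (by omega) hj
  have h5 := h4 r h1 le_rfl
  have := hs r
  exact ⟨r, h1, h2, by omega, by omega, fun x hx hx' => not_lt.1 (h4 x hx hx')⟩

theorem exists_first_down (hs : ∀ x, s (x + 1) ≤ s x + 1 ∧ s x ≤ s (x + 1) + 1) (hij : i ≤ j)
    (hi : v < s i) (hj : s j ≤ v) : ∃ r, i ≤ r ∧ r < j ∧ s r = v + 1 ∧ s (r + 1) = v ∧
      ∀ x, i ≤ x → x ≤ r → v < s x := by
  obtain ⟨r, h1, h2, h3, h4⟩ := exists_first (P := fun x => s x ≤ v) hij (by omega) hj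
  have h5 := h4 r h1 le_rfl
  have := hs r
  exact ⟨r, h1, h2, by omega, by omega, fun x hx hx' => not_le.1 (h4 x hx hx')⟩

end Paths

/-- If some windows of equal length differ by at least 3, then for a suitable length the number of
ones in the window is a path `s` between the levels `lo` and `lo + 3`, with the extreme levels
being left immediately by shortening the window at either end. -/
theorem Unbal.exists_path {w : ℕ → Bool} (hu : Unbal w) :
    ∃ (n lo : ℕ) (s : ℕ → ℕ), 0 < n ∧ (∀ x, ones w (x + n) = ones w x + s x) ∧ (∀ x, lo ≤ s x ∧ s x
        ≤ lo + 3) ∧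
      (∃ x, s x = lo) ∧ (∃ x, s x = lo + 3) ∧ (∀ x, s x = lo → w x = false) ∧
      (∀ x, s x = lo + 3 → w x = true) := by
  classical
  unfold Unbal at hu
  have hmin := fun m (hm : m < Nat.find hu) => Nat.find_min hu hm
  obtain ⟨x₀, y₀, h0⟩ := Nat.find_spec hu
  generalize Nat.find hu = n at h0 hmin
  rcases n with _ | n
  · simp at h0
    omega
  have hm := hmin n (by omega)
  push Not at hm
  have e : ∀ x, x + (n + 1) = x + n + 1 := fun x => rfl
  have hle := fun x => ones_le w x n
  have htn := fun x => Bool.toNat_le (w x)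
  have hsucc := fun x => ones_succ w x
  have hsh : ∀ x, x + 1 + n = x + n + 1 := fun x => by omega
  simp only [e] at *
  have key : ∀ x y, ones w (y + n + 1) + ones w x ≤ ones w (x + n + 1) + 3 + ones w y := by
    intro x y
    have h1 := hm x y
    have h2 := hsucc (x + n)
    have h3 := hsucc (y + n)
    have h4 := htn (y + n)
    omega
  have k0 := key x₀ y₀
  have l0 := hle x₀
  have m0 := hsucc (x₀ + n)
  have r0 := hsucc (y₀ + n)
  have l0' := hle y₀
  have t0 := htn (y₀ + n)
  refine ⟨n + 1, ones w (x₀ + n + 1) - ones w x₀, fun x => ones w (x + n + 1) - ones w x,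
    by omega, ?_, ?_, ⟨x₀, rfl⟩, ⟨y₀, ?_⟩, ?_, ?_⟩
  · intro x
    have := hle x
    have := hsucc (x + n)
    change ones w (x + n + 1) = ones w x + (ones w (x + n + 1) - ones w x)
    omega
  · intro x
    have := hle x
    have := hsucc (x + n)
    have k1 := key x y₀
    have k2 := key x₀ x
    beta_reduce
    constructor <;> omega
  · have := hle y₀
    have := hsucc (y₀ + n)
    change ones w (y₀ + n + 1) - ones w y₀ = ones w (x₀ + n + 1) - ones w x₀ + 3
    omega
  · intro x hx
    by_contra hc
    have h1 := hm (x + 1) y₀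
    have h2 := hsucc x
    have h4 := hle x
    have h5 := hsucc (x + n)
    rw [Bool.not_eq_false] at hc
    rw [hc, Bool.toNat_true] at h2
    rw [hsh] at h1
    change ones w (x + n + 1) - ones w x = ones w (x₀ + n + 1) - ones w x₀ at hx
    omega
  · intro x hx
    by_contra hc
    have h1 := hm x₀ (x + 1)
    have h2 := hsucc x
    have h4 := hle x
    have h5 := hsucc (x + n)
    rw [Bool.not_eq_true] at hc
    rw [hc, Bool.toNat_false] at h2
    rw [hsh] at h1
    change ones w (x + n + 1) - ones w x = ones w (x₀ + n + 1) - ones w x₀ + 3 at hx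
    omega

/-- The path of window sums of length `n` of a word without factor `11`, with its four levels. -/
structure LevelPath (w : ℕ → Bool) (n lo : ℕ) (s : ℕ → ℕ) : Prop where
  pos : 0 < n
  num : ∀ x, ones w (x + n) = ones w x + s x
  bd : ∀ x, lo ≤ s x ∧ s x ≤ lo + 3
  low : ∀ x, s x = lo → w x = false
  high : ∀ x, s x = lo + 3 → w x = true
  low_io : ∀ N, ∃ x, N ≤ x ∧ s x = lo
  high_io : ∀ N, ∃ x, N ≤ x ∧ s x = lo + 3
  one_one : ∀ x, w x = true → w (x + 1) = false

theorem ones_lt_ones {w : ℕ → Bool} {x y : ℕ} (hx : w x = true) (hxy : x < y) :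
    ones w x + 1 ≤ ones w y := by
  have h1 := ones_true hx
  have h2 := (ones_mono w (show x + 1 ≤ y by omega)).1
  omega

namespace LevelPath

variable {w : ℕ → Bool} {n lo : ℕ} {s : ℕ → ℕ}

theorem next (h : LevelPath w n lo s) (x : ℕ) :
    s (x + 1) + (w x).toNat = s x + (w (x + n)).toNat := by
  have h1 := h.num x
  have h2 := h.num (x + 1)
  rw [show x + 1 + n = x + n + 1 by omega, ones_succ, ones_succ] at h2
  omega

theorem step (h : LevelPath w n lo s) (x : ℕ) : s (x + 1) ≤ s x + 1 ∧ s x ≤ s (x + 1) + 1 := by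
  have h1 := h.next x
  have h2 := Bool.toNat_le (w x)
  have h3 := Bool.toNat_le (w (x + n))
  omega

theorem up (h : LevelPath w n lo s) {x : ℕ} (hx : s (x + 1) = s x + 1) :
    w x = false ∧ w (x + n) = true := by
  have h1 := h.next x
  cases hw : w x <;> cases hw' : w (x + n) <;> simp [hw, hw'] at h1 ⊢ <;> omega

theorem down (h : LevelPath w n lo s) {x : ℕ} (hx : s (x + 1) + 1 = s x) :
    w x = true ∧ w (x + n) = false := by
  have h1 := h.next x
  cases hw : w x <;> cases hw' : w (x + n) <;> simp [hw, hw'] at h1 ⊢ <;> omega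

theorem stay (h : LevelPath w n lo s) {x : ℕ} (hx : s (x + 1) = s x) : w (x + n) = w x := by
  have h1 := h.next x
  cases hw : w x <;> cases hw' : w (x + n) <;> simp [hw, hw'] at h1 ⊢ <;> omega

theorem hasRet (h : LevelPath w n lo s) {i l m v : ℕ} (hl : 0 < l) (hi : s i = v)
    (hj : s (i + l) = v) (hb : ∀ x, i < x → x < i + l → s x ≠ v)
    (hm : ones w (i + l) = ones w i + m) : HasRet w n v l m := by
  refine ⟨i, ⟨by omega, by rw [h.num, hi], by rw [h.num, hj], fun x h1 h2 h3 => ?_⟩, hm⟩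
  rw [h.num] at h3
  exact hb x h1 h2 (by omega)

/-- A visit to the top level lasts for one step. -/
theorem around_top (h : LevelPath w n lo s) {f : ℕ} (hf : s (f + 1) = lo + 3)
    (hf' : s f ≠ lo + 3) : s f = lo + 2 ∧ w f = false ∧ w (f + 1) = true ∧ w (f + n) = true ∧
      s (f + 2) = lo + 2 := by
  have h1 := h.step f
  have h2 := h.bd f
  have h3 := h.up (x := f) (by omega)
  have h4 := h.high _ hf
  have h5 := h.one_one _ h3.2
  have h6 := h.next (f + 1)
  rw [h4, show f + 1 + n = f + n + 1 by omega, h5, show f + 1 + 1 = f + 2 by rfl] at h6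
  simp only [Bool.toNat_true, Bool.toNat_false] at h6
  exact ⟨by omega, h3.1, h4, h3.2, by omega⟩

/-- A last ascent from below, before `f`, is followed by a stay with the letter `0`. -/
theorem stay_after_last_up (h : LevelPath w n lo s) {r f : ℕ} (hr : s (r + 1) = s r + 1)
    (hrf : r + 1 < f) (hb : ∀ x, r < x → x ≤ f → s r < s x) :
    w (r + 1) = false ∧ s (r + 2) = s r + 1 := by
  have h3 := h.up hr
  have h5 := h.one_one _ h3.2
  have h6 := h.next (r + 1)
  have h7 := hb (r + 2) (by omega) (by omega)
  rw [show r + 1 + n = r + n + 1 by omega, h5, show r + 1 + 1 = r + 2 by rfl] at h6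
  cases hw : w (r + 1)
  · rw [hw] at h6
    exact ⟨rfl, by simp at h6; omega⟩
  · rw [hw] at h6
    simp at h6
    omega

theorem hasRet_low (h : LevelPath w n lo s) : ∃ l, 2 ≤ l ∧ HasRet w n (lo + 1) l 1 := by
  obtain ⟨f, -, hf⟩ := h.high_io 0
  obtain ⟨x, hx, hx'⟩ := h.low_io f
  obtain ⟨f', hf', hf''⟩ := h.high_io x
  obtain ⟨r, r1, r2, r3, r4, -⟩ := exists_last_down h.step hx (v := lo) (by omega) (by omega)
  obtain ⟨r', r1', r2', r3', r4', r5'⟩ := exists_first_up h.step (show r + 1 ≤ f' by omega)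
    (v := lo) (by omega) (by omega)
  obtain ⟨d, rfl⟩ := Nat.exists_eq_add_of_le r1'
  have hz : ∀ q, q < d + 1 → w (r + 1 + q) = false := fun q hq =>
    h.low _ (by have := r5' (r + 1 + q) (by omega) (by omega); have := h.bd (r + 1 + q); omega)
  have ho := ones_eq_zeros hz le_rfl
  have ho' := ones_true (h.down (x := r) (by omega)).1
  refine ⟨d + 2, by omega, h.hasRet (i := r) (by omega) r3 ?_ ?_ ?_⟩
  · rw [show r + (d + 2) = r + 1 + d + 1 by omega, r4']
  · intro x hx hx'
    have := r5' x (by omega) (by omega)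
    omega
  · rw [show r + (d + 2) = r + 1 + (d + 1) by omega, ho, ho']

theorem hasRet_up (h : LevelPath w n lo s) : ∃ l m, 2 ≤ m ∧ HasRet w n (lo + 1) l m := by
  obtain ⟨e, -, he⟩ := h.low_io 0
  obtain ⟨f, hf, hf'⟩ := h.high_io e
  obtain ⟨x, hx, hx'⟩ := h.low_io f
  obtain ⟨r, r1, r2, r3, r4, r5⟩ := exists_last_up h.step hf (v := lo + 1) (by omega) (by omega)
  obtain ⟨r', r1', r2', r3', r4', r5'⟩ := exists_first_down h.step hx
    (v := lo + 1) (by omega) (by omega)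
  have hfr : f ≠ r' := by rintro rfl; omega
  have o1 := (ones_mono w r2.le).1
  have o2 := ones_lt_ones (h.high _ hf') (show f < r' by omega)
  have o3 := ones_true (h.down (x := r') (by omega)).1
  obtain ⟨l, hl⟩ := Nat.exists_eq_add_of_le (show r ≤ r' + 1 by omega)
  rw [hl] at o3 r4'
  refine ⟨l, ones w (r + l) - ones w r, by omega, h.hasRet (i := r) (by omega) r3 r4' ?_
    (by omega)⟩
  intro x hx hx'
  rcases le_total x f with h1 | h1
  · have := r5 x hx h1
    omega
  · have := r5' x h1 (by omega)
    omega

theorem hasRet_down (h : LevelPath w n lo s) :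
    ∃ l m, 2 ≤ l ∧ 2 ≤ m ∧ HasRet w n (lo + 2) l m := by
  obtain ⟨f, -, hf⟩ := h.high_io 0
  obtain ⟨x, hx, hx'⟩ := h.low_io f
  obtain ⟨f', hf', hf''⟩ := h.high_io x
  obtain ⟨r, r1, r2, r3, r4, r5⟩ := exists_last_down h.step hx (v := lo + 1) (by omega) (by omega)
  have hrx : r + 1 ≤ x := by omega
  obtain ⟨q, q1, q2, q3, q4, -⟩ := exists_last_down h.step hrx (v := lo) (by omega) (by omega)
  obtain ⟨r', r1', r2', r3', r4', r5'⟩ := exists_first_up h.step hf' (v := lo + 1)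
    (by omega) (by omega)
  have o1 := ones_lt_ones (h.down (x := r) (by omega)).1 (show r < q by omega)
  have o2 := ones_lt_ones (h.down (x := q) (by omega)).1 (show q < r' + 1 by omega)
  obtain ⟨l, hl⟩ := Nat.exists_eq_add_of_le (show r ≤ r' + 1 by omega)
  rw [hl] at o2 r4'
  refine ⟨l, ones w (r + l) - ones w r, by omega, by omega, h.hasRet (i := r) (by omega) r3 r4' ?_
    (by omega)⟩
  intro y hy hy'
  rcases le_total y x with h1 | h1
  · have := r5 y hy h1
    omega
  · have := r5' y h1 (by omega)
    omega

theorem hasRet_top (h : LevelPath w n lo s) : HasRet w n (lo + 2) 2 1 := by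
  obtain ⟨e, -, he⟩ := h.low_io 0
  obtain ⟨f, hf, hf'⟩ := h.high_io e
  obtain ⟨r, r1, r2, r3, r4, r5⟩ := exists_last_up h.step hf (v := lo + 2) (by omega) (by omega)
  obtain ⟨a1, a2, a3, a4, a5⟩ := h.around_top (f := r) r4 (by omega)
  refine h.hasRet (i := r) (by omega) r3 a5 ?_ ?_
  · intro x hx hx'
    obtain rfl : x = r + 1 := by omega
    omega
  · rw [show r + 2 = r + 1 + 1 by rfl, ones_true a3, ones_false a2]

theorem hasRet_stay (h : LevelPath w n lo s) {x v : ℕ} (hx : s x = v) (hx' : s (x + 1) = v) :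
    HasRet w n v 1 (w x).toNat :=
  h.hasRet (i := x) (by omega) hx hx' (fun y _ _ => by omega) (ones_succ w x)

set_option maxHeartbeats 400000 in
theorem exists_ascent (h : LevelPath w n lo s) (hw : Good w) : ∃ e c f, e < c ∧ c < f ∧
    w e = false ∧ w (e + n) = true ∧ w c = false ∧ w (c + n) = true ∧ w f = false ∧
    w (f + n) = true ∧ s (c + 1) = lo + 2 ∧ s f = lo + 2 ∧
    (∀ x, e < x → x ≤ f → lo + 1 ≤ s x ∧ s x ≤ lo + 2) ∧ (∀ x, e < x → x ≤ c → s x = lo + 1) ∧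
    (∀ x, s x = lo + 1 → s (x + 1) = lo + 1 → w x = false) ∧
    (∀ x, s x = lo + 2 → s (x + 1) = lo + 2 → w x = false) ∧
    ∀ l, HasRet w n (lo + 2) l 1 → l = 2 := by
  obtain ⟨x₀, -, hx₀⟩ := h.low_io 0
  obtain ⟨f', hf', hf''⟩ := h.high_io x₀
  -- the last lowest position before the first highest position
  obtain ⟨f, f1, -, f2, f3⟩ := exists_first (P := fun x => s x = lo + 3) hf' (by omega) hf''
  obtain ⟨e, e1, e2, e3, e4, e5⟩ := exists_last_up h.step f1 (v := lo) (by omega)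
    (by have := h.step f; omega)
  obtain ⟨a1, a2, a3, a4, a5⟩ := h.around_top f2 (f3 f f1 le_rfl)
  have hle : ∀ x, e < x → x ≤ f → lo + 1 ≤ s x ∧ s x ≤ lo + 2 := by
    intro x hx hx'
    have := e5 x hx hx'
    have := h.bd x
    have := f3 x (by omega) hx'
    omega
  have hef : e + 1 < f := by
    have : e + 1 ≠ f := by rintro rfl; omega
    omega
  -- no stay with `1` at the level `lo + 1`
  have stay1 : ∀ x, s x = lo + 1 → s (x + 1) = lo + 1 → w x = false := by
    intro x hx hx'
    by_contra hc
    rw [Bool.not_eq_false] at hc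
    obtain ⟨b1, b2⟩ := h.stay_after_last_up (r := e) (by omega) hef
      (fun x hx hx' => by have := e5 x hx hx'; omega)
    have c1 := h.hasRet_stay (x := e + 1) e4 (by rw [show e + 1 + 1 = e + 2 by rfl]; omega)
    have c2 := h.hasRet_stay hx hx'
    rw [b1] at c1
    rw [hc] at c2
    obtain ⟨l, hl, c3⟩ := h.hasRet_low
    obtain ⟨l', m, hm, c4⟩ := h.hasRet_up
    exact hw.four h.pos c1 c2 c3 c4 (by simp) (by simp) (by simp; omega) (by omega) (by simp; omega)
      (by omega)
  obtain ⟨c, c1, c2, c3, c4, c5⟩ := exists_last_up h.step (show e + 1 ≤ f by omega) (v := lo + 1)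
    (by omega) (by omega)
  have hcf : c + 1 < f := by
    have h1 := (h.up (x := c) (by omega)).2
    have h2 : c + 1 ≠ f := by
      rintro rfl
      have h3 := h.one_one _ h1
      rw [show c + n + 1 = c + 1 + n by omega, a4] at h3
      exact absurd h3 (by decide)
    omega
  -- returns at the level `lo + 2` with a single one
  have single : ∀ l, HasRet w n (lo + 2) l 1 → l = 2 := by
    intro l hl
    by_contra hne
    obtain ⟨b1, b2⟩ := h.stay_after_last_up (r := c) (by omega) hcf
      (fun x hx hx' => by have := c5 x hx hx'; omega)
    have d1 := h.hasRet_stay (x := c + 1) c4 (by rw [show c + 1 + 1 = c + 2 by rfl]; omega)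
    rw [b1] at d1
    obtain ⟨l', m, hl', hm, d4⟩ := h.hasRet_down
    clear stay1 hle c5 e5 f3
    exact hw.four h.pos d1 h.hasRet_top hl d4 (by simp) (by simp) (by simp; omega) (by omega)
      (by omega) (by omega)
  have stay2 : ∀ x, s x = lo + 2 → s (x + 1) = lo + 2 → w x = false := by
    intro x hx hx'
    by_contra hc
    rw [Bool.not_eq_false] at hc
    have c2 := h.hasRet_stay hx hx'
    rw [hc] at c2
    exact absurd (single 1 c2) (by decide)
  obtain ⟨c', c1', c2', c3', c4', c5'⟩ := exists_first_up h.step (show e + 1 ≤ f by omega)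
    (v := lo + 1) (by omega) (by omega)
  have we := (h.up (x := e) (by omega)).1
  have we' := (h.up (x := e) (by omega)).2
  have wc := (h.up (x := c') (by omega)).1
  have wc' := (h.up (x := c') (by omega)).2
  refine ⟨e, c', f, c1', c2', we, we', wc, wc', a2, a4, c4', a1, hle, fun x hx hx' => ?_, stay1,
    stay2, single⟩
  exact le_antisymm (c5' x hx hx') (hle x hx (hx'.trans c2'.le)).1

/-- Two adjacent gaps that together are shorter than a run of zeros. -/
theorem exists_gaps (h : LevelPath w n lo s) (hw : Good w) : ∃ i e r l,
    w i = true ∧ (∀ x, x < r → w (i + 1 + x) = false) ∧ w (i + 1 + r) = true ∧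
      (∀ x, x < l → w (i + 1 + r + 1 + x) = false) ∧ w (i + 1 + r + 1 + l) = true ∧
      ∀ x, x < r + l + 1 → w (e + x) = false := by
  obtain ⟨e, c, f, hec, hcf, we, we', wc, wc', wf, wf', sc, sf, hle, hlo, stay1, stay2, single⟩ :=
    h.exists_ascent hw
  have wlow : ∀ x, e < x → x < c → w x = false ∧ w (x + n) = false := by
    intro x hx hx'
    have h1 := hlo x hx hx'.le
    have h2 := hlo (x + 1) (by omega) hx'
    have h5 := stay1 x h1 h2
    exact ⟨h5, by rw [h.stay (by omega), h5]⟩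
  have whigh : ∀ d, d ≤ f → (∀ x, c + 1 ≤ x → x ≤ d → lo + 1 < s x) →
      ∀ x, c < x → x < d → w x = false ∧ w (x + n) = false := by
    intro d hd hb x hx hx'
    have h1 := hb x (by omega) (by omega)
    have h2 := hb (x + 1) (by omega) (by omega)
    have h3 := hle x (by omega) (by omega)
    have h4 := hle (x + 1) (by omega) (by omega)
    have h5 := stay2 x (by omega) (by omega)
    exact ⟨h5, by rw [h.stay (by omega), h5]⟩
  have zeros : ∀ d, d ≤ f → (∀ x, c + 1 ≤ x → x ≤ d → lo + 1 < s x) →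
      ∀ x, e ≤ x → x < d → w x = false := by
    intro d hd hb x hx hx'
    rcases eq_or_ne x e with rfl | h1
    · exact we
    rcases lt_trichotomy x c with h2 | rfl | h2
    · exact (wlow x (by omega) h2).1
    · exact wc
    · exact (whigh d hd hb x h2 hx').1
  have first : ∀ x, x < c - e - 1 → w (e + n + 1 + x) = false := fun x hx => by
    rw [show e + n + 1 + x = e + 1 + x + n by omega]
    exact (wlow _ (by omega) (by omega)).2
  have mid : w (e + n + 1 + (c - e - 1)) = true := by
    rw [show e + n + 1 + (c - e - 1) = c + n by omega]
    exact wc'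
  by_cases hcc : ∃ x, c + 1 ≤ x ∧ x ≤ f ∧ s x ≤ lo + 1
  · obtain ⟨x, x1, x2, x3⟩ := hcc
    obtain ⟨d, d1, d2, d3, d4, d5⟩ := exists_first_down h.step x1 (v := lo + 1)
      (by omega) (by omega)
    obtain ⟨d', g1, g2, g3, g4, g5⟩ := exists_first_up h.step (show d + 1 ≤ f by omega)
      (v := lo + 1) (by omega) (by omega)
    have hd := h.down (x := d) (by omega)
    have hd' := h.up (x := d') (by omega)
    obtain ⟨y, rfl⟩ := Nat.exists_eq_add_of_le g1
    have hz : ∀ q, q < y + 1 → w (d + 1 + q) = false := by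
      intro q hq
      rcases eq_or_ne q y with rfl | h0
      · exact hd'.1
      have k1 := g5 (d + 1 + q) (by omega) (by omega)
      have k2 := g5 (d + 1 + q + 1) (by omega) (by omega)
      have k3 := hle (d + 1 + q) (by omega) (by omega)
      have k4 := hle (d + 1 + q + 1) (by omega) (by omega)
      exact stay1 _ (by omega) (by omega)
    have hy : y + 2 = 2 := by
      refine single _ (h.hasRet (i := d) (by omega) d3 ?_ ?_ ?_)
      · rw [show d + (y + 2) = d + 1 + y + 1 by omega, g4]
      · intro x hx hx'
        have := g5 x (by omega) (by omega)
        omega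
      · rw [show d + (y + 2) = d + 1 + (y + 1) by omega, ones_eq_zeros hz le_rfl, ones_true hd.1]
    obtain rfl : y = 0 := by omega
    refine ⟨e + n, e, c - e - 1, d - c, we', first, mid, ?_, ?_, ?_⟩
    · intro x hx
      rw [show e + n + 1 + (c - e - 1) + 1 + x = c + 1 + x + n by omega]
      rcases eq_or_ne (c + 1 + x) d with h0 | h0
      · rw [h0]
        exact hd.2
      · exact (whigh d (by omega) d5 _ (by omega) (by omega)).2
    · rw [show e + n + 1 + (c - e - 1) + 1 + (d - c) = d + 1 + 0 + n by omega]
      exact hd'.2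
    · intro x hx
      exact zeros d (by omega) d5 _ (by omega) (by omega)
  · push Not at hcc
    refine ⟨e + n, e, c - e - 1, f - c - 1, we', first, mid, ?_, ?_, ?_⟩
    · intro x hx
      rw [show e + n + 1 + (c - e - 1) + 1 + x = c + 1 + x + n by omega]
      exact (whigh f le_rfl hcc _ (by omega) (by omega)).2
    · rw [show e + n + 1 + (c - e - 1) + 1 + (f - c - 1) = f + n by omega]
      exact wf'
    · intro x hx
      exact zeros f le_rfl hcc _ (by omega) (by omega)

end LevelPath

theorem exists_blocks {w : ℕ → Bool} {t : ℕ} (h0 : ∀ N, ∃ q, N ≤ q ∧ w q = false)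
    (h1 : ∀ N, ∃ q, N ≤ q ∧ w q = true) (ht : ∀ p k, IsRun w true p k → k = t) :
    ∃ B G, IsBlocks w t B G := by
  have hstep : ∀ p, w p = false → w (p + 1) = true → ∃ g, IsRun w true p t ∧
      IsRun w false (p + t) g := by
    intro p hp hp'
    obtain ⟨k, hk⟩ := exists_isRun (a := true) h0 hp hp'
    obtain rfl := ht p k hk
    obtain ⟨g, hg⟩ := exists_isRun (c := w) (a := false) (p := p + k) h1
      (by
        have h2 := hk.2.2.1 (k - 1) (by have := hk.1; omega)
        rwa [show p + 1 + (k - 1) = p + k by have := hk.1; omega] at h2)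
      (by rw [show p + k + 1 = p + 1 + k by omega]; exact hk.2.2.2)
    exact ⟨g, hk, hg⟩
  have hnext : ∀ p : {p // w p = false ∧ w (p + 1) = true},
      ∃ g, ∃ p' : {p // w p = false ∧ w (p + 1) = true}, p'.1 = p.1 + t + g ∧
        IsRun w true p.1 t ∧ IsRun w false (p.1 + t) g := by
    rintro ⟨p, hp, hp'⟩
    obtain ⟨g, h2, h3⟩ := hstep p hp hp'
    refine ⟨g, ⟨p + t + g, ?_, ?_⟩, rfl, h2, h3⟩
    · have h4 := h3.2.2.1 (g - 1) (by have := h3.1; omega)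
      rwa [show p + t + 1 + (g - 1) = p + t + g by have := h3.1; omega] at h4
    · have h4 := h3.2.2.2
      rwa [show p + t + 1 + g = p + t + g + 1 by omega] at h4
  choose gap nxt hn h2 h3 using hnext
  obtain ⟨q₀, -, hq₀⟩ := h0 0
  obtain ⟨q₁, hq₁, hq₁'⟩ := h1 q₀
  obtain ⟨p₀, -, -, hp₀, hp₀'⟩ := exists_change (a := true) hq₁ hq₀ hq₁'
  let P : ℕ → {p // w p = false ∧ w (p + 1) = true} := fun q => nxt^[q] ⟨p₀, hp₀, hp₀'⟩
  have hP : ∀ q, P (q + 1) = nxt (P q) := fun q => Function.iterate_succ_apply' nxt q _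
  refine ⟨fun q => (P q).1 + 1, fun q => gap (P q), fun q => ?_, fun q r hr => ?_,
    fun q r hr => ?_, fun q => (h3 (P q)).1⟩
  · rw [hP, hn]
    omega
  · exact (h2 (P q)).2.2.1 r hr
  · have h4 := (h3 (P q)).2.2.1 r hr
    rwa [show (P q).1 + t + 1 + r = (P q).1 + 1 + t + r by omega] at h4

namespace IsBlocks

variable {w : ℕ → Bool} {t : ℕ} {B G : ℕ → ℕ}

theorem gap_eq (h : IsBlocks w 1 B G) {q r : ℕ} (hz : ∀ x, x < r → w (B q + 1 + x) = false)
    (ho : w (B q + 1 + r) = true) : G q = r := by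
  rcases lt_trichotomy (G q) r with h1 | h1 | h1
  · have h2 := hz _ h1
    have h3 := h.one (q + 1) 0 (by omega)
    rw [h.next, add_zero, h2] at h3
    exact absurd h3 (by decide)
  · exact h1
  · have h2 := h.zero q r h1
    rw [ho] at h2
    exact absurd h2 (by decide)

theorem eq_start (h : IsBlocks w 1 B G) {x : ℕ} (hx : B 0 ≤ x) (ho : w x = true) :
    ∃ q, x = B q := by
  obtain ⟨q, h1, h2⟩ := h.locate hx
  rcases eq_or_ne x (B q) with h3 | h3
  · exact ⟨q, h3⟩
  · have h4 := h.zero q (x - B q - 1) (by rw [h.next] at h2; omega)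
    rw [show B q + 1 + (x - B q - 1) = x by omega, ho] at h4
    exact absurd h4 (by decide)

theorem one_one (h : IsBlocks w 1 B G) (hw : Good w) (x : ℕ) (hx : w x = true) :
    w (x + 1) = false := by
  obtain ⟨j, hj, hj'⟩ := hw.recur x 2 (B 0)
  have h0 := hj' 0 (by omega)
  have h1 := hj' 1 (by omega)
  rw [add_zero, add_zero, hx] at h0
  obtain ⟨q, rfl⟩ := h.eq_start hj h0
  rw [← h1]
  exact h.zero q 0 (h.pos q)

/-- An unbalanced word with isolated ones has two adjacent gaps and a third one which is longer
than these two together. -/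
theorem exists_gaps (h : IsBlocks w 1 B G) (hw : Good w) (hu : Unbal w) :
    ∃ q q', G q + G (q + 1) < G q' := by
  obtain ⟨n, lo, s, hn, hs, hb, ⟨x₀, hx₀⟩, ⟨x₁, hx₁⟩, hl, hh⟩ := hu.exists_path
  have hio : ∀ x N, ∃ j, N ≤ j ∧ s j = s x := by
    intro x N
    obtain ⟨j, hj, hj'⟩ := hw.recur x n N
    have h1 := ones_add_congr (w := w) (v := w) hj' le_rfl
    have h2 := hs x
    have h3 := hs j
    exact ⟨j, hj, by omega⟩
  have hp : LevelPath w n lo s := ⟨hn, hs, hb, hl, hh, fun N => hx₀ ▸ hio x₀ N,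
    fun N => hx₁ ▸ hio x₁ N, h.one_one hw⟩
  obtain ⟨i, e, r, l, k1, k2, k3, k4, k5, k6⟩ := hp.exists_gaps hw
  obtain ⟨j, hj, hj'⟩ := hw.recur i (r + l + 3) (B 0)
  have hw0 : w j = true := by
    have := hj' 0 (by omega)
    rwa [add_zero, add_zero, k1] at this
  obtain ⟨q, rfl⟩ := h.eq_start hj hw0
  have g1 : G q = r := by
    refine h.gap_eq (fun x hx => ?_) ?_
    · rw [add_assoc, hj' _ (by omega), ← add_assoc, k2 x hx]
    · rw [add_assoc, hj' _ (by omega), ← add_assoc, k3]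
  have hB : B (q + 1) = B q + 1 + r := by rw [h.next, g1]
  have g2 : G (q + 1) = l := by
    refine h.gap_eq (fun x hx => ?_) ?_
    · rw [hB, show B q + 1 + r + 1 + x = B q + (1 + r + 1 + x) by omega, hj' _ (by omega),
        show i + (1 + r + 1 + x) = i + 1 + r + 1 + x by omega, k4 x hx]
    · rw [hB, show B q + 1 + r + 1 + l = B q + (1 + r + 1 + l) by omega, hj' _ (by omega),
        show i + (1 + r + 1 + l) = i + 1 + r + 1 + l by omega, k5]
  obtain ⟨e', he, he'⟩ := hw.recur e (r + l + 1) (B 0)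
  have hz : ∀ x, x < r + l + 1 → w (e' + x) = false := fun x hx => by rw [he' x hx, k6 x hx]
  obtain ⟨q', h1, h2⟩ := h.locate he
  have h3 : e' + (r + l + 1) ≤ B (q' + 1) := by
    by_contra h3
    have h4 := hz (B (q' + 1) - e') (by omega)
    have h5 := h.one (q' + 1) 0 (by omega)
    rw [add_zero] at h5
    rw [show e' + (B (q' + 1) - e') = B (q' + 1) by omega, h5] at h4
    exact absurd h4 (by decide)
  have h4 : e' ≠ B q' := by
    rintro rfl
    have h5 := hz 0 (by omega)
    have h6 := h.one q' 0 (by omega)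
    rw [h5] at h6
    exact absurd h6 (by decide)
  refine ⟨q, q', ?_⟩
  have h5 := h.next q'
  rw [g1, g2]
  omega

end IsBlocks

/-- All runs of ones of an unbalanced word cannot have the same length. -/
theorem Good.false_of_runs_eq {w : ℕ → Bool} {t : ℕ} (hw : Good w) (hu : Unbal w)
    (h0 : ∀ N, ∃ q, N ≤ q ∧ w q = false) (h1 : ∀ N, ∃ q, N ≤ q ∧ w q = true)
    (ht : ∀ p k, IsRun w true p k → k = t) : False := by
  obtain ⟨B, G, h⟩ := exists_blocks h0 h1 ht
  have ht' : 1 ≤ t := by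
    obtain ⟨q₀, -, hq₀⟩ := h0 0
    obtain ⟨q₁, hq₁, hq₁'⟩ := h1 q₀
    obtain ⟨p₀, -, -, hp₀, hp₀'⟩ := exists_change (a := true) hq₁ hq₀ hq₁'
    obtain ⟨k, hk⟩ := exists_isRun (a := true) h0 hp₀ hp₀'
    exact ht _ _ hk ▸ hk.1
  refine h.false_of_good hw ht' ?_
  rintro rfl b g hbg hG - -
  obtain ⟨q, q', hq⟩ := h.exists_gaps hw hu
  have h1 := hG q
  have h2 := hG (q + 1)
  have h3 := hG q'
  exact ⟨by omega, q, by omega, by omega⟩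

theorem wordAt_add (w : ℕ → Bool) (i m n : ℕ) :
    wordAt w i (m + n) = wordAt w i m ++ wordAt w (i + m) n := by
  induction n with
  | zero => simp [wordAt]
  | succ n ih => rw [← add_assoc, wordAt_succ, ih, wordAt_succ, List.append_assoc, add_assoc]

theorem take_drop_wordAt (w : ℕ → Bool) {i j n N : ℕ} (h : j + n ≤ N) :
    ((wordAt w i N).drop j).take n = wordAt w (i + j) n := by
  obtain ⟨d, rfl⟩ := Nat.exists_eq_add_of_le h
  rw [add_assoc, wordAt_add, List.drop_left' (length_wordAt _ _ _), wordAt_add,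
    List.take_left' (length_wordAt _ _ _)]

theorem wordAt_eq_replicate {w : ℕ → Bool} {i n : ℕ} {a : Bool} (h : ∀ r, r < n → w (i + r) = a) :
    wordAt w i n = List.replicate n a := by
  rw [List.eq_replicate_iff]
  refine ⟨length_wordAt _ _ _, fun b hb => ?_⟩
  simp only [wordAt, List.mem_map, List.mem_range] at hb
  obtain ⟨r, hr, rfl⟩ := hb
  exact h r hr

/-- The number of letters `true` in the window of length `n` of `L` at position `i`. -/
def cnt (L : List Bool) (i n : ℕ) : ℕ := ((L.drop i).take n).count true

theorem ones_add_cnt (w : ℕ → Bool) {i j n N : ℕ} (h : j + n ≤ N) :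
    ones w (i + j + n) = ones w (i + j) + cnt (wordAt w i N) j n := by
  rw [cnt, take_drop_wordAt w h, ones_add]

/-- The window of length `n` at the start of `L` contains `k` ones, and its next `l - 1` shifts
do not. -/
def Leaves (n k l : ℕ) (L : List Bool) : Prop :=
  0 < l ∧ l + n ≤ L.length + 1 ∧ cnt L 0 n = k ∧ ∀ x, x < l → 0 < x → cnt L x n ≠ k

instance (n k l : ℕ) (L : List Bool) : Decidable (Leaves n k l L) := by
  unfold Leaves; infer_instance

/-- The word `L` starts with a complete first return of length `l` with `m` ones. -/
def Returns (n k l m : ℕ) (L : List Bool) : Prop :=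
  Leaves n k l L ∧ l + n ≤ L.length ∧ cnt L l n = k ∧ cnt L 0 l = m

instance (n k l m : ℕ) (L : List Bool) : Decidable (Returns n k l m L) := by
  unfold Returns; infer_instance

section Returns

variable {w : ℕ → Bool} {i n k l m : ℕ} {L : List Bool}

theorem Leaves.visit (h : Leaves n k l L) (hL : L = wordAt w i L.length) :
    ones w (i + n) = ones w i + k ∧
      ∀ x, i < x → x < i + l → ones w (x + n) ≠ ones w x + k := by
  obtain ⟨h0, h1, h2, h3⟩ := h
  constructor
  · have h4 := ones_add_cnt w (i := i) (j := 0) (n := n) (N := L.length) (by omega)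
    rwa [← hL, h2] at h4
  · intro x hx hx' hc
    obtain ⟨y, rfl⟩ := Nat.exists_eq_add_of_lt hx
    have h4 := ones_add_cnt w (i := i) (j := y + 1) (n := n) (N := L.length) (by omega)
    rw [← hL] at h4
    have h5 := h3 (y + 1) (by omega) (by omega)
    rw [show i + y + 1 = i + (y + 1) by omega] at hc
    omega

theorem Returns.ret (h : Returns n k l m L) (hL : L = wordAt w i L.length) :
    Ret w n k i (i + l) ∧ ones w (i + l) = ones w i + m := by
  obtain ⟨h1, h2, h3, h4⟩ := h
  obtain ⟨h5, h6⟩ := h1.visit hL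
  have h7 := ones_add_cnt w (i := i) (j := l) (n := n) (N := L.length) (by omega)
  have h8 := ones_add_cnt w (i := i) (j := 0) (n := l) (N := L.length) (by omega)
  rw [← hL, h3] at h7
  rw [← hL, h4] at h8
  exact ⟨⟨by have := h1.1; omega, h5, h7, h6⟩, h8⟩

theorem Returns.hasRet (h : Returns n k l m L) (hL : IsFactorW w L) : HasRet w n k l m := by
  obtain ⟨i, hi⟩ := hL
  exact ⟨i, h.ret hi⟩

theorem Leaves.hasRet (h : Leaves n k l L) (hw : Good w) (hL : IsFactorW w L) :
    ∃ l' m, l ≤ l' ∧ HasRet w n k l' m := by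
  classical
  obtain ⟨i, hi⟩ := hL
  obtain ⟨h1, h2⟩ := h.visit hi
  have hex : ∃ l', 0 < l' ∧ ones w (i + l' + n) = ones w (i + l') + k := by
    obtain ⟨j, hj, hj'⟩ := hw.recur i n (i + 1)
    have h3 := ones_add_congr hj' le_rfl
    refine ⟨j - i, by omega, ?_⟩
    rw [Nat.add_sub_cancel' (by omega)]
    omega
  obtain ⟨h3, h4⟩ := Nat.find_spec hex
  refine ⟨Nat.find hex, ones w (i + Nat.find hex) - ones w i, ?_, i, ⟨by omega, h1, h4, ?_⟩, ?_⟩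
  · by_contra h5
    exact h2 (i + Nat.find hex) (by omega) (by omega) h4
  · intro x hx hx' hx''
    refine Nat.find_min hex (m := x - i) (by omega) ⟨by omega, ?_⟩
    rwa [Nat.add_sub_cancel' hx.le]
  · have := (ones_mono w (show i ≤ i + Nat.find hex by omega)).1
    omega

end Returns

/-- The image of `s` under the substitution `0 ↦ 0^p`, `1 ↦ 1^q`. -/
def stretch (p q : ℕ) (s : List Bool) : List Bool := s.flatMap fun a => List.replicate (cond a q p)
    a

/-- The tail of `w` from `c 0` on is the image of `v` under `0 ↦ 0^p`, `1 ↦ 1^q`. -/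
structure IsCoded (w v : ℕ → Bool) (p q : ℕ) (c : ℕ → ℕ) : Prop where
  zero : p = 1 ∨ p = 2
  one : q = 1 ∨ q = 2
  next : ∀ i, c (i + 1) = c i + cond (v i) q p
  letter : ∀ i r, r < cond (v i) q p → w (c i + r) = v i
  recur : ∀ i n N, ∃ j, N ≤ j ∧ ∀ r, r < n → v (j + r) = v (i + r)
  cube : ∀ a, ¬IsFactorW v [a, a, a]
  single : ∀ a, IsFactorW v [!a, a, !a]
  double : ∀ a, IsFactorW v [!a, a, a, !a]

theorem isFactorW_iff {v : ℕ → Bool} {s : List Bool} :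
    IsFactorW v s ↔ ∃ i n, s = wordAt v i n :=
  ⟨fun ⟨i, h⟩ => ⟨i, _, h⟩, fun ⟨i, n, h⟩ => ⟨i, by rw [h, length_wordAt]⟩⟩

theorem isFactorW_of_infix {v : ℕ → Bool} {s t : List Bool} (h : s <:+: t) (ht : IsFactorW v t) :
    IsFactorW v s := by
  obtain ⟨a, b, rfl⟩ := h
  obtain ⟨i, hi⟩ := ht
  rw [List.length_append, List.length_append, wordAt_add, wordAt_add] at hi
  have h1 := List.append_inj hi (by simp [length_wordAt])
  have h2 := List.append_inj h1.1 (by simp [length_wordAt])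
  exact ⟨_, h2.2⟩

theorem isFactorW_compl {v : ℕ → Bool} {s : List Bool} :
    IsFactorW (fun x => !v x) s ↔ IsFactorW v (s.map not) := by
  have h : ∀ i n, wordAt (fun x => !v x) i n = (wordAt v i n).map not := fun i n => by
    simp [wordAt]
  have h2 : ∀ u : List Bool, (u.map not).map not = u := fun u => by
    rw [List.map_map, show not ∘ not = id by funext a; simp, List.map_id]
  constructor
  · rintro ⟨i, hi⟩
    refine ⟨i, ?_⟩
    rw [List.length_map, ← h2 (wordAt v i _), ← h, ← hi]
  · rintro ⟨i, hi⟩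
    refine ⟨i, ?_⟩
    rw [List.length_map] at hi
    rw [h, ← hi, h2]

namespace IsCoded

variable {w v : ℕ → Bool} {p q : ℕ} {c : ℕ → ℕ}

theorem compl (h : IsCoded w v p q c) : IsCoded (fun x => !w x) (fun x => !v x) q p c where
  zero := h.one
  one := h.zero
  next i := by rw [h.next]; cases v i <;> rfl
  letter i r hr := by rw [h.letter i r (by cases hv : v i <;> simpa [hv] using hr)]
  recur i n N := by
    obtain ⟨j, hj, hj'⟩ := h.recur i n N
    exact ⟨j, hj, fun r hr => by rw [hj' r hr]⟩
  cube a := by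
    rw [isFactorW_compl]
    exact h.cube (!a)
  single a := by
    rw [isFactorW_compl]
    exact h.single (!a)
  double a := by
    rw [isFactorW_compl]
    exact h.double (!a)

theorem wordAt_stretch (h : IsCoded w v p q c) (i n : ℕ) :
    c (i + n) = c i + (stretch p q (wordAt v i n)).length ∧
      wordAt w (c i) (stretch p q (wordAt v i n)).length = stretch p q (wordAt v i n) := by
  induction n with
  | zero => simp [wordAt, stretch]
  | succ n ih =>
    have h1 : stretch p q (wordAt v i (n + 1)) =
        stretch p q (wordAt v i n) ++ List.replicate (cond (v (i + n)) q p) (v (i + n)) := by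
      rw [wordAt_succ, stretch, List.flatMap_append]
      simp [stretch]
    have h2 := wordAt_eq_replicate (h.letter (i + n))
    rw [ih.1] at h2
    rw [h1, List.length_append, List.length_replicate, wordAt_add, ih.2, h2, ← add_assoc, h.next,
      ih.1]
    exact ⟨by omega, rfl⟩

theorem isFactorW_stretch (h : IsCoded w v p q c) {s : List Bool} (hs : IsFactorW v s) :
    IsFactorW w (stretch p q s) := by
  obtain ⟨i, hi⟩ := hs
  refine ⟨c i, ?_⟩
  rw [hi, (h.wordAt_stretch i _).2]

end IsCoded

local notation "⓪" => false
local notation "①" => true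

/-- All binary words of length `n`. -/
def binaryWords : ℕ → List (List Bool)
  | 0 => [[]]
  | n + 1 => (binaryWords n).flatMap fun u => [false :: u, true :: u]

theorem mem_binaryWords (u : List Bool) : u ∈ binaryWords u.length := by
  induction u with
  | nil => simp [binaryWords]
  | cons a u ih =>
    rw [List.length_cons, binaryWords, List.mem_flatMap]
    exact ⟨u, ih, by cases a <;> simp⟩

namespace IsCoded

variable {w v : ℕ → Bool} {p q : ℕ} {c : ℕ → ℕ}

theorem exists_ge (h : IsCoded w v p q c) {s : List Bool} (hs : IsFactorW v s) (N : ℕ) :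
    ∃ i, N ≤ i ∧ s = wordAt v i s.length := by
  obtain ⟨i, hi⟩ := hs
  obtain ⟨j, hj, hj'⟩ := h.recur i s.length N
  exact ⟨j, hj, hi.trans ((wordAt_eq_iff v i j s.length).2 fun r hr => (hj' r hr).symm)⟩

/-- If `s` is a factor, then so is one of its extensions, by `a` letters on the left and `b` letters
on the right, that avoid the non-factors `F`. -/
theorem extend (h : IsCoded w v p q c) {s : List Bool} (hs : IsFactorW v s) (a b : ℕ)
    (F T : List (List Bool)) (hF : F.Forall fun u => ¬IsFactorW v u)
    (hT : ∀ x ∈ binaryWords a, ∀ y ∈ binaryWords b,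
      (∃ u ∈ F, u <:+: x ++ s ++ y) ∨ ∃ t ∈ T, t <:+: x ++ s ++ y) :
    ∃ t ∈ T, IsFactorW v t := by
  obtain ⟨i, hi, hs'⟩ := h.exists_ge hs a
  obtain ⟨i, rfl⟩ := Nat.exists_eq_add_of_le' hi
  have h1 : IsFactorW v (wordAt v i a ++ s ++ wordAt v (i + a + s.length) b) := by
    rw [hs', length_wordAt, ← wordAt_add, add_assoc, ← wordAt_add, isFactorW_iff]
    exact ⟨i, _, rfl⟩
  have hx := mem_binaryWords (wordAt v i a)
  have hy := mem_binaryWords (wordAt v (i + a + s.length) b)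
  rw [length_wordAt] at hx hy
  rcases hT _ hx _ hy with ⟨u, hu, hu'⟩ | ⟨t, ht, ht'⟩
  · exact absurd (isFactorW_of_infix hu' h1) (List.forall_iff_forall_mem.1 hF u hu)
  · exact ⟨t, ht, isFactorW_of_infix ht' h1⟩

/-- If the windows of length `k` in `S` are closed under succession, up to the non-factors `F`, and
one of them occurs, then no others occur. -/
theorem not_isFactorW_of_closed (h : IsCoded w v p q c) {t s : List Bool} (ht : IsFactorW v t)
    (k : ℕ) (S F : List (List Bool)) (hF : F.Forall fun u => ¬IsFactorW v u) (htS : t ∈ S)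
    (hk : ∀ u ∈ S, u.length = k)
    (hS : ∀ u ∈ S, ∀ b, (∃ x ∈ F, x <:+: u ++ [b]) ∨ (u ++ [b]).tail ∈ S)
    (hs : s.length ≤ k ∧ ∀ u ∈ S, ¬s <+: u) : ¬IsFactorW v s := by
  obtain ⟨i, hi⟩ := ht
  rw [hk t htS] at hi
  have h1 : ∀ m, wordAt v (i + m) k ∈ S := by
    intro m
    induction m with
    | zero => rwa [add_zero, ← hi]
    | succ m ih =>
      have h2 := hS _ ih (v (i + m + k))
      rw [← wordAt_succ] at h2
      rcases h2 with ⟨x, hx, hx'⟩ | h2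
      · exact absurd (isFactorW_of_infix hx' (isFactorW_iff.2 ⟨_, _, rfl⟩))
          (List.forall_iff_forall_mem.1 hF x hx)
      · rwa [add_comm k 1, wordAt_add, show wordAt v (i + m) 1 = [v (i + m)] by simp [wordAt],
          List.singleton_append, List.tail_cons] at h2
  intro hs'
  obtain ⟨j, hj, hj'⟩ := h.exists_ge hs' i
  obtain ⟨m, rfl⟩ := Nat.exists_eq_add_of_le hj
  refine hs.2 _ (h1 m) ?_
  obtain ⟨d, rfl⟩ := Nat.exists_eq_add_of_le hs.1
  rw [wordAt_add, ← hj']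
  exact List.prefix_append _ _

theorem hasRet_of_mem (h : IsCoded w v p q c) {T : List (List Bool)} (hT : ∃ t ∈ T, IsFactorW v t)
    {n k l m : ℕ} (hr : ∀ t ∈ T, Returns n k l m (stretch p q t)) : HasRet w n k l m := by
  obtain ⟨t, ht, ht'⟩ := hT
  exact (hr t ht).hasRet (h.isFactorW_stretch ht')

theorem hasRet (h : IsCoded w v p q c) {s : List Bool} (hs : IsFactorW v s) {n k l m : ℕ}
    (hr : Returns n k l m (stretch p q s)) : HasRet w n k l m :=
  hr.hasRet (h.isFactorW_stretch hs)

theorem hasRet_long (h : IsCoded w v p q c) (hw : Good w) {T : List (List Bool)}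
    (hT : ∃ t ∈ T, IsFactorW v t) {n k l : ℕ} (hr : ∀ t ∈ T, Leaves n k l (stretch p q t)) :
    ∃ l' m, l ≤ l' ∧ HasRet w n k l' m := by
  obtain ⟨t, ht, ht'⟩ := hT
  exact (hr t ht).hasRet hw (h.isFactorW_stretch ht')

theorem isolated (h : IsCoded w v p q c) (hw : Good w) :
    IsFactorW v [⓪, ⓪, ①, ⓪] ∨ IsFactorW v [⓪, ①, ⓪, ⓪] := by
  by_contra! hcon
  have h0 := h.cube false
  have h1 := h.cube true
  have s1 : IsFactorW v [①, ⓪, ①, ⓪, ①] := by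
    simpa using h.extend (h.single true) 1 1 [[⓪, ⓪, ①, ⓪], [⓪, ①, ⓪, ⓪]] [[①, ⓪, ①, ⓪, ①]] hcon (by
        decide)
  have s2 : IsFactorW v [①, ①, ⓪, ⓪, ①, ①] := by
    simpa using h.extend (h.double false) 1 1 [[⓪, ⓪, ⓪], [⓪, ⓪, ①, ⓪],
        [⓪, ①, ⓪, ⓪]] [[①, ①, ⓪, ⓪, ①, ①]]
      ⟨h0, hcon⟩ (by decide)
  have s3 : IsFactorW v [①, ①, ⓪, ①] ∨ IsFactorW v [①, ⓪, ①, ①] := by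
    by_contra! hcon'
    exact h.not_isFactorW_of_closed (h.double false) 4 [[①, ①, ⓪, ⓪], [①, ⓪, ⓪, ①], [⓪, ⓪, ①, ①],
        [⓪, ①, ①, ⓪]]
      [[⓪, ⓪, ⓪], [①, ①, ①], [⓪, ⓪, ①, ⓪], [⓪, ①, ⓪, ⓪], [①, ①, ⓪, ①], [①, ⓪, ①, ①]]
          ⟨h0, h1, hcon.1, hcon.2, hcon'.1, hcon'.2⟩
      (by decide) (by decide) (by decide) (by decide) (h.single true)
  have r1 : HasRet w (p + 2 * q) (2 * q) 1 0 := h.hasRet (h.double true)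
    (by obtain rfl | rfl := h.zero <;> obtain rfl | rfl := h.one <;> decide)
  have r2 : HasRet w (p + 2 * q) (2 * q) 1 1 := by
    rcases s3 with s3 | s3 <;> refine h.hasRet s3 ?_ <;>
      obtain rfl | rfl := h.zero <;> obtain rfl | rfl := h.one <;> decide
  have r3 : HasRet w (p + 2 * q) (2 * q) (p + 2 * q) (2 * q) := h.hasRet s2
    (by obtain rfl | rfl := h.zero <;> obtain rfl | rfl := h.one <;> decide)
  have r4 : HasRet w (p + 2 * q) (2 * q) (p + q) q := h.hasRet s1
    (by obtain rfl | rfl := h.zero <;> obtain rfl | rfl := h.one <;> decide)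
  obtain h2 | h2 := h.zero <;> obtain h3 | h3 := h.one <;>
    exact hw.four (by omega) r1 r2 r3 r4 (by omega) (by omega) (by omega) (by omega) (by omega)
      (by omega)

theorem isolated' (h : IsCoded w v p q c) (hw : Good w) :
    IsFactorW v [①, ①, ⓪, ①] ∨ IsFactorW v [①, ⓪, ①, ①] := by
  have := h.compl.isolated hw.compl
  rwa [isFactorW_compl, isFactorW_compl] at this

theorem hasRet_zero (h : IsCoded w v p q c) (hw : Good w) : HasRet w (2 * p + q) q 1 0 := by
  rcases h.isolated hw with hs | hs <;> refine h.hasRet hs ?_ <;>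
    obtain rfl | rfl := h.zero <;> obtain rfl | rfl := h.one <;> decide

theorem hasRet_one (h : IsCoded w v p q c) : HasRet w (2 * p + q) q 1 1 := h.hasRet (h.double false)
  (by obtain rfl | rfl := h.zero <;> obtain rfl | rfl := h.one <;> decide)

theorem not_isFactorW_01010 (h : IsCoded w v p q c) (hw : Good w) : ¬IsFactorW v [⓪, ①, ⓪, ①, ⓪] :=
    by
  intro hs
  have h0 := h.cube false
  have h1 := h.cube true
  have s1 : IsFactorW v [⓪, ⓪, ①, ①] ∨ IsFactorW v [⓪, ①, ⓪, ①, ①] := by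
    by_contra! hcon
    exact h.not_isFactorW_of_closed (h.double false) 4
      [[①, ⓪, ⓪, ①], [⓪, ⓪, ①, ⓪], [⓪, ①, ⓪, ⓪], [⓪, ①, ⓪, ①], [①, ⓪, ①, ⓪]] [[⓪, ⓪, ⓪],
          [⓪, ⓪, ①, ①], [⓪, ①, ⓪, ①, ①]]
      ⟨h0, hcon⟩ (by decide) (by decide) (by decide) (by decide) (h.double true)
  have s2 : ∃ t ∈ [[⓪, ⓪, ①, ①, ⓪], [⓪, ①, ⓪, ①, ①, ⓪]], IsFactorW v t := by
    rcases s1 with s1 | s1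
    · exact h.extend s1 0 1 [[①, ①, ①]] _ h1 (by decide)
    · exact h.extend s1 0 1 [[①, ①, ①]] _ h1 (by decide)
  have r3 : HasRet w (2 * p + q) q (p + q) q := h.hasRet hs
    (by obtain rfl | rfl := h.zero <;> obtain rfl | rfl := h.one <;> decide)
  obtain ⟨l, m, hl, r4⟩ : ∃ l m, p + q + 1 ≤ l ∧ HasRet w (2 * p + q) q l m := h.hasRet_long hw s2
    (by obtain rfl | rfl := h.zero <;> obtain rfl | rfl := h.one <;> decide)
  obtain h2 | h2 := h.zero <;> obtain h3 | h3 := h.one <;>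
    exact hw.four (by omega) (h.hasRet_zero hw) h.hasRet_one r3 r4 (by omega) (by omega) (by omega)
      (by omega) (by omega) (by omega)

theorem not_isFactorW_10101 (h : IsCoded w v p q c) (hw : Good w) : ¬IsFactorW v [①, ⓪, ①, ⓪, ①] :=
    by
  have := h.compl.not_isFactorW_01010 hw.compl
  rwa [isFactorW_compl] at this

theorem not_isFactorW_11011_of (h : IsCoded w v p q c) (hw : Good w)
    (hs : IsFactorW v [①, ①, ⓪, ①, ①]) (hs' : IsFactorW v [①, ①, ⓪, ⓪] ∨ IsFactorW v [⓪, ⓪, ①, ①]) :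
        False := by
  have h0 := h.cube false
  have h1 := h.cube true
  have s1 : IsFactorW v [⓪, ①, ①, ⓪, ①, ①, ⓪] := by
    simpa using h.extend hs 1 1 [[①, ①, ①]] [[⓪, ①, ①, ⓪, ①, ①, ⓪]] h1 (by decide)
  have ext : ∀ T : List (List Bool), (∀ x ∈ binaryWords 1, ∀ y ∈ binaryWords 1,
      ((∃ u ∈ [[⓪, ⓪, ⓪], [①, ①, ①]], u <:+: x ++ [①, ①, ⓪, ⓪] ++ y) ∨ ∃ t ∈ T, t <:+: x ++ [①, ①,
          ⓪, ⓪] ++ y) ∧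
      ((∃ u ∈ [[⓪, ⓪, ⓪], [①, ①, ①]], u <:+: x ++ [⓪, ⓪, ①, ①] ++ y) ∨ ∃ t ∈ T, t <:+: x ++ [⓪, ⓪,
          ①, ①] ++ y)) →
      ∃ t ∈ T, IsFactorW v t := by
    intro T hT
    rcases hs' with hs' | hs'
    · exact h.extend hs' 1 1 [[⓪, ⓪, ⓪], [①, ①, ①]] _ ⟨h0, h1⟩ fun x hx y hy => (hT x hx y hy).1
    · exact h.extend hs' 1 1 [[⓪, ⓪, ⓪], [①, ①, ①]] _ ⟨h0, h1⟩ fun x hx y hy => (hT x hx y hy).2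
  have s3 : IsFactorW v [①, ⓪, ⓪, ①, ⓪, ⓪, ①] ∨ ∃ t ∈ [[①, ⓪, ⓪, ①, ⓪, ①],
      [①, ⓪, ①, ⓪, ⓪, ①]], IsFactorW v t := by
    have : ∃ t ∈ [[①, ⓪, ⓪, ①, ⓪, ⓪, ①], [①, ⓪, ⓪, ①, ⓪, ①], [①, ⓪, ①, ⓪, ⓪, ①]], IsFactorW v t :=
        by
      rcases h.isolated hw with s | s
      · exact h.extend s 1 2 [[⓪, ⓪, ⓪]] _ h0 (by decide)
      · exact h.extend s 2 1 [[⓪, ⓪, ⓪]] _ h0 (by decide)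
    simpa using this
  have r1 : HasRet w (2 * p + 2 * q) (2 * q) (p + 2 * q) (2 * q) := h.hasRet s1
    (by obtain rfl | rfl := h.zero <;> obtain rfl | rfl := h.one <;> decide)
  have r2 : HasRet w (2 * p + 2 * q) (2 * q) 1 0 := h.hasRet_of_mem
    (ext [[⓪, ①, ①, ⓪, ⓪], [⓪, ⓪, ①, ①, ⓪]] (by decide))
    (by obtain rfl | rfl := h.zero <;> obtain rfl | rfl := h.one <;> decide)
  have r3 : HasRet w (2 * p + 2 * q) (2 * q) 1 1 := h.hasRet_of_mem
    (ext [[①, ①, ⓪, ⓪, ①], [①, ⓪, ⓪, ①, ①]] (by decide))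
    (by obtain rfl | rfl := h.zero <;> obtain rfl | rfl := h.one <;> decide)
  obtain ⟨m, hm, r4⟩ : ∃ m, (m = 2 * p + q ∨ m = p + q) ∧
      HasRet w (2 * p + 2 * q) (2 * q) m q := by
    rcases s3 with s3 | s3
    · refine ⟨_, Or.inl rfl, h.hasRet s3 ?_⟩
      obtain rfl | rfl := h.zero <;> obtain rfl | rfl := h.one <;> decide
    · refine ⟨_, Or.inr rfl, h.hasRet_of_mem s3 ?_⟩
      obtain rfl | rfl := h.zero <;> obtain rfl | rfl := h.one <;> decide
  obtain h2 | h2 := h.zero <;> obtain h3 | h3 := h.one <;>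
    exact hw.four (by omega) r1 r2 r3 r4 (by omega) (by omega) (by omega)
      (by omega) (by omega) (by omega)

theorem not_isFactorW_11011 (h : IsCoded w v p q c) (hw : Good w) : ¬IsFactorW v [①, ①, ⓪, ①, ①] :=
    by
  intro hs
  have h0 := h.cube false
  have h1 := h.cube true
  have h2 := h.not_isFactorW_10101 hw
  have h3 : ¬IsFactorW v [①, ①, ⓪, ⓪] := fun hs' => h.not_isFactorW_11011_of hw hs (Or.inl hs')
  have s1 : IsFactorW v [⓪, ①, ①, ⓪, ①, ①, ⓪] := by
    simpa using h.extend hs 1 1 [[①, ①, ①]] [[⓪, ①, ①, ⓪, ①, ①, ⓪]] h1 (by decide)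
  have s2 : IsFactorW v [①, ⓪, ①, ①, ⓪, ①] := by
    simpa using h.extend s1 0 2 [[①, ①, ①], [①, ①, ⓪, ⓪]] [[①, ⓪, ①, ①, ⓪, ①]] ⟨h1, h3⟩ (by decide)
  have s3 : IsFactorW v [①, ①, ⓪, ①, ⓪, ⓪] := by
    by_contra hcon
    exact h.not_isFactorW_of_closed (isFactorW_of_infix (s := [①, ①, ⓪, ①, ①, ⓪]) (by decide) s1) 6
      [[①, ①, ⓪, ①, ①, ⓪], [①, ⓪, ①, ①, ⓪, ①], [⓪, ①, ①, ⓪, ①, ①], [⓪, ①, ①, ⓪, ①, ⓪]] [[①, ①, ①],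
          [①, ①, ⓪, ⓪], [①, ①, ⓪, ①, ⓪, ⓪], [①, ⓪, ①, ⓪, ①]]
      ⟨h1, h3, hcon, h2⟩ (by decide) (by decide) (by decide) (by decide) (h.double false)
  have s4 : IsFactorW v [①, ①, ⓪, ①, ⓪, ⓪, ①] := by
    simpa using h.extend s3 0 1 [[⓪, ⓪, ⓪]] [[①, ①, ⓪, ①, ⓪, ⓪, ①]] h0 (by decide)
  have s5 : IsFactorW v [⓪, ①, ①, ⓪, ①, ⓪] := by
    simpa using h.extend s3 1 0 [[①, ①, ①]] [[⓪, ①, ①, ⓪, ①, ⓪]] h1 (by decide)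
  have r1 : HasRet w (2 * p + 3 * q) (3 * q) 1 1 := h.hasRet s2
    (by obtain rfl | rfl := h.zero <;> obtain rfl | rfl := h.one <;> decide)
  have r2 : HasRet w (2 * p + 3 * q) (3 * q) (p + q) q := h.hasRet s1
    (by obtain rfl | rfl := h.zero <;> obtain rfl | rfl := h.one <;> decide)
  have r3 : HasRet w (2 * p + 3 * q) (3 * q) 1 0 := h.hasRet s5
    (by obtain rfl | rfl := h.zero <;> obtain rfl | rfl := h.one <;> decide)
  obtain ⟨l, m, hl, r4⟩ : ∃ l m, p + q + 1 ≤ l ∧ HasRet w (2 * p + 3 * q) (3 * q) l m :=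
    h.hasRet_long hw (T := [[①, ①, ⓪, ①, ⓪, ⓪, ①]]) (by simpa using s4)
      (by obtain rfl | rfl := h.zero <;> obtain rfl | rfl := h.one <;> decide)
  obtain h4 | h4 := h.zero <;> obtain h5 | h5 := h.one <;>
    exact hw.four (by omega) r1 r2 r3 r4 (by omega) (by omega) (by omega)
      (by omega) (by omega) (by omega)

theorem not_isFactorW_00100 (h : IsCoded w v p q c) (hw : Good w) : ¬IsFactorW v [⓪, ⓪, ①, ⓪, ⓪] :=
    by
  have := h.compl.not_isFactorW_11011 hw.compl
  rwa [isFactorW_compl] at this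

end IsCoded

theorem Ret.unique {w : ℕ → Bool} {n k i j j' : ℕ} (h : Ret w n k i j) (h' : Ret w n k i j') :
    j = j' := by
  obtain ⟨h1, -, h2, h3⟩ := h
  obtain ⟨h1', -, h2', h3'⟩ := h'
  by_contra hne
  rcases lt_or_gt_of_ne hne with h4 | h4
  · exact h3' _ h1 h4 h2
  · exact h3 _ h1' h4 h2'

namespace IsCoded

variable {w v : ℕ → Bool} {p q : ℕ} {c : ℕ → ℕ}

theorem forced {s : List Bool} {i : ℕ} (hi : s = wordAt v i s.length) (b : ℕ) {X : List Bool}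
    (F : List (List Bool)) (hF : F.Forall fun u => ¬IsFactorW v u)
    (hX : ∀ y ∈ binaryWords b, (∃ u ∈ F, u <:+: s ++ y) ∨ s ++ y = X) :
    X = wordAt v i X.length := by
  have hy := mem_binaryWords (wordAt v (i + s.length) b)
  have h1 : s ++ wordAt v (i + s.length) b = wordAt v i (s.length + b) := by
    rw [wordAt_add, ← hi]
  rw [length_wordAt] at hy
  rcases hX _ hy with ⟨u, hu, hu'⟩ | h2
  · rw [h1] at hu'
    exact absurd (isFactorW_of_infix hu' (isFactorW_iff.2 ⟨_, _, rfl⟩))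
      (List.forall_iff_forall_mem.1 hF u hu)
  · rw [← h2, h1, length_wordAt]

theorem exists_zero_zero (h : IsCoded w v p q c) {i : ℕ} (hi : c 0 ≤ i)
    (hz : ∀ r, r < 2 * p → w (i + r) = false) : ∃ m, i = c m ∧ [⓪, ⓪] = wordAt v m 2 := by
  have hp := h.zero
  have hq := h.one
  have hlen : ∀ m, 1 ≤ cond (v m) q p := fun m => by cases v m <;> simp <;> omega
  have hv : ∀ m r, c m = i + r → r < 2 * p → v m = false := fun m r h1 h2 => by
    rw [← h.letter m 0 (hlen m), add_zero, h1, hz r h2]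
  obtain ⟨m, h1, h2⟩ : ∃ m, c m ≤ i ∧ i < c (m + 1) := by
    classical
    have hex : ∃ m, i < c (m + 1) := by
      have hge : ∀ m, m ≤ c m := fun m => by
        induction m with
        | zero => omega
        | succ m ih => have := h.next m; have := hlen m; omega
      exact ⟨i, hge (i + 1)⟩
    refine ⟨Nat.find hex, ?_, Nat.find_spec hex⟩
    rcases h0 : Nat.find hex with _ | m
    · exact hi
    · have := Nat.find_min hex (m := m) (by omega)
      omega
  have h3 := h.next m
  have h4 := h.letter m (i - c m) (by omega)
  have h5 := hz 0 (by omega)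
  rw [Nat.add_sub_cancel' h1] at h4
  rw [add_zero, h4] at h5
  rw [h5, cond_false] at h3
  have h6 := hv (m + 1) (c (m + 1) - i) (by omega) (by omega)
  have h7 : c (m + 2) = c (m + 1) + cond (v (m + 1)) q p := h.next (m + 1)
  rw [h6, cond_false] at h7
  rcases h1.eq_or_lt with h8 | h8
  · exact ⟨m, h8.symm, by simp [wordAt, h5, h6, List.range_succ]⟩
  · have h9 := hv (m + 2) (c (m + 2) - i) (by omega) (by omega)
    exact absurd ⟨m, by simp [wordAt, h5, h6, h9, List.range_succ]⟩ (h.cube false)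

theorem false_of_forced (h : IsCoded w v p q c) (hw : Good w) (X : List Bool)
    (hX : ∀ i, [⓪, ⓪] = wordAt v i 2 → X = wordAt v i X.length) {l m : ℕ}
    (hr : Returns (2 * p) 0 l m (stretch p q X)) : False := by
  have hp := h.zero
  have hvis : ∀ i, c 0 ≤ i → ones w (i + 2 * p) = ones w i + 0 →
      wordAt w i (stretch p q X).length = stretch p q X := by
    intro i hi hv
    obtain ⟨m, rfl, hm⟩ := h.exists_zero_zero hi fun r hr => by
      by_contra hc
      rw [Bool.not_eq_false] at hc
      have h1 := ones_true hc
      have h2 := ones_mono w (show i ≤ i + r by omega)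
      have h3 := ones_mono w (show i + r + 1 ≤ i + 2 * p by omega)
      omega
    have h1 := (h.wordAt_stretch m X.length).2
    rwa [← hX m hm] at h1
  obtain ⟨i, hi⟩ := isFactorW_of_infix (s := [⓪, ⓪]) (by decide) (h.double false)
  have h1 := (h.wordAt_stretch i 2).2
  rw [← show [⓪, ⓪] = wordAt v i 2 from hi] at h1
  have h2 := ones_add w (c i) (2 * p)
  have h3 : wordAt w (c i) (2 * p) = List.replicate (2 * p) false := by
    obtain rfl | rfl := hp <;> exact h1
  rw [h3, List.count_replicate] at h2
  obtain ⟨i₁, l₁, i₂, l₂, hi₁, hi₂, r₁, r₂, hne⟩ := hw.two (n := 2 * p) (by omega) h2 (c 0)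
  have e₁ := hvis i₁ hi₁ r₁.2.1
  have e₂ := hvis i₂ hi₂ r₂.2.1
  have u₁ := r₁.unique (hr.ret e₁.symm).1
  have u₂ := r₂.unique (hr.ret e₂.symm).1
  have hl := hr.2.1
  refine hne ⟨by omega, fun r hr => (wordAt_eq_iff w i₁ i₂ _).1 (e₁.trans e₂.symm) r (by omega)⟩

theorem excursion_unique (h : IsCoded w v p q c) (hw : Good w) :
    ¬(IsFactorW v [⓪, ⓪, ①, ①, ⓪, ⓪] ∧ ∃ t ∈ [[⓪, ⓪, ①, ①, ⓪, ①, ⓪],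
        [⓪, ①, ⓪, ①, ①, ⓪, ⓪]], IsFactorW v t) ∧
    ¬(IsFactorW v [⓪, ⓪, ①, ①, ⓪, ⓪] ∧ IsFactorW v [⓪, ①, ⓪, ①, ①, ⓪, ①, ⓪]) ∧
    ¬((∃ t ∈ [[⓪, ⓪, ①, ①, ⓪, ①, ⓪], [⓪, ①, ⓪, ①, ①, ⓪, ⓪]], IsFactorW v t) ∧ IsFactorW v [⓪, ①, ⓪,
        ①, ①, ⓪, ①, ⓪]) := by
  have ra : IsFactorW v [⓪, ⓪, ①, ①, ⓪, ⓪] → HasRet w (2 * p + q) q (2 * p + q) q := fun hs =>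
      h.hasRet hs
    (by obtain rfl | rfl := h.zero <;> obtain rfl | rfl := h.one <;> decide)
  have rb : (∃ t ∈ [[⓪, ⓪, ①, ①, ⓪, ①, ⓪], [⓪, ①, ⓪, ①, ①, ⓪, ⓪]], IsFactorW v t) →
      HasRet w (2 * p + q) q (2 * p + 2 * q) (2 * q) := fun hs => h.hasRet_of_mem hs
    (by obtain rfl | rfl := h.zero <;> obtain rfl | rfl := h.one <;> decide)
  have rc : IsFactorW v [⓪, ①, ⓪, ①, ①, ⓪, ①, ⓪] → HasRet w (2 * p + q) q (2 * p + 3 * q) (3 * q) :=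
      fun hs =>
    h.hasRet hs (by obtain rfl | rfl := h.zero <;> obtain rfl | rfl := h.one <;> decide)
  have r0 := h.hasRet_zero hw
  have r1 := h.hasRet_one
  have hp : 1 ≤ p := by have := h.zero; omega
  have hq : 1 ≤ q := by have := h.one; omega
  refine ⟨fun hs => ?_, fun hs => ?_, fun hs => ?_⟩
  · exact hw.four (by omega) r0 r1 (ra hs.1) (rb hs.2) (by omega) (by omega) (by omega)
      (by omega) (by omega) (by omega)
  · exact hw.four (by omega) r0 r1 (ra hs.1) (rc hs.2) (by omega) (by omega) (by omega)
      (by omega) (by omega) (by omega)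
  · exact hw.four (by omega) r0 r1 (rb hs.1) (rc hs.2) (by omega) (by omega) (by omega)
      (by omega) (by omega) (by omega)

theorem excursion_cases (h : IsCoded w v p q c) (hw : Good w) :
    (∃ t ∈ [[⓪, ⓪, ①, ①, ⓪, ①, ⓪], [⓪, ①, ⓪, ①, ①, ⓪, ⓪]], IsFactorW v t) ∨ IsFactorW v [⓪, ①, ⓪, ①,
        ①, ⓪, ①, ⓪] := by
  have h1 := h.cube true
  have h3 := h.not_isFactorW_10101 hw
  have h4 := h.not_isFactorW_11011 hw
  have : ∃ t ∈ [[⓪, ⓪, ①, ①, ⓪, ①, ⓪], [⓪, ①, ⓪, ①, ①, ⓪, ⓪],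
      [⓪, ①, ⓪, ①, ①, ⓪, ①, ⓪]], IsFactorW v t := by
    rcases h.isolated' hw with s | s
    · exact h.extend s 3 2 [[①, ①, ①], [①, ⓪, ①, ⓪, ①], [①, ①, ⓪, ①, ①]] _ ⟨h1, h3, h4⟩ (by decide)
    · exact h.extend s 2 3 [[①, ①, ①], [①, ⓪, ①, ⓪, ①], [①, ①, ⓪, ①, ①]] _ ⟨h1, h3, h4⟩ (by decide)
  simp only [List.mem_cons, List.not_mem_nil, or_false, exists_eq_or_imp, exists_eq_left] at this ⊢
  tauto

theorem not_isFactorW_001100 (h : IsCoded w v p q c) (hw : Good w) : ¬IsFactorW v [⓪, ⓪, ①, ①, ⓪, ⓪]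
    := by
  have h1 := h.excursion_unique hw
  exact fun hs => (h.excursion_cases hw).elim (fun h2 => h1.1 ⟨hs, h2⟩) fun h2 => h1.2.1 ⟨hs, h2⟩

theorem not_isFactorW_of_01011010 (h : IsCoded w v p q c) (hw : Good w)
    (hs : IsFactorW v [⓪, ①, ⓪, ①, ①, ⓪, ①, ⓪]) : ¬IsFactorW v [⓪, ⓪, ①, ①] ∧ ¬IsFactorW v [①, ①, ⓪,
        ⓪] := by
  have h1 := h.cube true
  have h2 := h.not_isFactorW_001100 hw
  have h3 := h.not_isFactorW_10101 hw
  have h4 := h.not_isFactorW_11011 hw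
  have h5 := h.excursion_unique hw
  constructor <;> intro hs'
  · exact h5.2.2 ⟨h.extend hs' 0 3 [[①, ①, ①], [①, ⓪, ①, ⓪, ①], [①, ①, ⓪, ①, ①],
      [⓪, ⓪, ①, ①, ⓪, ⓪]] _ ⟨h1, h3, h4, h2⟩
      (by decide), hs⟩
  · exact h5.2.2 ⟨h.extend hs' 3 0 [[①, ①, ①], [①, ⓪, ①, ⓪, ①], [①, ①, ⓪, ①, ①],
      [⓪, ⓪, ①, ①, ⓪, ⓪]] _ ⟨h1, h3, h4, h2⟩
      (by decide), hs⟩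

set_option maxRecDepth 4000 in
theorem false_of_good (h : IsCoded w v p q c) (hw : Good w) : False := by
  have h0 := h.cube false
  have h1 := h.cube true
  have h2 := h.not_isFactorW_01010 hw
  have h3 := h.not_isFactorW_10101 hw
  have h4 := h.not_isFactorW_11011 hw
  have h5 := h.not_isFactorW_00100 hw
  have h6 := h.not_isFactorW_001100 hw
  by_cases hc : IsFactorW v [⓪, ①, ⓪, ①, ①, ⓪, ①, ⓪]
  · obtain ⟨k1, k2⟩ := h.not_isFactorW_of_01011010 hw hc
    refine h.false_of_forced hw [⓪, ⓪, ①, ⓪, ①, ①, ⓪, ①, ⓪, ⓪] (l := 4 * p + 4 * q) (m := 4 * q)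
      (fun i hi => forced hi 8
        [[⓪, ⓪, ⓪], [⓪, ⓪, ①, ①], [⓪, ⓪, ①, ⓪, ⓪], [⓪, ①, ⓪, ①, ⓪], [①, ①, ①], [①, ①, ⓪, ⓪],
            [①, ①, ⓪, ①, ①], [①, ⓪, ①, ⓪, ①]]
        ⟨h0, k1, h5, h2, h1, k2, h4, h3⟩ (by decide)) ?_
    obtain rfl | rfl := h.zero <;> obtain rfl | rfl := h.one <;> decide
  have hb := (h.excursion_cases hw).resolve_right hc
  have hc' : ¬IsFactorW v [①, ⓪, ①, ⓪, ⓪, ①, ⓪, ①] := by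
    intro hs
    have h7 := h.compl.not_isFactorW_of_01011010 hw.compl (isFactorW_compl.2 hs)
    rw [isFactorW_compl, isFactorW_compl] at h7
    obtain ⟨t, ht, ht'⟩ := hb
    simp only [List.mem_cons, List.not_mem_nil, or_false] at ht
    rcases ht with rfl | rfl
    · exact h7.2 (isFactorW_of_infix (by decide) ht')
    · exact h7.1 (isFactorW_of_infix (by decide) ht')
  by_cases hs : IsFactorW v [⓪, ⓪, ①, ①]
  · have k1 : IsFactorW v [⓪, ⓪, ①, ①, ⓪, ①, ⓪] := by
      simpa using h.extend hs 0 3 [[①, ①, ①], [①, ⓪, ①, ⓪, ①], [①, ①, ⓪, ①, ①],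
          [⓪, ⓪, ①, ①, ⓪, ⓪]] [[⓪, ⓪, ①, ①, ⓪, ①, ⓪]] ⟨h1, h3, h4, h6⟩
        (by decide)
    have k2 : ¬IsFactorW v [⓪, ⓪, ①, ⓪] :=
      h.not_isFactorW_of_closed k1 7
        [[⓪, ⓪, ①, ①, ⓪, ①, ⓪], [⓪, ①, ①, ⓪, ①, ⓪, ⓪], [①, ①, ⓪, ①, ⓪, ⓪, ①],
            [①, ⓪, ①, ⓪, ⓪, ①, ⓪], [①, ⓪, ①, ⓪, ⓪, ①, ①], [⓪, ①, ⓪, ⓪, ①, ①, ⓪],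
            [①, ⓪, ⓪, ①, ①, ⓪, ①]]
        [[⓪, ⓪, ⓪], [①, ①, ①], [①, ⓪, ①, ⓪, ①], [①, ①, ⓪, ①, ①], [⓪, ⓪, ①, ⓪, ⓪],
            [⓪, ⓪, ①, ①, ⓪, ⓪], [①, ⓪, ①, ⓪, ⓪, ①, ⓪, ①]]
        ⟨h0, h1, h3, h4, h5, h6, hc'⟩ (by decide) (by decide) (by decide) (by decide)
    refine h.false_of_forced hw [⓪, ⓪, ①, ①, ⓪, ①, ⓪, ⓪] (l := 3 * p + 3 * q) (m := 3 * q)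
      (fun i hi => forced hi 6 [[⓪, ⓪, ⓪], [⓪, ⓪, ①, ⓪], [①, ①, ①], [⓪, ⓪, ①, ①, ⓪, ⓪],
          [①, ①, ⓪, ①, ①], [①, ⓪, ①, ⓪, ①]]
        ⟨h0, k2, h1, h6, h4, h3⟩ (by decide)) ?_
    obtain rfl | rfl := h.zero <;> obtain rfl | rfl := h.one <;> decide
  · have k1 : ¬IsFactorW v [⓪, ①, ⓪, ①, ①, ⓪, ①] := by
      intro hs'
      obtain ⟨t, ht, ht'⟩ := h.extend hs' 0 1 [[①, ①, ⓪, ①, ①]] [[⓪, ①, ⓪, ①, ①, ⓪, ①, ⓪]] h4 (by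
          decide)
      rw [List.mem_singleton] at ht
      exact hc (ht ▸ ht')
    refine h.false_of_forced hw [⓪, ⓪, ①, ⓪, ①, ①, ⓪, ⓪] (l := 3 * p + 3 * q) (m := 3 * q)
      (fun i hi => forced hi 6 [[⓪, ⓪, ⓪], [⓪, ⓪, ①, ①], [⓪, ⓪, ①, ⓪, ⓪], [⓪, ①, ⓪, ①, ⓪],
          [①, ①, ①], [⓪, ①, ⓪, ①, ①, ⓪, ①]]
        ⟨h0, hs, h5, h2, h1, k1⟩ (by decide)) ?_
    obtain rfl | rfl := h.zero <;> obtain rfl | rfl := h.one <;> decide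

end IsCoded

section Runs

variable {w : ℕ → Bool} {p k : ℕ}

theorem isRun_compl {a : Bool} : IsRun (fun x => !w x) a p k ↔ IsRun w (!a) p k := by
  simp [IsRun, Bool.not_eq_eq_eq_not]

theorem IsRun.exists_ge {a : Bool} (h : IsRun w a p k) (hw : Good w) (N : ℕ) :
    ∃ p', N ≤ p' ∧ IsRun w a p' k := by
  obtain ⟨j, hj, hj'⟩ := hw.recur p (k + 2) N
  obtain ⟨h1, h2, h3, h4⟩ := h
  refine ⟨j, hj, h1, by rw [← h2]; exact hj' 0 (by omega), fun i hi => ?_, ?_⟩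
  · rw [← h3 i hi, add_assoc, hj' _ (by omega), ← add_assoc]
  · rw [← h4, add_assoc, hj' _ (by omega), ← add_assoc]

theorem IsRun.hasRet_two (h : IsRun w false p k) : HasRet w 2 1 k 1 := by
  obtain ⟨h1, h2, h3, h4⟩ := h
  have h5 : ∀ x, p < x → x ≤ p + k → w x = false := fun x hx hx' => by
    rw [← h3 (x - p - 1) (by omega)]
    congr 1
    omega
  have h6 := ones_eq_zeros (w := w) (i := p + 1) (n := k) h3 (r := k - 1) (by omega)
  have h7 := h5 (p + 1) (by omega) (by omega)
  have h8 := h5 (p + k) (by omega) (by omega)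
  have h4' : w (p + k + 1) = true := by rw [← Bool.not_false, ← h4]; congr 1; omega
  refine ⟨p, ⟨by omega, ?_, ?_, fun x hx hx' => ?_⟩, ?_⟩
  · rw [ones_succ, ones_succ, h2, h7]; rfl
  · rw [ones_succ, ones_succ, h8, h4']; rfl
  · rw [ones_succ, ones_succ, h5 x hx (by omega), h5 (x + 1) (by omega) (by omega)]
    simp
  · rw [show p + k = p + 1 + (k - 1) by omega, h6, ones_succ, h2]; rfl

theorem IsRun.hasRet_three (h : IsRun w false p k) (hk : 2 ≤ k) : HasRet w 3 1 (k - 1) 1 := by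
  obtain ⟨h1, h2, h3, h4⟩ := h
  have h5 : ∀ x, p < x → x ≤ p + k → w x = false := fun x hx hx' => by
    rw [← h3 (x - p - 1) (by omega)]
    congr 1
    omega
  have h6 := ones_eq_zeros (w := w) (i := p + 1) (n := k) h3 (r := k - 2) (by omega)
  have h4' : w (p + (k - 1) + 2) = true := by rw [← Bool.not_false, ← h4]; congr 1; omega
  refine ⟨p, ⟨by omega, ?_, ?_, fun x hx hx' => ?_⟩, ?_⟩
  · rw [ones_succ, ones_succ, ones_succ, h2, h5 (p + 1) (by omega) (by omega),
      h5 (p + 2) (by omega) (by omega)]; rfl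
  · rw [ones_succ, ones_succ, ones_succ, h5 (p + (k - 1)) (by omega) (by omega),
      h5 (p + (k - 1) + 1) (by omega) (by omega), h4']; rfl
  · rw [ones_succ, ones_succ, ones_succ, h5 x hx (by omega), h5 (x + 1) (by omega) (by omega),
      h5 (x + 2) (by omega) (by omega)]
    simp
  · rw [show p + (k - 1) = p + 1 + (k - 2) by omega, h6, ones_succ, h2]; rfl

theorem IsRun.hasRet_three' (h : IsRun w true (p + 1) k) (hk : 2 ≤ k) (hp : w p = false)
    (hp' : w (p + k + 3) = false) : HasRet w 3 1 (k + 1) (k - 1) := by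
  obtain ⟨h1, h2, h3, h4⟩ := h
  have h5 : ∀ x, p + 1 < x → x ≤ p + 1 + k → w x = true := fun x hx hx' => by
    rw [← h3 (x - p - 2) (by omega)]
    congr 1
    omega
  have h6 := ones_eq_ones (w := w) (i := p + 1 + 1) (n := k) h3 (r := k - 1) (by omega)
  have h4' : w (p + (k + 1) + 1) = false := by rw [← Bool.not_true, ← h4]; congr 1; omega
  have hp'' : w (p + (k + 1) + 2) = false := by rw [← hp']; congr 1
  refine ⟨p, ⟨by omega, ?_, ?_, fun x hx hx' => ?_⟩, ?_⟩
  · rw [ones_succ, ones_succ, ones_succ, hp, h2, h5 (p + 2) (by omega) (by omega)]; rfl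
  · rw [ones_succ, ones_succ, ones_succ, h5 (p + (k + 1)) (by omega) (by omega), h4', hp'']; rfl
  · rw [ones_succ, ones_succ, ones_succ]
    rcases (show p + 1 ≤ x from hx).eq_or_lt with rfl | h7
    · rw [h5 (p + 1 + 1) (by omega) (by omega), h5 (p + 1 + 2) (by omega) (by omega)]
      simp; omega
    · rw [h5 x (by omega) (by omega), h5 (x + 1) (by omega) (by omega)]
      simp; omega
  · rw [show p + (k + 1) = p + 1 + 1 + (k - 1) by omega, h6, ones_succ, ones_succ, hp, h2]
    simp

end Runs

/-- The lengths of the runs of `a` in `w` are exactly `2` and `x`. -/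
def RunLengths (w : ℕ → Bool) (a : Bool) (x : ℕ) : Prop :=
  x ≠ 2 ∧ (∃ s, IsRun w a s 2) ∧ (∃ s, IsRun w a s x) ∧ ∀ s k, IsRun w a s k → k = 2 ∨ k = x

theorem runLengths_compl {w : ℕ → Bool} {a : Bool} {x : ℕ} :
    RunLengths (fun x => !w x) a x ↔ RunLengths w (!a) x := by
  simp [RunLengths, isRun_compl]

namespace Good

variable {w : ℕ → Bool}

theorem eq_two_or (hw : Good w) {a : Bool} {s₁ s₂ t₁ t₂ c₁ c₂ r₁ r₂ : ℕ} (h₁ : IsRun w a s₁ c₁)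
    (h₂ : IsRun w a s₂ c₂) (h₃ : IsRun w (!a) t₁ r₁) (h₄ : IsRun w (!a) t₂ r₂) (hc : c₁ ≠ c₂)
    (hr : r₁ ≠ r₂) : c₁ = 2 ∨ c₂ = 2 := by
  wlog ha : a = false generalizing w a
  · rw [Bool.not_eq_false] at ha
    subst ha
    exact this (w := fun x => !w x) (a := false) hw.compl (isRun_compl.2 h₁) (isRun_compl.2 h₂)
      (isRun_compl.2 h₃) (isRun_compl.2 h₄) rfl
  subst ha
  have e₃ := (isRun_compl (w := w) (a := false) |>.2 h₃).hasRet_two.compl.1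
  have e₄ := (isRun_compl (w := w) (a := false) |>.2 h₄).hasRet_two.compl.1
  have := h₃.1
  have := h₄.1
  by_contra! hcon
  exact hw.four (by omega) h₁.hasRet_two h₂.hasRet_two e₃ e₄ (by omega) (by omega) (by omega)
    (by omega) (by omega) (by omega)

theorem exists_runLengths (hw : Good w) {a : Bool} {s₁ s₂ t₁ t₂ c₁ c₂ r₁ r₂ : ℕ}
    (h₁ : IsRun w a s₁ c₁) (h₂ : IsRun w a s₂ c₂) (h₃ : IsRun w (!a) t₁ r₁)
    (h₄ : IsRun w (!a) t₂ r₂) (hc : c₁ ≠ c₂) (hr : r₁ ≠ r₂) : ∃ x, RunLengths w a x := by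
  wlog h : c₁ = 2 generalizing s₁ s₂ c₁ c₂
  · exact this h₂ h₁ hc.symm ((hw.eq_two_or h₁ h₂ h₃ h₄ hc hr).resolve_left h)
  subst h
  refine ⟨c₂, hc.symm, ⟨_, h₁⟩, ⟨_, h₂⟩, fun s k hk => ?_⟩
  by_contra! h
  have := hw.eq_two_or hk h₂ h₃ h₄ h.2 hr
  omega

/-- If some runs of `a` have length one, then no run of `!a` is longer than four. -/
theorem eq_four_of_one (hw : Good w) {a : Bool} {r : ℕ} (h1 : RunLengths w a 1)
    (h2 : RunLengths w (!a) r) (hr : 3 ≤ r) : r = 4 := by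
  wlog ha : a = true generalizing w a
  · rw [Bool.not_eq_true] at ha
    subst ha
    exact this (w := fun x => !w x) (a := true) hw.compl (runLengths_compl.2 h1)
      (runLengths_compl.2 h2) rfl
  subst ha
  have hlong : ∀ x, w x = true → w (x + 1) = false → w (x + 2) = false := by
    intro x hx hx'
    by_contra hc
    rw [Bool.not_eq_false] at hc
    have h3 : IsRun w false x 1 := ⟨le_rfl, hx, fun i hi => by
      obtain rfl : i = 0 := by omega
      exact hx', hc⟩
    have := h2.2.2.2 _ _ h3
    omega
  have hlong' : ∀ x, w x = false → w (x + 1) = true → 1 ≤ x → w (x - 1) = false := by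
    intro x hx hx' h1x
    by_contra hc
    rw [Bool.not_eq_false] at hc
    have h3 := hlong (x - 1) hc (by rwa [Nat.sub_add_cancel h1x])
    rw [show x - 1 + 2 = x + 1 by omega, hx'] at h3
    exact absurd h3 (by decide)
  obtain ⟨s₂, h₂⟩ := h2.2.1
  obtain ⟨s₃, h₃⟩ := h2.2.2.1
  have e₁ := h₂.hasRet_three le_rfl
  have e₂ := h₃.hasRet_three (by omega)
  obtain ⟨s₁, h₁⟩ := h1.2.2.1
  obtain ⟨s₄, h₄⟩ := h1.2.1
  obtain ⟨t₁, ht₁, k₁⟩ := h₁.exists_ge hw 1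
  obtain ⟨t₄, ht₄, k₄⟩ := h₄.exists_ge hw 1
  obtain ⟨t₄, rfl⟩ := Nat.exists_eq_add_of_le' ht₄
  have e₃ : HasRet w 3 1 1 0 := by
    have q1 := k₁.2.1
    have q2 := k₁.2.2.1 0 (by omega)
    have q3 := k₁.2.2.2
    have q4 := hlong' _ q1 q2 ht₁
    obtain ⟨t, rfl⟩ := Nat.exists_eq_add_of_le' ht₁
    refine ⟨t, ⟨by omega, ?_, ?_, fun x hx hx' => by omega⟩, ?_⟩
    · rw [ones_succ, ones_succ, ones_succ, show w t = false from q4, q1, q2]; rfl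
    · rw [ones_succ, ones_succ, ones_succ, q1, q2, q3]; rfl
    · rw [ones_succ, show w t = false from q4]; rfl
  have e₄ : HasRet w 3 1 3 1 := by
    refine k₄.hasRet_three' le_rfl (hlong' _ k₄.2.1 (k₄.2.2.1 0 (by omega)) ht₄) ?_
    exact hlong _ (k₄.2.2.1 1 (by omega)) k₄.2.2.2
  by_contra hr'
  exact hw.four (by omega) e₁ e₂ e₃ e₄ (by omega) (by omega) (by omega) (by omega) (by omega)
    (by omega)

/-- If the runs of `!a` are all of length at least two, then those of `a` are no longer than
four. -/
theorem eq_four_of_three_le (hw : Good w) {a : Bool} {g r : ℕ} (h1 : RunLengths w a g)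
    (h2 : RunLengths w (!a) r) (hg : 3 ≤ g) (hr : 3 ≤ r) : g = 4 := by
  wlog ha : a = false generalizing w a
  · rw [Bool.not_eq_false] at ha
    subst ha
    exact this (w := fun x => !w x) (a := false) hw.compl (runLengths_compl.2 h1)
      (runLengths_compl.2 h2) rfl
  subst ha
  have hlong : ∀ x, w x = true → w (x + 1) = false → w (x + 2) = false := by
    intro x hx hx'
    by_contra hc
    rw [Bool.not_eq_false] at hc
    have h3 : IsRun w false x 1 := ⟨le_rfl, hx, fun i hi => by
      obtain rfl : i = 0 := by omega
      exact hx', hc⟩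
    have := h1.2.2.2 _ _ h3
    omega
  have hret : ∀ s k, IsRun w true s k → 2 ≤ k → HasRet w 3 1 (k + 1) (k - 1) := by
    intro s k h hk
    obtain ⟨t, ht, h'⟩ := h.exists_ge hw 1
    obtain ⟨t, rfl⟩ := Nat.exists_eq_add_of_le' ht
    refine h'.hasRet_three' hk ?_ ?_
    · by_contra hc
      rw [Bool.not_eq_false] at hc
      have h3 := hlong t hc h'.2.1
      have h4 := h'.2.2.1 0 (by omega)
      rw [add_zero] at h4
      rw [h4] at h3
      exact absurd h3 (by decide)
    · have h3 := hlong (t + 1 + k) (by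
        rw [← h'.2.2.1 (k - 1) (by omega)]
        congr 1
        omega) (by
        rw [show t + 1 + k + 1 = t + 1 + 1 + k by omega]
        exact h'.2.2.2)
      rwa [show t + 1 + k + 2 = t + k + 3 by omega] at h3
  obtain ⟨s₁, h₁⟩ := h1.2.1
  obtain ⟨s₂, h₂⟩ := h1.2.2.1
  obtain ⟨s₃, h₃⟩ := h2.2.1
  obtain ⟨s₄, h₄⟩ := h2.2.2.1
  by_contra hg'
  exact hw.four (by omega) (h₁.hasRet_three le_rfl) (h₂.hasRet_three (by omega))
    (hret _ _ h₃ le_rfl) (hret _ _ h₄ (by omega)) (by omega) (by omega) (by omega) (by omega)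
    (by omega) (by omega)

/-- The runs of each letter in an unbalanced word have two lengths, one of them twice the other. -/
theorem exists_double (hw : Good w) (hu : Unbal w) (h : ∀ a N, ∃ q, N ≤ q ∧ w q = a) :
    ∃ ℓ : Bool → ℕ, ∀ a, (ℓ a = 1 ∨ ℓ a = 2) ∧ (∃ s, IsRun w a s (ℓ a)) ∧
      (∃ s, IsRun w a s (2 * ℓ a)) ∧ ∀ s k, IsRun w a s k → k = ℓ a ∨ k = 2 * ℓ a := by
  have hruns : ∀ a, ∃ s₁ s₂ k₁ k₂, IsRun w a s₁ k₁ ∧ IsRun w a s₂ k₂ ∧ k₁ ≠ k₂ := by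
    intro a
    by_contra! hcon
    obtain ⟨p₀, -, hp₀⟩ := h (!a) 0
    obtain ⟨q₀, hq₀, hq₀'⟩ := h a p₀
    obtain ⟨s, -, -, hs, hs'⟩ := exists_change hq₀ hp₀ hq₀'
    obtain ⟨t, ht⟩ := exists_isRun (h (!a)) hs hs'
    cases a with
    | true =>
      exact hw.false_of_runs_eq hu (h false) (h true) fun p k hk => hcon _ _ _ _ hk ht
    | false =>
      refine hw.compl.false_of_runs_eq hu.compl (t := t) (fun N => ?_) (fun N => ?_) fun p k hk =>
        hcon _ _ _ _ (isRun_compl.1 hk) ht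
      · simpa using h true N
      · simpa using h false N
  have hlen : ∀ a, ∃ x, RunLengths w a x := by
    intro a
    obtain ⟨s₁, s₂, c₁, c₂, h₁, h₂, hc⟩ := hruns a
    obtain ⟨t₁, t₂, r₁, r₂, h₃, h₄, hr⟩ := hruns (!a)
    exact hw.exists_runLengths h₁ h₂ h₃ h₄ hc hr
  choose x hx using hlen
  have hcases : ∀ a, x a = 1 ∨ x a = 4 := by
    intro a
    have h1 := (hx a).1
    obtain ⟨s, hs⟩ := (hx a).2.2.1
    have h2 := hs.1
    have h1' := (hx (!a)).1
    obtain ⟨s', hs'⟩ := (hx (!a)).2.2.1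
    have h2' := hs'.1
    by_contra! hcon
    rcases (show x (!a) = 1 ∨ 3 ≤ x (!a) by omega) with h3 | h3
    · have h4 := hw.eq_four_of_one (a := !a) (r := x a) (h3 ▸ hx (!a)) (by simpa using hx a)
        (by omega)
      omega
    · have h4 := hw.eq_four_of_three_le (hx a) (hx (!a)) (by omega) h3
      omega
  refine ⟨fun a => if x a = 1 then 1 else 2, fun a => ?_⟩
  obtain ⟨-, h2, h3, h4⟩ := hx a
  rcases hcases a with h5 | h5 <;> rw [h5] at h3 h4 <;> simp only [h5]
  · exact ⟨by simp, h3, h2, fun s k hk => (h4 s k hk).symm⟩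
  · exact ⟨by simp, h2, h3, h4⟩

end Good

section Coding

variable {w : ℕ → Bool} {ℓ : Bool → ℕ}

/-- `x` starts a block when each run of a letter `a` is cut into one or two blocks of length
`ℓ a`. -/
def IsCut (w : ℕ → Bool) (ℓ : Bool → ℕ) (x : ℕ) : Prop :=
  ∃ a s k, IsRun w a s k ∧ (k = ℓ a ∧ x = s + 1 ∨ k = 2 * ℓ a ∧ (x = s + 1 ∨ x = s + 1 + ℓ a))

theorem IsCut.next (hx : IsCut w ℓ x) (h : ∀ a N, ∃ q, N ≤ q ∧ w q = a) (hpos : ∀ a, 1 ≤ ℓ a)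
    (hk : ∀ a s k, IsRun w a s k → k = ℓ a ∨ k = 2 * ℓ a) :
    (∀ r, r < ℓ (w x) → w (x + r) = w x) ∧ IsCut w ℓ (x + ℓ (w x)) ∧
      ∃ y, x ≤ y ∧ y ≤ x + 2 * ℓ (w x) ∧ w y = !w x := by
  obtain ⟨a, s, k, hr, hx⟩ := hx
  have ha := hpos a
  have h1 : ∀ y, s + 1 ≤ y → y < s + 1 + k → w y = a := fun y hy hy' => by
    rw [← hr.2.2.1 (y - (s + 1)) (by omega), Nat.add_sub_cancel' hy]
  have h2 : w x = a := h1 x (by omega) (by omega)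
  rw [h2]
  refine ⟨fun r hr => h1 _ (by omega) (by omega), ?_, s + 1 + k, by omega, by omega, hr.2.2.2⟩
  have hend : IsCut w ℓ (s + k + 1) := by
    obtain ⟨k', hk'⟩ := exists_isRun (c := w) (a := !a) (p := s + k) (h _)
      (by rw [Bool.not_not]; exact h1 _ (by have := hr.1; omega) (by omega))
      (by rw [show s + k + 1 = s + 1 + k by omega]; exact hr.2.2.2)
    rcases hk _ _ _ hk' with h3 | h3
    · exact ⟨_, _, _, hk', Or.inl ⟨h3, rfl⟩⟩
    · exact ⟨_, _, _, hk', Or.inr ⟨h3, Or.inl rfl⟩⟩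
  rcases hx with ⟨h3, rfl⟩ | ⟨h3, rfl | rfl⟩
  · rwa [show s + 1 + ℓ a = s + k + 1 by omega]
  · exact ⟨_, _, _, hr, Or.inr ⟨h3, Or.inr rfl⟩⟩
  · rwa [show s + 1 + ℓ a + ℓ a = s + k + 1 by omega]

/-- The successive block starts from `x` on. -/
def cuts (w : ℕ → Bool) (ℓ : Bool → ℕ) (x : ℕ) : ℕ → ℕ
  | 0 => x
  | i + 1 => cuts w ℓ x i + ℓ (w (cuts w ℓ x i))

theorem cuts_succ (w : ℕ → Bool) (ℓ : Bool → ℕ) (x i : ℕ) :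
    cuts w ℓ x (i + 1) = cuts w ℓ x i + ℓ (w (cuts w ℓ x i)) := rfl

theorem cuts_strictMono (hpos : ∀ a, 1 ≤ ℓ a) (x : ℕ) : StrictMono (cuts w ℓ x) :=
  strictMono_nat_of_lt_succ fun i => by
    have := hpos (w (cuts w ℓ x i))
    rw [cuts_succ]
    omega

theorem exists_eq_cuts (hpos : ∀ a, 1 ≤ ℓ a) {x y : ℕ}
    (hblock : ∀ i r, r < ℓ (w (cuts w ℓ x i)) → w (cuts w ℓ x i + r) = w (cuts w ℓ x i))
    (hxy : x ≤ y) (hy : w (y + 1) = !w y) : ∃ m, y + 1 = cuts w ℓ x (m + 1) := by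
  classical
  have hex : ∃ m, y < cuts w ℓ x m := ⟨y + 1, (cuts_strictMono hpos x).id_le (y + 1)⟩
  have h1 := Nat.find_spec hex
  rcases h2 : Nat.find hex with _ | m
  · rw [h2] at h1
    exact absurd h1 (by simpa [cuts] using hxy)
  · have h3 := Nat.find_min hex (m := m) (by omega)
    rw [h2] at h1
    refine ⟨m, ?_⟩
    by_contra h4
    have h5 := cuts_succ w ℓ x m
    have h6 := hblock m (y - cuts w ℓ x m) (by omega)
    have h7 := hblock m (y + 1 - cuts w ℓ x m) (by omega)
    rw [Nat.add_sub_cancel' (by omega)] at h6 h7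
    rw [h7, h6] at hy
    simp at hy

theorem Good.exists_isCoded (hw : Good w) (h : ∀ a N, ∃ q, N ≤ q ∧ w q = a)
    (hℓ : ∀ a, (ℓ a = 1 ∨ ℓ a = 2) ∧ (∃ s, IsRun w a s (ℓ a)) ∧
      (∃ s, IsRun w a s (2 * ℓ a)) ∧ ∀ s k, IsRun w a s k → k = ℓ a ∨ k = 2 * ℓ a) :
    ∃ v c, IsCoded w v (ℓ false) (ℓ true) c := by
  have hpos : ∀ a, 1 ≤ ℓ a := fun a => by have := (hℓ a).1; omega
  have hk := fun a => (hℓ a).2.2.2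
  have hcond : ∀ a, cond a (ℓ true) (ℓ false) = ℓ a := fun a => by cases a <;> rfl
  obtain ⟨x, hx⟩ := (hℓ true).2.1
  have hcut : ∀ i, IsCut w ℓ (cuts w ℓ (x + 1) i) := by
    intro i
    induction i with
    | zero => exact ⟨_, _, _, hx, Or.inl ⟨rfl, rfl⟩⟩
    | succ i ih => exact (ih.next h hpos hk).2.1
  have hblock := fun i => ((hcut i).next h hpos hk).1
  have hmono := cuts_strictMono (w := w) hpos (x + 1)
  have hrun : ∀ a s k, IsRun w a s k → ∃ m, w (cuts w ℓ (x + 1) m) = !a ∧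
      ∃ t, cuts w ℓ (x + 1) (m + 1) = t + 1 ∧ IsRun w a t k := by
    intro a s k hs
    obtain ⟨t, ht, ht'⟩ := hs.exists_ge hw (x + 1)
    have h1 := ht'.2.2.1 0 ht'.1
    rw [add_zero] at h1
    obtain ⟨m, hm⟩ := exists_eq_cuts hpos hblock ht (by rw [h1, ht'.2.1, Bool.not_not])
    refine ⟨m, ?_, t, hm.symm, ht'⟩
    have h2 := cuts_succ w ℓ (x + 1) m
    have h3 := hpos (w (cuts w ℓ (x + 1) m))
    rw [← hblock m (t - cuts w ℓ (x + 1) m) (by omega), Nat.add_sub_cancel' (by omega), ht'.2.1]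
  refine ⟨fun i => w (cuts w ℓ (x + 1) i), cuts w ℓ (x + 1), (hℓ false).1, (hℓ true).1,
    fun i => by rw [hcond, cuts_succ], fun i r hr => hblock i r (by rwa [hcond] at hr),
    fun i n N => ?_, fun a ⟨i, hi⟩ => ?_, fun a => ?_, fun a => ?_⟩
  · obtain ⟨j, hj, hj'⟩ := hw.recur x (cuts w ℓ (x + 1) (i + n) + 2)
      (max (x + 1) (cuts w ℓ (x + 1) N))
    have h1 := hx.2.1
    have h2 := hx.2.2.1 0 hx.1
    obtain ⟨m, hm⟩ := exists_eq_cuts hpos hblock (y := j) (by omega) (by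
      rw [hj' 1 (by omega), ← add_zero j, hj' 0 (by omega)]
      rw [add_zero] at h2 ⊢
      rw [h1, h2, Bool.not_not])
    have hN : N < m + 1 := hmono.lt_iff_lt.1 (by omega)
    have hval : ∀ y, y ≤ i + n →
        cuts w ℓ (x + 1) (m + 1 + y) + (x + 1) = cuts w ℓ (x + 1) y + (j + 1) →
          w (cuts w ℓ (x + 1) (m + 1 + y)) = w (cuts w ℓ (x + 1) y) := by
      intro y hy h3
      have h4 := hmono.monotone hy
      have h5 : x + 1 ≤ cuts w ℓ (x + 1) y := hmono.monotone (Nat.zero_le y)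
      have h6 := hj' (cuts w ℓ (x + 1) y - x) (by omega)
      rwa [show j + (cuts w ℓ (x + 1) y - x) = cuts w ℓ (x + 1) (m + 1 + y) by omega,
        Nat.add_sub_cancel' (by omega)] at h6
    have key : ∀ y, y ≤ i + n →
        cuts w ℓ (x + 1) (m + 1 + y) + (x + 1) = cuts w ℓ (x + 1) y + (j + 1) := by
      intro y hy
      induction y with
      | zero => rw [add_zero, ← hm, cuts]; omega
      | succ y ih =>
        have h3 := ih (by omega)
        have h4 := hval y (by omega) h3
        rw [show m + 1 + (y + 1) = m + 1 + y + 1 by omega, cuts_succ, cuts_succ, h4]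
        omega
    exact ⟨m + 1 + i, by omega, fun r hr => by
      rw [show m + 1 + i + r = m + 1 + (i + r) by omega]
      exact hval _ (by omega) (key (i + r) (by omega))⟩
  · obtain ⟨h1, h2, h3⟩ : a = w (cuts w ℓ (x + 1) i) ∧ a = w (cuts w ℓ (x + 1) (i + 1)) ∧
        a = w (cuts w ℓ (x + 1) (i + 2)) := by
      simpa [wordAt, List.range_succ] using hi
    obtain ⟨y, hy, hy', hy''⟩ := ((hcut i).next h hpos hk).2.2
    have e1 := cuts_succ w ℓ (x + 1) i
    have e2 : cuts w ℓ (x + 1) (i + 2) = _ := cuts_succ w ℓ (x + 1) (i + 1)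
    have b1 := hblock i (y - cuts w ℓ (x + 1) i)
    have b2 := hblock (i + 1) (y - cuts w ℓ (x + 1) (i + 1))
    have b3 := hblock (i + 2) (y - cuts w ℓ (x + 1) (i + 2))
    rw [← h1] at e1 b1 hy' hy''
    rw [← h2] at e2 b2
    rw [← h3] at b3
    have : w y = a := by
      have := hpos a
      rcases lt_or_ge y (cuts w ℓ (x + 1) (i + 1)) with h4 | h4
      · rw [← b1 (by omega), Nat.add_sub_cancel' (by omega)]
      rcases lt_or_ge y (cuts w ℓ (x + 1) (i + 2)) with h5 | h5
      · rw [← b2 (by omega), Nat.add_sub_cancel' (by omega)]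
      · rw [← b3 (by omega), Nat.add_sub_cancel' (by omega)]
    rw [this] at hy''
    simp at hy''
  · obtain ⟨s, hs⟩ := (hℓ a).2.1
    obtain ⟨m, hm, t, ht, hr⟩ := hrun _ _ _ hs
    have h1 := hr.2.2.1 0 hr.1
    rw [add_zero, ← ht] at h1
    have h2 := hr.2.2.2
    rw [← ht] at h2
    have e1 : cuts w ℓ (x + 1) (m + 2) = _ := cuts_succ w ℓ (x + 1) (m + 1)
    rw [h1] at e1
    exact ⟨m, by simp [wordAt, List.range_succ, hm, h1, e1, h2]⟩
  · obtain ⟨s, hs⟩ := (hℓ a).2.2.1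
    obtain ⟨m, hm, t, ht, hr⟩ := hrun _ _ _ hs
    have h1 := hr.2.2.1 0 hr.1
    rw [add_zero, ← ht] at h1
    have h2 := hr.2.2.2
    have h3 := hr.2.2.1 (ℓ a) (by have := hpos a; omega)
    rw [← ht] at h2 h3
    have e1 : cuts w ℓ (x + 1) (m + 2) = _ := cuts_succ w ℓ (x + 1) (m + 1)
    rw [h1] at e1
    have e2 : cuts w ℓ (x + 1) (m + 3) = _ := cuts_succ w ℓ (x + 1) (m + 2)
    rw [e1, h3, add_assoc, ← two_mul] at e2
    exact ⟨m, by simp [wordAt, List.range_succ, hm, h1, e1, h3, e2, h2]⟩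

end Coding

theorem Good.not_unbal {w : ℕ → Bool} (hw : Good w) : ¬Unbal w := by
  intro hu
  have hio : ∀ x N, ∃ q, N ≤ q ∧ w q = w x := fun x N => by
    obtain ⟨j, hj, hj'⟩ := hw.recur x 1 N
    exact ⟨j, hj, hj' 0 (by omega)⟩
  have h : ∀ a N, ∃ q, N ≤ q ∧ w q = a := by
    intro a N
    by_cases hx : ∃ x, w x = a
    · obtain ⟨x, rfl⟩ := hx
      exact hio x N
    · push Not at hx
      obtain ⟨n, x, y, hxy⟩ := hu
      exfalso
      cases a with
      | true =>
        have h1 : ∀ i, ones w (i + n) = ones w i := fun i =>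
          ones_eq_zeros (fun r _ => by simpa using hx (i + r)) le_rfl
        rw [h1, h1] at hxy
        omega
      | false =>
        have h1 : ∀ i, ones w (i + n) = ones w i + n := fun i =>
          ones_eq_ones (fun r _ => by simpa using hx (i + r)) le_rfl
        rw [h1, h1] at hxy
        omega
  obtain ⟨ℓ, hℓ⟩ := hw.exists_double hu h
  obtain ⟨v, c, hc⟩ := hw.exists_isCoded h hℓ
  exact hc.false_of_good hw

/-- If every factor of a recurrent binary word has at most three abelian returns and at
least two semi-abelian returns, then the word is 2-balanced. -/
theorem stmt13 (w : ℕ → Bool) (hrec : RecurrentW w)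
    (h : ∀ u, IsFactorW w u → u ≠ [] →
      AtMostKAbReturns w u 3 ∧ AtLeastTwoSemiAbReturns w u) :
    CBalanced w 2 := cBalanced_of_not_unbal (good_of_returns w hrec h).not_unbal
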